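/- arXiv:2302.05183 — 2 statements merged into one kernel-verified Lean document; each statement's English description precedes it below -/
import Mathlib

section
/- Frequency-preserving KAM theorem for perturbed rotations with continuous parameter dependence (Theorem 3.4, with the topological degree condition realized by injectivity). Let n ≥ 1 and let Λ ⊂ ℝⁿ be a connected compact set with nonempty interior Λ°. Let ω : Λ → ℝⁿ be continuous and injective, let ξ* ∈ Λ° and q = ω(ξ*), and assume: (i) q is (γ,τ)-Diophantine for some γ > 0 and τ > n−1; (ii) there exist δ > 0 with B̄(ξ*,δ) ⊂ Λ° and a modulus of continuity ϖ₂ such that |ω(ξ′) − ω(ξ″)| ≥ ϖ₂(|ξ′ − ξ″|) for all ξ′, ξ″ ∈ B̄(ξ*,δ) with 0 < |ξ′ − ξ″| ≤ 1. Let ϖ₁ be a modulus of continuity with limsup_{x→0+} ϖ₁(x)/ϖ₂(x) < ∞, let h > 0, M > 0, and for each ε ∈ (0,1] let f(·,ξ,ε) : D(h) → ℂⁿ be holomorphic for each ξ ∈ Λ, 2π-periodic in each component of θ, real-valued for real arguments, with sup_{D(h)×Λ} |f| ≤ M, and uniformly ϖ₁-continuous in ξ: sup_{θ∈D(h)} |f(θ,ξ′,ε)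 − f(θ,ξ″,ε)| ≤ M ϖ₁(|ξ′ − ξ″|) whenever 0 < |ξ′ − ξ″| ≤ 1. Then there exists ε₀ > 0 such that for every ε ∈ (0,ε₀) there exist ξ_∞ ∈ Λ and a continuous map U_ε : T^n → T^n with sup_θ dist(U_ε(θ), θ) → 0 as ε → 0, satisfying U_ε(θ + q) = U_ε(θ) + ω(ξ_∞) + ε f(U_ε(θ), ξ_∞, ε) (mod 2πℤⁿ) for all θ ∈ T^n; that is, the mapping θ ↦ θ + ω(ξ_∞) + ε f(θ, ξ_∞, ε) on T^n is conjugated by U_ε to the rigid rotation θ ↦ θ + q with the prescribed frequency q. -/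
open scoped Real

noncomputable section

/-- A modulus of continuity: a strictly increasing continuous function on `(0,∞)`,
positive there, tending to `0` at `0⁺`, with `limsup_{x→0⁺} x/ϖ(x) < ∞`. -/
def IsModulusOfContinuity (ϖ : ℝ → ℝ) : Prop :=
  StrictMonoOn ϖ (Set.Ioi 0) ∧ ContinuousOn ϖ (Set.Ioi 0) ∧ (∀ x > 0, 0 < ϖ x) ∧
  Filter.Tendsto ϖ (nhdsWithin 0 (Set.Ioi 0)) (nhds 0) ∧
  ∃ C > 0, ∀ᶠ x in nhdsWithin 0 (Set.Ioi 0), x ≤ C * ϖ x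

/-- Two points of `ℝⁿ` project to the same point of the torus `ℝⁿ/2πℤⁿ`. -/
def ProjEq {n : ℕ} (x y : Fin n → ℝ) : Prop :=
  ∃ m : Fin n → ℤ, ∀ i, y i = x i + 2 * π * (m i)

/-- The character `θ ↦ exp (i ⟨k, θ⟩)`. -/
def torusChar {n : ℕ} (k : Fin n → ℤ) (θ : Fin n → ℝ) : ℂ :=
  Complex.exp (((∑ i, (k i : ℝ) * θ i : ℝ) : ℂ) * Complex.I)

/-- The `ℓ¹`-length of a multi-index. -/
def freqLen {n : ℕ} (k : Fin n → ℤ) : ℝ := ∑ i, |(k i : ℝ)|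

/-- `F` is a real Fourier series in `θ`, with coefficients depending continuously on a parameter
in `X`, whose weighted `ℓ¹`-norm with weight `exp (ρ |k|)` is at most `c`. -/
def FourierBound {n : ℕ} {X : Type*} [TopologicalSpace X] [CompactSpace X] (ρ c : ℝ)
    (F : X → (Fin n → ℝ) → ℝ) : Prop :=
  ∃ a : (Fin n → ℤ) → C(X, ℂ), Summable (fun k => ‖a k‖ * Real.exp (ρ * freqLen k)) ∧
    ∑' k, ‖a k‖ * Real.exp (ρ * freqLen k) ≤ c ∧
    ∀ x θ, HasSum (fun k => (a k x * torusChar k θ).re) (F x θ)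

section Characters

variable {n : ℕ}

lemma norm_torusChar (k : Fin n → ℤ) (θ : Fin n → ℝ) : ‖torusChar k θ‖ = 1 := by
  rw [torusChar, Complex.norm_exp_ofReal_mul_I]

lemma torusChar_add_apply (k : Fin n → ℤ) (θ η : Fin n → ℝ) :
    torusChar k (θ + η) = torusChar k θ * torusChar k η := by
  simp only [torusChar, ← Complex.exp_add]
  congr 1
  simp only [Pi.add_apply, mul_add, Finset.sum_add_distrib]
  push_cast
  ring

lemma torusChar_add (k l : Fin n → ℤ) (θ : Fin n → ℝ) :
    torusChar (k + l) θ = torusChar k θ * torusChar l θ := by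
  simp only [torusChar, ← Complex.exp_add]
  congr 1
  simp only [Pi.add_apply, Int.cast_add, add_mul, Finset.sum_add_distrib]
  push_cast
  ring

lemma torusChar_neg (k : Fin n → ℤ) (θ : Fin n → ℝ) :
    torusChar (-k) θ = starRingEnd ℂ (torusChar k θ) := by
  simp only [torusChar, ← Complex.exp_conj]
  congr 1
  simp

lemma torusChar_zero (θ : Fin n → ℝ) : torusChar 0 θ = 1 := by
  simp [torusChar]

lemma freqLen_nonneg (k : Fin n → ℤ) : 0 ≤ freqLen k :=
  Finset.sum_nonneg fun _ _ => abs_nonneg _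

lemma freqLen_zero : freqLen (0 : Fin n → ℤ) = 0 := by simp [freqLen]

lemma freqLen_add_le (k l : Fin n → ℤ) : freqLen (k + l) ≤ freqLen k + freqLen l := by
  simp only [freqLen, ← Finset.sum_add_distrib]
  refine Finset.sum_le_sum fun i _ => ?_
  simpa using abs_add_le (k i : ℝ) (l i)

lemma freqLen_neg (k : Fin n → ℤ) : freqLen (-k) = freqLen k := by simp [freqLen]

lemma abs_le_freqLen (k : Fin n → ℤ) (i : Fin n) : |(k i : ℝ)| ≤ freqLen k :=
  Finset.single_le_sum (f := fun i => |(k i : ℝ)|) (fun _ _ => abs_nonneg _) (Finset.mem_univ i)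

lemma one_le_freqLen {k : Fin n → ℤ} (hk : k ≠ 0) : 1 ≤ freqLen k := by
  obtain ⟨i, hi⟩ := Function.ne_iff.mp hk
  refine le_trans ?_ (abs_le_freqLen k i)
  exact_mod_cast Int.one_le_abs hi

end Characters

namespace FourierBound

variable {n : ℕ} {X : Type*} [TopologicalSpace X] [CompactSpace X] {ρ c d : ℝ}
  {F G : X → (Fin n → ℝ) → ℝ}

lemma norm_term_le (a : C(X, ℂ)) (x : X) (k : Fin n → ℤ) (θ : Fin n → ℝ) :
    ‖(a x * torusChar k θ).re‖ ≤ ‖a‖ := by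
  refine (Complex.abs_re_le_norm _).trans ?_
  rw [norm_mul, norm_torusChar, mul_one]
  exact a.norm_coe_le_norm x

lemma nonneg (hF : FourierBound ρ c F) : 0 ≤ c := by
  obtain ⟨a, -, hc, -⟩ := hF
  exact (tsum_nonneg fun k => by positivity).trans hc

lemma mono (hF : FourierBound ρ c F) {ρ' c' : ℝ} (hρ : ρ' ≤ ρ) (hc : c ≤ c') :
    FourierBound ρ' c' F := by
  obtain ⟨a, hs, hc', ha⟩ := hF
  have hle : ∀ k, ‖a k‖ * Real.exp (ρ' * freqLen k) ≤ ‖a k‖ * Real.exp (ρ * freqLen k) := by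
    intro k
    have := freqLen_nonneg k
    gcongr
  have hs' := Summable.of_nonneg_of_le (fun k => by positivity) hle hs
  exact ⟨a, hs', (hs'.tsum_le_tsum hle hs).trans (hc'.trans hc), ha⟩

lemma abs_le (hF : FourierBound ρ c F) (hρ : 0 ≤ ρ) (x : X) (θ : Fin n → ℝ) : |F x θ| ≤ c := by
  obtain ⟨a, hs, hc, ha⟩ := hF
  refine le_trans ?_ hc
  rw [← (ha x θ).tsum_eq]
  refine tsum_of_norm_bounded hs.hasSum fun k => (norm_term_le _ _ _ _).trans ?_
  have := freqLen_nonneg k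
  exact le_mul_of_one_le_right (norm_nonneg _) (Real.one_le_exp (by positivity))

lemma congr (hF : FourierBound ρ c F) (h : ∀ x θ, G x θ = F x θ) : FourierBound ρ c G := by
  obtain rfl : G = F := funext fun x => funext fun θ => h x θ
  exact hF

/-- A single Fourier mode. -/
lemma mode (b : C(X, ℂ)) (l : Fin n → ℤ) :
    FourierBound ρ (‖b‖ * Real.exp (ρ * freqLen l)) fun x θ => (b x * torusChar l θ).re := by
  classical
  have h0 : ∀ k ≠ l, ‖(if k = l then b else 0 : C(X, ℂ))‖ * Real.exp (ρ * freqLen k) = 0 := by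
    intro k hk
    simp [hk]
  have h1 := hasSum_single l h0
  refine ⟨fun k => if k = l then b else 0, h1.summable, by simpa using h1.tsum_eq.le, ?_⟩
  intro x θ
  have := hasSum_single (f := fun k => ((if k = l then b else 0 : C(X, ℂ)) x * torusChar k θ).re)
    l (by intro k hk; simp [hk])
  simpa using this

lemma const (m : C(X, ℝ)) (hm : ∀ x, |m x| ≤ c) (hc : 0 ≤ c) :
    FourierBound (n := n) ρ c fun x _ => m x := by
  have h := mode (n := n) (ρ := ρ) (⟨fun x => (m x : ℂ), by fun_prop⟩ : C(X, ℂ)) 0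
  have h2 : FourierBound (n := n) ρ
      (‖(⟨fun x => (m x : ℂ), by fun_prop⟩ : C(X, ℂ))‖ * Real.exp (ρ * freqLen (0 : Fin n → ℤ)))
      fun x _ => m x := h.congr fun x θ => by simp [torusChar_zero]
  refine h2.mono le_rfl ?_
  rw [freqLen_zero, mul_zero, Real.exp_zero, mul_one]
  exact (ContinuousMap.norm_le _ hc).2 fun x => by simpa using hm x

lemma zero : FourierBound (n := n) (X := X) ρ 0 fun _ _ => 0 := by
  simpa using const (n := n) (X := X) (ρ := ρ) (c := 0) 0 (by simp) le_rfl

lemma one : FourierBound (n := n) (X := X) ρ 1 fun _ _ => 1 := by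
  simpa using const (n := n) (X := X) (ρ := ρ) (c := 1) 1 (by simp) zero_le_one

/-- A convergent series of Fourier-bounded functions. -/
lemma hasSum {J : Type*} {F : J → X → (Fin n → ℝ) → ℝ} {c : J → ℝ} {S : X → (Fin n → ℝ) → ℝ}
    (hρ : 0 ≤ ρ) (hF : ∀ j, FourierBound ρ (c j) (F j)) (hc : Summable c)
    (hS : ∀ x θ, HasSum (fun j => F j x θ) (S x θ)) :
    FourierBound ρ (∑' j, c j) S := by
  choose a hs hc' ha using hF
  have hone : ∀ k : Fin n → ℤ, 1 ≤ Real.exp (ρ * freqLen k) := fun k =>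
    Real.one_le_exp (mul_nonneg hρ (freqLen_nonneg k))
  have hsum : Summable fun p : J × (Fin n → ℤ) => ‖a p.1 p.2‖ * Real.exp (ρ * freqLen p.2) := by
    rw [summable_prod_of_nonneg fun p => by positivity]
    exact ⟨hs, Summable.of_nonneg_of_le (fun j => tsum_nonneg fun k => by positivity) hc' hc⟩
  have hsum1 : Summable fun p : J × (Fin n → ℤ) => ‖a p.1 p.2‖ :=
    Summable.of_nonneg_of_le (fun p => norm_nonneg _)
      (fun p => le_mul_of_one_le_right (norm_nonneg _) (hone p.2)) hsum
  have hsw := hsum.prod_symm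
  have hsw1 := hsum1.prod_symm
  have hk : ∀ k, Summable fun j => ‖a j k‖ := fun k => hsw1.prod_factor k
  have hle : ∀ k, ‖∑' j, a j k‖ * Real.exp (ρ * freqLen k)
      ≤ ∑' j, ‖a j k‖ * Real.exp (ρ * freqLen k) := by
    intro k
    rw [tsum_mul_right]
    gcongr
    exact norm_tsum_le_tsum_norm (hk k)
  have hs3 : Summable fun k => ∑' j, ‖a j k‖ * Real.exp (ρ * freqLen k) := hsw.prod
  have hs4 := Summable.of_nonneg_of_le (fun k => by positivity) hle hs3
  refine ⟨fun k => ∑' j, a j k, hs4, ?_, ?_⟩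
  · refine (hs4.tsum_le_tsum hle hs3).trans ?_
    rw [hsum.tsum_comm]
    exact hsum.prod.tsum_le_tsum hc' hc
  · intro x θ
    have hT : Summable fun p : J × (Fin n → ℤ) => (a p.1 p.2 x * torusChar p.2 θ).re :=
      Summable.of_norm_bounded hsum1 fun p => norm_term_le _ _ _ _
    have h1 : HasSum (fun p : J × (Fin n → ℤ) => (a p.1 p.2 x * torusChar p.2 θ).re) (S x θ) := by
      have := hT.hasSum.prod_fiberwise fun j => ha j x θ
      rw [← this.unique (hS x θ)]
      exact hT.hasSum
    have h2 : HasSum (fun p : (Fin n → ℤ) × J => (a p.2 p.1 x * torusChar p.1 θ).re) (S x θ) :=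
      (Equiv.prodComm _ _).hasSum_iff.1 h1
    refine h2.prod_fiberwise fun k => ?_
    have h3 : HasSum (fun j => a j k) (∑' j, a j k) := (hk k).of_norm.hasSum
    have h4 : HasSum (fun j => a j k x) ((∑' j, a j k) x) :=
      h3.mapL (ContinuousMap.evalCLM ℂ x)
    exact (h4.mul_right (torusChar k θ)).mapL Complex.reCLM

lemma sum {J : Type*} [Fintype J] {F : J → X → (Fin n → ℝ) → ℝ} {c : J → ℝ}
    (hρ : 0 ≤ ρ) (hF : ∀ j, FourierBound ρ (c j) (F j)) :
    FourierBound ρ (∑ j, c j) fun x θ => ∑ j, F j x θ := by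
  rw [← tsum_fintype (L := .unconditional J)]
  exact hasSum hρ hF (hasSum_fintype c).summable fun x θ => hasSum_fintype _

lemma add (hρ : 0 ≤ ρ) (hF : FourierBound ρ c F) (hG : FourierBound ρ d G) :
    FourierBound ρ (c + d) fun x θ => F x θ + G x θ := by
  have := sum (J := Bool) (F := fun b => if b then F else G) (c := fun b => if b then c else d)
    hρ (by rintro (_ | _) <;> simpa)
  simpa using this

lemma const_mul (hF : FourierBound ρ c F) (s : ℝ) :
    FourierBound ρ (|s| * c) fun x θ => s * F x θ := by
  obtain ⟨a, hs, hc, ha⟩ := hF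
  have hn : ∀ k, ‖(s : ℂ) • a k‖ * Real.exp (ρ * freqLen k)
      = |s| * (‖a k‖ * Real.exp (ρ * freqLen k)) := by
    intro k
    rw [norm_smul, Complex.norm_real, Real.norm_eq_abs, mul_assoc]
  refine ⟨fun k => (s : ℂ) • a k, ?_, ?_, fun x θ => ?_⟩
  · simp_rw [hn]; exact hs.mul_left _
  · simp_rw [hn]; rw [tsum_mul_left]; gcongr
  · have h : ∀ k, (((s : ℂ) • a k) x * torusChar k θ).re = s * (a k x * torusChar k θ).re := by
      intro k
      rw [← Complex.re_ofReal_mul]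
      simp [mul_assoc]
    simp_rw [h]
    exact (ha x θ).mul_left s

/-- Multiplication by a Fourier mode. -/
lemma mode_mul (hF : FourierBound ρ c F) (hρ : 0 ≤ ρ) (b : C(X, ℂ)) (l : Fin n → ℤ) :
    FourierBound ρ (‖b‖ * Real.exp (ρ * freqLen l) * c)
      fun x θ => (b x * torusChar l θ).re * F x θ := by
  obtain ⟨a, hs, hc, ha⟩ := hF
  have key : ∀ (e : C(X, ℂ)) (m : Fin n → ℤ), ‖e‖ ≤ ‖b‖ → freqLen m = freqLen l → ∀ k,
      FourierBound ρ (‖b‖ * Real.exp (ρ * freqLen l) * (‖a k‖ * Real.exp (ρ * freqLen k)))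
        fun x θ => (e x * a k x * torusChar (m + k) θ).re := by
    intro e m he hm k
    refine (mode (e * a k) (m + k)).mono le_rfl ?_
    calc _ ≤ ‖b‖ * ‖a k‖ * Real.exp (ρ * (freqLen l + freqLen k)) := by
          gcongr
          · exact (norm_mul_le _ _).trans (by gcongr)
          · rw [← hm]; exact freqLen_add_le m k
      _ = _ := by rw [mul_add, Real.exp_add]; ring
  have key2 : ∀ k, FourierBound ρ
      (‖b‖ * Real.exp (ρ * freqLen l) * (‖a k‖ * Real.exp (ρ * freqLen k)))
      fun x θ => (b x * torusChar l θ).re * (a k x * torusChar k θ).re := by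
    intro k
    have h1 := key b l le_rfl rfl k
    have h2 := key (star b) (-l) (norm_star b).le (freqLen_neg l) k
    refine ((add hρ h1 h2).const_mul 2⁻¹).congr (fun x θ => ?_) |>.mono le_rfl ?_
    · rw [torusChar_add, torusChar_add, torusChar_neg]
      simp only [ContinuousMap.star_apply, RCLike.star_def, Complex.mul_re, Complex.conj_re,
        Complex.conj_im, Complex.mul_im]
      ring
    · rw [abs_of_pos (by norm_num)]
      linarith
  have h3 := hasSum hρ key2 (hs.mul_left _) fun x θ => (ha x θ).mul_left _
  refine h3.mono le_rfl ?_
  rw [tsum_mul_left]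
  gcongr

lemma mul (hρ : 0 ≤ ρ) (hF : FourierBound ρ c F) (hG : FourierBound ρ d G) :
    FourierBound ρ (c * d) fun x θ => F x θ * G x θ := by
  have hd := hG.nonneg
  obtain ⟨a, hs, hc, ha⟩ := hF
  have h3 := hasSum hρ (fun k => hG.mode_mul hρ (a k) k) (hs.mul_right _)
    fun x θ => (ha x θ).mul_right _
  refine h3.mono le_rfl ?_
  rw [tsum_mul_right]
  gcongr

lemma neg (hF : FourierBound ρ c F) : FourierBound ρ c fun x θ => -F x θ := by
  simpa using hF.const_mul (-1)

lemma sub (hρ : 0 ≤ ρ) (hF : FourierBound ρ c F) (hG : FourierBound ρ d G) :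
    FourierBound ρ (c + d) fun x θ => F x θ - G x θ := by
  simpa [sub_eq_add_neg] using hF.add hρ (hG.neg)

lemma pow (hρ : 0 ≤ ρ) (hF : FourierBound ρ c F) (m : ℕ) :
    FourierBound ρ (c ^ m) fun x θ => F x θ ^ m := by
  induction m with
  | zero => simpa using one
  | succ m ih => simpa [pow_succ] using mul hρ ih hF

/-- Translation of the angle. -/
lemma translate (hF : FourierBound ρ c F) (q : Fin n → ℝ) :
    FourierBound ρ c fun x θ => F x (θ + q) := by
  obtain ⟨a, hs, hc, ha⟩ := hF
  have hn : ∀ k, ‖torusChar k q • a k‖ = ‖a k‖ := by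
    intro k; rw [norm_smul, norm_torusChar, one_mul]
  refine ⟨fun k => torusChar k q • a k, by simpa only [hn], by simpa only [hn], fun x θ => ?_⟩
  convert ha x (θ + q) using 3 with k
  rw [torusChar_add_apply]
  simp only [ContinuousMap.coe_smul, Pi.smul_apply, smul_eq_mul]
  ring

end FourierBound

section Characters

variable {n : ℕ}

/-- The linear form `θ ↦ ⟨k, θ⟩`. -/
def freqForm (k : Fin n → ℤ) : (Fin n → ℝ) →L[ℝ] ℝ :=
  ∑ i, (k i : ℝ) • ContinuousLinearMap.proj i

lemma freqForm_apply (k : Fin n → ℤ) (θ : Fin n → ℝ) :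
    freqForm k θ = ∑ i, (k i : ℝ) * θ i := by
  simp [freqForm]

lemma torusChar_eq (k : Fin n → ℤ) (θ : Fin n → ℝ) :
    torusChar k θ = Complex.exp ((freqForm k θ : ℂ) * Complex.I) := by
  rw [freqForm_apply, torusChar]

lemma abs_freqForm_le (k : Fin n → ℤ) (θ : Fin n → ℝ) : |freqForm k θ| ≤ freqLen k * ‖θ‖ := by
  rw [freqForm_apply, freqLen, Finset.sum_mul]
  refine (Finset.abs_sum_le_sum_abs _ _).trans (Finset.sum_le_sum fun i _ => ?_)
  rw [abs_mul]
  gcongr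
  exact norm_le_pi_norm θ i

lemma hasFDerivAt_torusChar (k : Fin n → ℤ) (θ : Fin n → ℝ) :
    HasFDerivAt (torusChar k)
      ((torusChar k θ * Complex.I) • Complex.ofRealCLM.comp (freqForm k)) θ := by
  have h1 : HasFDerivAt (fun θ => (freqForm k θ : ℂ) * Complex.I)
      (Complex.I • Complex.ofRealCLM.comp (freqForm k)) θ :=
    (Complex.ofRealCLM.comp (freqForm k)).hasFDerivAt.mul_const' Complex.I |>.congr_fderiv (by
      ext h; simp)
  have h2 := h1.cexp
  have : torusChar k = fun θ => Complex.exp ((freqForm k θ : ℂ) * Complex.I) :=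
    funext (torusChar_eq k)
  rw [this]
  refine h2.congr_fderiv ?_
  ext h
  simp [mul_assoc]

end Characters

lemma le_exp_div {σ y : ℝ} (hσ : 0 < σ) : y ≤ Real.exp (σ * y) / σ := by
  rw [le_div_iff₀ hσ]
  linarith [Real.add_one_le_exp (σ * y)]

lemma HasSum.of_eq {J : Type*} {f g : J → ℝ} {s t : ℝ} (h : HasSum f s) (hf : ∀ j, g j = f j)
    (ht : t = s) : HasSum g t := by
  rw [ht, funext hf]
  exact h

lemma exp_sub_one_sub_le {y : ℝ} (hy : 0 ≤ y) : Real.exp y - 1 - y ≤ y ^ 2 * Real.exp y := by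
  have h1 : (1 - y) * Real.exp y ≤ 1 := by
    have := Real.add_one_le_exp (-y)
    calc (1 - y) * Real.exp y ≤ Real.exp (-y) * Real.exp y := by gcongr; linarith
      _ = 1 := by rw [← Real.exp_add]; simp
  nlinarith

lemma sq_le_exp_div {s y : ℝ} (hs : 0 < s) (hy : 0 ≤ y) :
    y ^ 2 ≤ 2 / s ^ 2 * Real.exp (s * y) := by
  have := Real.quadratic_le_exp_of_nonneg (mul_nonneg hs.le hy)
  have h2 : 0 ≤ s * y := by positivity
  rw [div_mul_eq_mul_div, le_div_iff₀ (by positivity)]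
  nlinarith

namespace FourierBound

variable {n : ℕ} {X : Type*} [TopologicalSpace X] [CompactSpace X] {ρ c d : ℝ}
  {F G : X → (Fin n → ℝ) → ℝ}

lemma hasFDerivAt_of_hasSum {a : (Fin n → ℤ) → C(X, ℂ)} (hρ : 0 < ρ)
    (hs : Summable fun k => ‖a k‖ * Real.exp (ρ * freqLen k))
    (ha : ∀ x θ, HasSum (fun k => (a k x * torusChar k θ).re) (F x θ)) (x : X) (θ : Fin n → ℝ) :
    DifferentiableAt ℝ (F x) θ ∧ ∀ h, HasSum
      (fun k => (a k x * torusChar k θ * Complex.I).re * freqForm k h) (fderiv ℝ (F x) θ h) := by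
  let f' : (Fin n → ℤ) → (Fin n → ℝ) → ((Fin n → ℝ) →L[ℝ] ℝ) := fun k θ =>
    (a k x * torusChar k θ * Complex.I).re • freqForm k
  have hf : ∀ k θ, HasFDerivAt (fun θ => (a k x * torusChar k θ).re) (f' k θ) θ := by
    intro k θ
    have h1 := (hasFDerivAt_torusChar k θ).const_mul (a k x)
    have h2 := Complex.reCLM.hasFDerivAt.comp θ h1
    refine h2.congr_fderiv ?_
    ext h
    simp [f']
    ring
  have hu : Summable fun k : Fin n → ℤ => ‖a k‖ * freqLen k := by
    refine Summable.of_nonneg_of_le (fun k => mul_nonneg (norm_nonneg _) (freqLen_nonneg k))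
      (fun k => ?_) (hs.mul_right (1 / ρ))
    calc ‖a k‖ * freqLen k ≤ ‖a k‖ * (Real.exp (ρ * freqLen k) / ρ) := by
          gcongr; exact le_exp_div hρ
      _ = _ := by ring
  have hf' : ∀ k θ, ‖f' k θ‖ ≤ ‖a k‖ * freqLen k := by
    intro k θ
    refine ContinuousLinearMap.opNorm_le_bound _
      (mul_nonneg (norm_nonneg _) (freqLen_nonneg k)) fun h => ?_
    simp only [f', _root_.smul_apply, norm_smul, mul_assoc ‖a k‖]
    have h1 : ‖(a k x * torusChar k θ * Complex.I).re‖ ≤ ‖a k‖ := by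
      refine (Complex.abs_re_le_norm _).trans ?_
      rw [norm_mul, norm_mul, norm_torusChar, Complex.norm_I, mul_one, mul_one]
      exact (a k).norm_coe_le_norm x
    exact mul_le_mul h1 (abs_freqForm_le k h) (norm_nonneg _) (norm_nonneg _)
  have h1 := hasFDerivAt_tsum hu hf hf' (ha x θ).summable θ
  have h2 : (fun y => ∑' k, (a k x * torusChar k y).re) = F x :=
    funext fun y => (ha x y).tsum_eq
  rw [h2] at h1
  refine ⟨h1.differentiableAt, fun h => ?_⟩
  rw [h1.fderiv]
  have h3 : Summable fun k => f' k θ := Summable.of_norm_bounded hu fun k => hf' k θ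
  exact h3.hasSum.mapL (ContinuousLinearMap.apply ℝ ℝ h)

lemma differentiableAt (hF : FourierBound ρ c F) (hρ : 0 < ρ) (x : X) (θ : Fin n → ℝ) :
    DifferentiableAt ℝ (F x) θ := by
  obtain ⟨a, hs, -, ha⟩ := hF
  exact (hasFDerivAt_of_hasSum hρ hs ha x θ).1

/-- Cauchy estimate for the partial derivatives. -/
lemma fderiv (hF : FourierBound ρ c F) {σ : ℝ} (hσ : 0 < σ) (hσρ : σ ≤ ρ) (j : Fin n) :
    FourierBound (ρ - σ) (c / σ) fun x θ => fderiv ℝ (F x) θ (Pi.single j 1) := by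
  obtain ⟨a, hs, hc, ha⟩ := hF
  have hle : ∀ k, ‖(Complex.I * (k j : ℂ)) • a k‖ * Real.exp ((ρ - σ) * freqLen k)
      ≤ ‖a k‖ * Real.exp (ρ * freqLen k) / σ := by
    intro k
    have h1 : |(k j : ℝ)| ≤ Real.exp (σ * freqLen k) / σ :=
      (abs_le_freqLen k j).trans (le_exp_div hσ)
    have h2 : ‖(k j : ℂ)‖ = |(k j : ℝ)| := by
      rw [← Real.norm_eq_abs, ← Complex.norm_real]; simp
    rw [norm_smul, norm_mul, Complex.norm_I, one_mul, h2]
    calc _ ≤ Real.exp (σ * freqLen k) / σ * ‖a k‖ * Real.exp ((ρ - σ) * freqLen k) := by gcongr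
      _ = ‖a k‖ * (Real.exp (σ * freqLen k) * Real.exp ((ρ - σ) * freqLen k)) / σ := by ring
      _ = _ := by rw [← Real.exp_add]; ring_nf
  have hs' := Summable.of_nonneg_of_le (fun k => by positivity) hle (hs.div_const σ)
  refine ⟨fun k => (Complex.I * (k j : ℂ)) • a k, hs', ?_, fun x θ => ?_⟩
  · refine (hs'.tsum_le_tsum hle (hs.div_const σ)).trans ?_
    rw [tsum_div_const]
    gcongr
  · have := (hasFDerivAt_of_hasSum (hσ.trans_le hσρ) hs ha x θ).2 (Pi.single j 1)
    convert this using 2 with k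
    have h3 : freqForm k (Pi.single j 1) = (k j : ℝ) := by
      rw [freqForm_apply]
      simp [Pi.single_apply]
    rw [h3, mul_comm _ (k j : ℝ), ← Complex.re_ofReal_mul]
    congr 1
    simp only [ContinuousMap.coe_smul, Pi.smul_apply, smul_eq_mul, Complex.ofReal_intCast]
    ring

/-- Composition with an entire function given by a power series. -/
lemma powerSeries {J : Type*} (hF : FourierBound ρ c F) (hρ : 0 ≤ ρ) {α : J → ℝ} {m : J → ℕ}
    {φ : ℝ → ℝ} {s : ℝ} (hφ : ∀ y, HasSum (fun j => α j * y ^ m j) (φ y))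
    (hs : HasSum (fun j => |α j| * c ^ m j) s) : FourierBound ρ s fun x θ => φ (F x θ) := by
  rw [← hs.tsum_eq]
  exact hasSum hρ (fun j => (hF.pow hρ (m j)).const_mul (α j)) hs.summable fun x θ => hφ _

lemma cos (hF : FourierBound ρ c F) (hρ : 0 ≤ ρ) :
    FourierBound ρ (Real.cosh c) fun x θ => Real.cos (F x θ) := by
  refine hF.powerSeries hρ (α := fun j : ℕ => (-1) ^ j / ((2 * j).factorial : ℝ))
    (m := fun j => 2 * j) (φ := Real.cos) (fun y => ?_) ?_
  · exact (Real.hasSum_cos y).of_eq (fun j => by ring) rfl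
  · exact (Real.hasSum_cosh c).of_eq (fun j => by rw [abs_div]; simp; ring) rfl

lemma sin (hF : FourierBound ρ c F) (hρ : 0 ≤ ρ) :
    FourierBound ρ (Real.sinh c) fun x θ => Real.sin (F x θ) := by
  refine hF.powerSeries hρ (α := fun j : ℕ => (-1) ^ j / ((2 * j + 1).factorial : ℝ))
    (m := fun j => 2 * j + 1) (φ := Real.sin) (fun y => ?_) ?_
  · exact (Real.hasSum_sin y).of_eq (fun j => by ring) rfl
  · exact (Real.hasSum_sinh c).of_eq (fun j => by rw [abs_div]; simp; ring) rfl

lemma cos_sub_one (hF : FourierBound ρ c F) (hρ : 0 ≤ ρ) :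
    FourierBound ρ (Real.cosh c - 1) fun x θ => Real.cos (F x θ) - 1 := by
  refine hF.powerSeries hρ (α := fun j : ℕ => (-1) ^ (j + 1) / ((2 * (j + 1)).factorial : ℝ))
    (m := fun j => 2 * (j + 1)) (φ := fun y => Real.cos y - 1) (fun y => ?_) ?_
  · have h := (hasSum_nat_add_iff' 1).2 (Real.hasSum_cos y)
    exact h.of_eq (fun j => by ring) (by simp)
  · have h := (hasSum_nat_add_iff' 1).2 (Real.hasSum_cosh c)
    exact h.of_eq (fun j => by rw [abs_div]; simp; ring) (by simp)

lemma sin_sub_self (hF : FourierBound ρ c F) (hρ : 0 ≤ ρ) :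
    FourierBound ρ (Real.sinh c - c) fun x θ => Real.sin (F x θ) - F x θ := by
  refine hF.powerSeries hρ (α := fun j : ℕ => (-1) ^ (j + 1) / ((2 * (j + 1) + 1).factorial : ℝ))
    (m := fun j => 2 * (j + 1) + 1) (φ := fun y => Real.sin y - y) (fun y => ?_) ?_
  · have h := (hasSum_nat_add_iff' 1).2 (Real.hasSum_sin y)
    exact h.of_eq (fun j => by ring) (by simp)
  · have h := (hasSum_nat_add_iff' 1).2 (Real.hasSum_sinh c)
    exact h.of_eq (fun j => by rw [abs_div]; simp; ring) (by simp)

/-- The cohomological equation over the rotation by `q`, up to the mean value. -/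
lemma exists_cohomology (hF : FourierBound ρ c F) {q : Fin n → ℝ} {σ D : ℝ}
    (hσρ : σ ≤ ρ) (hD0 : 0 ≤ D)
    (hD : ∀ k : Fin n → ℤ, k ≠ 0 → 1 ≤ ‖torusChar k q - 1‖ * (D * Real.exp (σ * freqLen k))) :
    ∃ m : C(X, ℝ), (∀ x, |m x| ≤ c) ∧ ∃ W : X → (Fin n → ℝ) → ℝ, FourierBound (ρ - σ) (D * c) W ∧
      ∀ x θ, W x (θ + q) - W x θ = F x θ - m x := by
  classical
  obtain ⟨a, hs, hc, ha⟩ := hF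
  let b : (Fin n → ℤ) → C(X, ℂ) := fun k =>
    if k = 0 then 0 else (torusChar k q - 1)⁻¹ • a k
  have hle : ∀ k, ‖b k‖ * Real.exp ((ρ - σ) * freqLen k)
      ≤ D * (‖a k‖ * Real.exp (ρ * freqLen k)) := by
    intro k
    by_cases hk : k = 0
    · simp only [b, hk, if_true, norm_zero, zero_mul]
      positivity
    · simp only [b, hk, if_false, norm_smul, norm_inv]
      have h0 : 0 < ‖torusChar k q - 1‖ := by
        by_contra h
        have h2 := hD k hk
        rw [le_antisymm (not_lt.1 h) (norm_nonneg _)] at h2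
        norm_num at h2
      have h1 : ‖torusChar k q - 1‖⁻¹ ≤ D * Real.exp (σ * freqLen k) := by
        rw [inv_le_iff_one_le_mul₀' h0]
        exact hD k hk
      calc _ ≤ D * Real.exp (σ * freqLen k) * ‖a k‖ * Real.exp ((ρ - σ) * freqLen k) := by gcongr
        _ = D * (‖a k‖ * (Real.exp (σ * freqLen k) * Real.exp ((ρ - σ) * freqLen k))) := by ring
        _ = _ := by rw [← Real.exp_add]; ring_nf
  have hs' := Summable.of_nonneg_of_le (fun k => by positivity) hle (hs.mul_left D)
  have hsb : Summable fun k => ‖b k‖ := by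
    refine Summable.of_nonneg_of_le (fun k => norm_nonneg _) (fun k => ?_) hs'
    exact le_mul_of_one_le_right (norm_nonneg _)
      (Real.one_le_exp (mul_nonneg (by linarith) (freqLen_nonneg k)))
  have hW : ∀ x θ, HasSum (fun k => (b k x * torusChar k θ).re)
      (∑' k, (b k x * torusChar k θ).re) := fun x θ =>
    (Summable.of_norm_bounded hsb fun k => norm_term_le _ _ _ _).hasSum
  refine ⟨⟨fun x => (a 0 x).re, by fun_prop⟩, fun x => ?_,
    fun x θ => ∑' k, (b k x * torusChar k θ).re,
    ⟨b, hs', (hs'.tsum_le_tsum hle (hs.mul_left D)).trans ?_, hW⟩, fun x θ => ?_⟩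
  · refine (Complex.abs_re_le_norm _).trans (((a 0).norm_coe_le_norm x).trans (le_trans ?_ hc))
    have := hs.le_tsum 0 fun k _ => by positivity
    simpa [freqLen_zero] using this
  · rw [tsum_mul_left]
    gcongr
  · have h1 := (hW x (θ + q)).sub (hW x θ)
    have h2 : HasSum (fun k : Fin n → ℤ => (if k = 0 then (a 0 x).re else 0 : ℝ)) (a 0 x).re := by
      simpa using hasSum_single (f := fun k : Fin n → ℤ => if k = 0 then (a 0 x).re else 0) 0
        (by intro k hk; simp [hk])
    refine h1.unique (((ha x θ).sub h2).of_eq (fun k => ?_) rfl)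
    rw [← Complex.sub_re, torusChar_add_apply]
    by_cases hk : k = 0
    · simp [hk, b, torusChar_zero]
    · have h0 : torusChar k q - 1 ≠ 0 := by
        intro h
        have h2 := hD k hk
        rw [h] at h2
        norm_num at h2
      simp only [b, hk, if_false, ContinuousMap.coe_smul, Pi.smul_apply, smul_eq_mul, sub_zero]
      congr 1
      field_simp

/-- Inversion of a matrix close to the identity. -/
lemma exists_inverse {N : Fin n → Fin n → X → (Fin n → ℝ) → ℝ} (hρ : 0 ≤ ρ) (hc0 : 0 ≤ c)
    (hN : ∀ i j, FourierBound ρ c (N i j)) (hc : n * c ≤ 1 / 4) :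
    ∃ P : Fin n → Fin n → X → (Fin n → ℝ) → ℝ, (∀ i j, FourierBound ρ 2 (P i j)) ∧
      (∀ i j, FourierBound ρ (2 * (n * c)) fun x θ => P i j x θ - if i = j then 1 else 0) ∧
      ∀ x θ i j, P i j x θ + ∑ l, N i l x θ * P l j x θ = if i = j then 1 else 0 := by
  let M : X → (Fin n → ℝ) → Matrix (Fin n) (Fin n) ℝ := fun x θ => Matrix.of fun i j => -N i j x θ
  have hnc : 0 ≤ n * c := by positivity
  have hM : ∀ m i j, FourierBound ρ ((n * c) ^ m) fun x θ => (M x θ ^ m) i j := by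
    intro m
    induction m with
    | zero =>
      intro i j
      by_cases hij : i = j
      · simpa [hij] using one
      · simpa [Matrix.one_apply, hij] using zero.mono le_rfl zero_le_one
    | succ m ih =>
      intro i j
      have := sum hρ fun l => (ih i l).mul hρ (hN l j).neg
      refine (this.congr fun x θ => ?_).mono le_rfl ?_
      · rw [pow_succ, Matrix.mul_apply]
        rfl
      · simp [pow_succ]
        nlinarith
  have hgeo := hasSum_geometric_of_lt_one hnc (by linarith : n * c < 1)
  have hsum : ∀ x θ i j, Summable fun m => (M x θ ^ m) i j := fun x θ i j =>
    Summable.of_norm_bounded hgeo.summable fun m => (hM m i j).abs_le hρ x θ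
  have hmat : ∀ x θ, Summable fun m => M x θ ^ m := fun x θ =>
    Pi.summable.2 fun i => Pi.summable.2 fun j => hsum x θ i j
  have happ : ∀ x θ i j, (∑' m, M x θ ^ m) i j = ∑' m, (M x θ ^ m) i j := by
    intro x θ i j
    have h := (hmat x θ).hasSum
    exact ((Pi.hasSum.1 (Pi.hasSum.1 h i) j).tsum_eq).symm
  refine ⟨fun i j x θ => ∑' m, (M x θ ^ m) i j, fun i j => ?_, fun i j => ?_, fun x θ i j => ?_⟩
  · refine (hasSum hρ (fun m => hM m i j) hgeo.summable fun x θ => (hsum x θ i j).hasSum).mono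
      le_rfl ?_
    rw [hgeo.tsum_eq, inv_le_comm₀ (by linarith) (by norm_num)]
    linarith
  · have h1 := (hasSum_nat_add_iff' 1).2 hgeo
    have h3 : ∀ x θ, HasSum (fun m => (M x θ ^ (m + 1)) i j)
        ((∑' m, (M x θ ^ m) i j) - if i = j then 1 else 0) := fun x θ =>
      ((hasSum_nat_add_iff' 1).2 (hsum x θ i j).hasSum).of_eq (fun m => rfl)
        (by simp [Matrix.one_apply])
    refine (hasSum hρ (fun m => hM (m + 1) i j) h1.summable h3).mono le_rfl ?_
    rw [h1.tsum_eq]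
    have h2 : (1 - n * c)⁻¹ ≤ 1 + 2 * (n * c) := by
      rw [inv_le_iff_one_le_mul₀' (by linarith)]
      nlinarith
    simp only [Finset.range_one, Finset.sum_singleton, pow_zero]
    linarith
  · have h := congrFun (congrFun (hmat x θ).one_sub_mul_tsum_pow i) j
    rw [sub_mul, one_mul, Matrix.sub_apply, Matrix.mul_apply, Matrix.one_apply] at h
    simp only [happ] at h
    rw [← h, sub_eq_add_neg, ← Finset.sum_neg_distrib]
    congr 1
    exact Finset.sum_congr rfl fun l _ => by simp [M]

lemma freqForm {v : Fin n → X → (Fin n → ℝ) → ℝ} (hρ : 0 ≤ ρ) (hv : ∀ i, FourierBound ρ c (v i))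
    (k : Fin n → ℤ) :
    FourierBound ρ (freqLen k * c) fun x θ => freqForm k fun i => v i x θ := by
  rw [freqLen, Finset.sum_mul]
  exact (sum hρ fun i => (hv i).const_mul (k i : ℝ)).congr fun x θ => freqForm_apply _ _

lemma mode_mul_exp (hF : FourierBound ρ c F) (hρ : 0 ≤ ρ) (b : C(X, ℂ)) (l : Fin n → ℤ) :
    FourierBound ρ (‖b‖ * Real.exp (ρ * freqLen l) * Real.exp c) fun x θ =>
      (b x * torusChar l θ * Complex.exp (F x θ * Complex.I)).re := by
  have h1 := (hF.cos hρ).mode_mul hρ b l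
  have h2 := (hF.sin hρ).mode_mul hρ (Complex.I • b) l
  refine ((h1.add hρ h2).congr fun x θ => ?_).mono le_rfl ?_
  · rw [Complex.exp_mul_I, ← Complex.ofReal_cos, ← Complex.ofReal_sin]
    simp only [ContinuousMap.coe_smul, Pi.smul_apply, smul_eq_mul, Complex.mul_re, Complex.mul_im,
      Complex.add_re, Complex.add_im, Complex.I_re, Complex.I_im, Complex.ofReal_re,
      Complex.ofReal_im]
    ring
  · rw [norm_smul, Complex.norm_I, one_mul, ← mul_add, Real.cosh_add_sinh]

lemma mode_mul_exp_remainder (hF : FourierBound ρ c F) (hG : FourierBound ρ d G) (hρ : 0 ≤ ρ)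
    (b : C(X, ℂ)) (l : Fin n → ℤ) :
    FourierBound ρ (‖b‖ * Real.exp (ρ * freqLen l) * Real.exp c * (Real.exp d - 1 - d)) fun x θ =>
      (b x * torusChar l θ * Complex.exp (F x θ * Complex.I) *
        (Complex.exp (G x θ * Complex.I) - 1 - G x θ * Complex.I)).re := by
  have h1 := (hF.mode_mul_exp hρ b l).mul hρ (hG.cos_sub_one hρ)
  have h2 := (hF.mode_mul_exp hρ (Complex.I • b) l).mul hρ (hG.sin_sub_self hρ)
  refine ((h1.add hρ h2).congr fun x θ => ?_).mono le_rfl ?_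
  · rw [Complex.exp_mul_I (G x θ : ℂ), ← Complex.ofReal_cos, ← Complex.ofReal_sin]
    simp only [ContinuousMap.coe_smul, Pi.smul_apply, smul_eq_mul, mul_assoc Complex.I]
    generalize b x * (torusChar l θ * Complex.exp (F x θ * Complex.I)) = z
    generalize b x * torusChar l θ * Complex.exp (F x θ * Complex.I) = z
    simp only [Complex.mul_re, Complex.mul_im, Complex.sub_re, Complex.sub_im, Complex.one_re,
      Complex.one_im,
      Complex.add_re, Complex.add_im, Complex.I_re, Complex.I_im, Complex.ofReal_re,
      Complex.ofReal_im]
    ring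
  · rw [norm_smul, Complex.norm_I, one_mul, ← mul_add]
    apply le_of_eq
    congr 1
    rw [← Real.cosh_add_sinh]
    ring

/-- The quadratic Taylor remainder of `g` along `θ ↦ θ + v(θ)`. -/
lemma taylor_remainder {r t V s : ℝ} {g : X → (Fin n → ℝ) → ℝ} (hg : FourierBound r t g)
    {v δ : Fin n → X → (Fin n → ℝ) → ℝ} (hρ : 0 ≤ ρ) (hV : 0 ≤ V) (hd : 0 ≤ d)
    (hv : ∀ i, FourierBound ρ V (v i)) (hδ : ∀ i, FourierBound ρ d (δ i)) (hs : 0 < s)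
    (hr : ρ + V + d + s ≤ r) :
    FourierBound ρ (2 * t * d ^ 2 / s ^ 2) fun x θ =>
      g x (fun i => θ i + v i x θ + δ i x θ) - g x (fun i => θ i + v i x θ) -
        _root_.fderiv ℝ (g x) (fun i => θ i + v i x θ) (fun i => δ i x θ) := by
  obtain ⟨a, has, hat, ha⟩ := hg
  have hmode := fun k => mode_mul_exp_remainder (freqForm hρ hv k) (freqForm hρ hδ k) hρ (a k) k
  have hle : ∀ k, ‖a k‖ * Real.exp (ρ * freqLen k) * Real.exp (freqLen k * V) *
      (Real.exp (freqLen k * d) - 1 - freqLen k * d)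
      ≤ 2 * d ^ 2 / s ^ 2 * (‖a k‖ * Real.exp (r * freqLen k)) := by
    intro k
    have hk := freqLen_nonneg k
    calc _ ≤ ‖a k‖ * Real.exp (ρ * freqLen k) * Real.exp (freqLen k * V) *
          ((2 / s ^ 2 * Real.exp (s * freqLen k)) * d ^ 2 * Real.exp (freqLen k * d)) := by
          refine mul_le_mul_of_nonneg_left ?_ (by positivity)
          refine (exp_sub_one_sub_le (by positivity)).trans ?_
          rw [mul_pow]
          gcongr
          exact sq_le_exp_div hs hk
      _ = 2 * d ^ 2 / s ^ 2 * (‖a k‖ * (Real.exp (ρ * freqLen k) * Real.exp (freqLen k * V) *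
          Real.exp (s * freqLen k) * Real.exp (freqLen k * d))) := by ring
      _ = 2 * d ^ 2 / s ^ 2 * (‖a k‖ * Real.exp ((ρ + V + d + s) * freqLen k)) := by
          rw [← Real.exp_add, ← Real.exp_add, ← Real.exp_add]
          ring_nf
      _ ≤ _ := by gcongr
  have hsum : Summable fun k => ‖a k‖ * Real.exp (ρ * freqLen k) * Real.exp (freqLen k * V) *
      (Real.exp (freqLen k * d) - 1 - freqLen k * d) :=
    Summable.of_nonneg_of_le (fun k => (hmode k).nonneg) hle (has.mul_left _)
  refine (hasSum hρ hmode hsum fun x θ => ?_).mono le_rfl ?_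
  · have h1 := ha x (fun i => θ i + v i x θ + δ i x θ)
    have h2 := ha x (fun i => θ i + v i x θ)
    have h3 := (hasFDerivAt_of_hasSum (by linarith) has ha x (fun i => θ i + v i x θ)).2
      (fun i => δ i x θ)
    refine ((h1.sub h2).sub h3).of_eq (fun k => ?_) rfl
    have e1 : torusChar k (fun i => θ i + v i x θ)
        = torusChar k θ * torusChar k (fun i => v i x θ) := torusChar_add_apply _ _ _
    have e2 : torusChar k (fun i => θ i + v i x θ + δ i x θ)
        = torusChar k (fun i => θ i + v i x θ) * torusChar k (fun i => δ i x θ) :=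
      torusChar_add_apply _ _ _
    rw [e2, e1, torusChar_eq k (fun i => v i x θ), torusChar_eq k (fun i => δ i x θ),
      mul_comm (Complex.re _) (_root_.freqForm k _), ← Complex.re_ofReal_mul, ← Complex.sub_re,
      ← Complex.sub_re]
    congr 1
    ring
  · refine (hsum.tsum_le_tsum hle (has.mul_left _)).trans ?_
    rw [tsum_mul_left]
    calc _ ≤ 2 * d ^ 2 / s ^ 2 * t := by gcongr
      _ = _ := by ring

end FourierBound

/-- Lower bound for the small divisors of a Diophantine vector. -/
lemma exists_small_divisor_bound {n : ℕ} {q : Fin n → ℝ} {γ τ : ℝ} (hγ : 0 < γ)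
    (hdio : ∀ k : Fin n → ℤ, k ≠ 0 → ∀ k₀ : ℤ,
      γ * (∑ i, |(k i : ℝ)|) ^ (-τ) ≤ |(∑ i, (k i : ℝ) * q i) - 2 * π * (k₀ : ℝ)|) :
    ∃ D > 0, ∃ N : ℕ, ∀ σ > 0, ∀ k : Fin n → ℤ, k ≠ 0 →
      1 ≤ ‖torusChar k q - 1‖ * (D / σ ^ N * Real.exp (σ * freqLen k)) := by
  obtain ⟨N, hN⟩ := exists_nat_ge τ
  refine ⟨π * N.factorial / (2 * γ), by positivity, N, fun σ hσ k hk => ?_⟩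
  set φ := ∑ i, (k i : ℝ) * q i with hφ
  set m : ℤ := round (φ / (2 * π)) with hm
  set ψ := φ - 2 * π * m with hψ
  have hψ1 : |ψ| ≤ π := by
    have h1 := abs_sub_round (φ / (2 * π))
    have h2 : ψ = 2 * π * (φ / (2 * π) - m) := by
      rw [hψ]; field_simp
    rw [h2, abs_mul, abs_of_pos (by positivity : (0 : ℝ) < 2 * π)]
    nlinarith [Real.pi_pos]
  have hnorm : ‖torusChar k q - 1‖ = 2 * |Real.sin (ψ / 2)| := by
    have h1 : torusChar k q = Complex.exp (Complex.I * (ψ : ℂ)) := by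
      rw [torusChar, ← hφ, mul_comm, Complex.exp_eq_exp_iff_exists_int]
      exact ⟨m, by rw [hψ]; push_cast; ring⟩
    rw [h1, Complex.norm_exp_I_mul_ofReal_sub_one, norm_mul, Real.norm_eq_abs, Real.norm_eq_abs,
      abs_two]
  have hsin : 2 / π * (|ψ| / 2) ≤ |Real.sin (ψ / 2)| := by
    have h1 := Real.mul_le_sin (x := |ψ| / 2) (by positivity) (by linarith)
    have h2 : Real.sin (|ψ| / 2) ≤ |Real.sin (ψ / 2)| := by
      rcases abs_cases ψ with ⟨h, -⟩ | ⟨h, -⟩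
      · rw [h]; exact le_abs_self _
      · rw [h, neg_div, Real.sin_neg]; exact neg_le_abs _
    exact h1.trans h2
  have hlen := one_le_freqLen hk
  have hlen0 : 0 < freqLen k := by linarith
  have h1 : γ * freqLen k ^ (-τ) ≤ |ψ| := hdio k hk m
  have h2 : (freqLen k ^ N)⁻¹ ≤ freqLen k ^ (-τ) := by
    rw [Real.rpow_neg hlen0.le, ← Real.rpow_natCast]
    gcongr
  have h3 : (σ * freqLen k) ^ N / N.factorial ≤ Real.exp (σ * freqLen k) :=
    Real.pow_div_factorial_le_exp _ (by positivity) N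
  have h4 : 2 / π * (γ * (freqLen k ^ N)⁻¹) ≤ ‖torusChar k q - 1‖ := by
    rw [hnorm]
    calc _ ≤ 2 / π * (γ * freqLen k ^ (-τ)) := by gcongr
      _ ≤ 2 / π * |ψ| := by gcongr
      _ = 2 * (2 / π * (|ψ| / 2)) := by ring
      _ ≤ _ := by gcongr
  calc (1 : ℝ) = 2 / π * (γ * (freqLen k ^ N)⁻¹) *
        (π * N.factorial / (2 * γ) / σ ^ N * ((σ * freqLen k) ^ N / N.factorial)) := by
        rw [mul_pow]
        have : (N.factorial : ℝ) ≠ 0 := by positivity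
        field_simp
    _ ≤ _ := by gcongr

namespace FourierBound

variable {n : ℕ} {X : Type*} [TopologicalSpace X] [CompactSpace X] {ρ c d : ℝ}
  {F G : X → (Fin n → ℝ) → ℝ}

lemma continuous_parameter (hF : FourierBound ρ c F) (hρ : 0 ≤ ρ) (θ : Fin n → ℝ) :
    Continuous fun x => F x θ := by
  obtain ⟨a, hs, -, ha⟩ := hF
  have h : (fun x => F x θ) = fun x => ∑' k, (a k x * torusChar k θ).re :=
    funext fun x => (ha x θ).tsum_eq.symm
  rw [h]
  refine continuous_tsum (fun k => by fun_prop) hs fun k x => (norm_term_le _ _ _ _).trans ?_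
  have := freqLen_nonneg k
  exact le_mul_of_one_le_right (norm_nonneg _) (Real.one_le_exp (by positivity))

lemma continuous_angle (hF : FourierBound ρ c F) (hρ : 0 < ρ) (x : X) : Continuous (F x) :=
  continuous_iff_continuousAt.2 fun θ => (hF.differentiableAt hρ x θ).continuousAt

lemma periodic (hF : FourierBound ρ c F) (x : X) (θ : Fin n → ℝ) (j : Fin n) :
    F x (θ + Pi.single j (2 * π)) = F x θ := by
  obtain ⟨a, -, -, ha⟩ := hF
  refine (ha x _).unique ((ha x θ).of_eq (fun k => ?_) rfl)
  have h : torusChar k (Pi.single j (2 * π)) = 1 := by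
    rw [torusChar, Complex.exp_eq_one_iff]
    refine ⟨k j, ?_⟩
    simp only [Pi.single_apply, mul_ite, mul_zero, Finset.sum_ite_eq', Finset.mem_univ, if_true]
    push_cast
    ring
  rw [torusChar_add_apply, h, mul_one]

lemma sum_const {F : Fin n → X → (Fin n → ℝ) → ℝ} (hρ : 0 ≤ ρ) (hF : ∀ j, FourierBound ρ c (F j)) :
    FourierBound ρ (n * c) fun x θ => ∑ j, F j x θ := by
  simpa using sum hρ hF

end FourierBound

lemma ContinuousLinearMap.apply_eq_sum_single {n : ℕ} (L : (Fin n → ℝ) →L[ℝ] ℝ) (w : Fin n → ℝ) :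
    L w = ∑ l, L (Pi.single l 1) * w l := by
  have h := LinearMap.pi_apply_eq_sum_univ (L : (Fin n → ℝ) →ₗ[ℝ] ℝ) w
  simp only [ContinuousLinearMap.coe_coe, smul_eq_mul] at h
  rw [h]
  refine Finset.sum_congr rfl fun l _ => ?_
  rw [mul_comm]
  congr 2
  funext j
  simp [Pi.single_apply, eq_comm]

/-- If `P` is a right inverse of `1 + N`, then `1 + N` maps `P y` to `y`. -/
lemma add_sum_mul_eq_of_right_inverse {n : ℕ} {N P : Fin n → Fin n → ℝ}
    (h : ∀ i j, P i j + ∑ l, N i l * P l j = if i = j then 1 else 0) (y : Fin n → ℝ) (i : Fin n) :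
    (∑ j, P i j * y j) + ∑ l, N i l * ∑ j, P l j * y j = y i := by
  have h1 : ∑ l, N i l * ∑ j, P l j * y j = ∑ j, (∑ l, N i l * P l j) * y j := by
    simp only [Finset.mul_sum, Finset.sum_mul]
    rw [Finset.sum_comm]
    exact Finset.sum_congr rfl fun _ _ => Finset.sum_congr rfl fun _ _ => by ring
  rw [h1, ← Finset.sum_add_distrib]
  simp only [← add_mul, h, ite_mul, one_mul, zero_mul, Finset.sum_ite_eq, Finset.mem_univ, if_true]

/-- The defect of `θ ↦ θ + v(θ)` as a conjugacy between the rotation by `q` and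
`θ ↦ θ + lam + g(θ)`. -/
def conjDefect {n : ℕ} {X : Type*} (q : Fin n → ℝ) (g v : Fin n → X → (Fin n → ℝ) → ℝ)
    (lam : Fin n → X → ℝ) (j : Fin n) (x : X) (θ : Fin n → ℝ) : ℝ :=
  v j x (θ + q) - v j x θ - lam j x - g j x fun i => θ i + v i x θ

/-- The linearisation identity at an approximate conjugacy. -/
lemma conjDefect_newton {n : ℕ} {X : Type*} {q : Fin n → ℝ} {g v w : Fin n → X → (Fin n → ℝ) → ℝ}
    {lam μ : Fin n → X → ℝ} {x : X} (hg : ∀ j θ, DifferentiableAt ℝ (g j x) θ)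
    (hv : ∀ j θ, DifferentiableAt ℝ (v j x) θ)
    {δ : Fin n → X → (Fin n → ℝ) → ℝ}
    (hδ : ∀ i θ, δ i x θ = w i x θ + ∑ l, fderiv ℝ (v i x) θ (Pi.single l 1) * w l x θ)
    (hw : ∀ θ i, (w i x (θ + q) - w i x θ) +
      ∑ l, fderiv ℝ (v i x) (θ + q) (Pi.single l 1) * (w l x (θ + q) - w l x θ)
        = μ i x - conjDefect q g v lam i x θ) (j : Fin n) (θ : Fin n → ℝ) :
    conjDefect q g (fun i x θ => v i x θ + δ i x θ) (fun i x => lam i x + μ i x) j x θ =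
      (∑ l, fderiv ℝ (conjDefect q g v lam j x) θ (Pi.single l 1) * w l x θ) -
      (g j x (fun i => θ i + v i x θ + δ i x θ) - g j x (fun i => θ i + v i x θ) -
        fderiv ℝ (g j x) (fun i => θ i + v i x θ) (fun i => δ i x θ)) := by
  have hU : HasFDerivAt (fun θ i => θ i + v i x θ)
      (ContinuousLinearMap.pi fun i => ContinuousLinearMap.proj i + fderiv ℝ (v i x) θ) θ :=
    hasFDerivAt_pi.2 fun i => (hasFDerivAt_apply i θ).add (hv i θ).hasFDerivAt
  have hshift : HasFDerivAt (fun θ => v j x (θ + q)) (fderiv ℝ (v j x) (θ + q)) θ := by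
    exact (hasFDerivAt_comp_add_right q).2 (hv j (θ + q)).hasFDerivAt
  have hDE : HasFDerivAt (conjDefect q g v lam j x)
      (fderiv ℝ (v j x) (θ + q) - fderiv ℝ (v j x) θ -
        (fderiv ℝ (g j x) fun i => θ i + v i x θ).comp
          (ContinuousLinearMap.pi fun i => ContinuousLinearMap.proj i + fderiv ℝ (v i x) θ)) θ :=
    ((hshift.sub (hv j θ).hasFDerivAt).sub_const (lam j x)).sub
      ((hg j _).hasFDerivAt.comp θ hU)
  have hδw : ∀ i θ, δ i x θ = w i x θ + fderiv ℝ (v i x) θ (fun l => w l x θ) := fun i θ => by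
    rw [hδ, ← ContinuousLinearMap.apply_eq_sum_single _ fun l => w l x θ]
  have h1 := ContinuousLinearMap.apply_eq_sum_single
    (fderiv ℝ (conjDefect q g v lam j x) θ) fun l => w l x θ
  have h2 : fderiv ℝ (conjDefect q g v lam j x) θ (fun l => w l x θ) =
      fderiv ℝ (v j x) (θ + q) (fun l => w l x θ) - fderiv ℝ (v j x) θ (fun l => w l x θ) -
        fderiv ℝ (g j x) (fun i => θ i + v i x θ) (fun i => δ i x θ) := by
    rw [hDE.fderiv]
    simp only [sub_apply, ContinuousLinearMap.comp_apply]
    congr 2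
    funext i
    rw [hδw]
    rfl
  have h3 := hw θ j
  rw [← ContinuousLinearMap.apply_eq_sum_single _ fun l => w l x (θ + q) - w l x θ] at h3
  have h4 : fderiv ℝ (v j x) (θ + q) (fun l => w l x (θ + q) - w l x θ) =
      fderiv ℝ (v j x) (θ + q) (fun l => w l x (θ + q)) -
        fderiv ℝ (v j x) (θ + q) (fun l => w l x θ) := map_sub _ _ _
  rw [← h1, h2]
  have h5 : conjDefect q g v lam j x θ =
    v j x (θ + q) - v j x θ - lam j x - g j x fun i => θ i + v i x θ := rfl
  have h6 : (fun i => θ i + (v i x θ + δ i x θ)) = fun i => θ i + v i x θ + δ i x θ :=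
    funext fun i => by ring
  simp only [conjDefect, h6]
  have h7 := hδw j (θ + q)
  have h8 := hδw j θ
  linarith

section Linearised

variable {n : ℕ} {X : Type*} [TopologicalSpace X] [CompactSpace X] {ρ c e : ℝ}

/-- Solution of the linearised conjugacy equation. -/
lemma exists_newton_direction (hn : 1 ≤ n) {q : Fin n → ℝ} {σ T : ℝ} (hσρ : σ ≤ ρ)
    (hσ : 0 ≤ σ) (hT0 : 0 ≤ T)
    (hT : ∀ k : Fin n → ℤ, k ≠ 0 → 1 ≤ ‖torusChar k q - 1‖ * (T * Real.exp (σ * freqLen k)))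
    {N : Fin n → Fin n → X → (Fin n → ℝ) → ℝ} (hc0 : 0 ≤ c) (hc : 8 * n ^ 2 * c ≤ 1)
    (hN : ∀ i l, FourierBound ρ c (N i l)) {E : Fin n → X → (Fin n → ℝ) → ℝ}
    (hE : ∀ j, FourierBound ρ e (E j)) :
    ∃ w : Fin n → X → (Fin n → ℝ) → ℝ, ∃ μ : Fin n → C(X, ℝ),
      (∀ i, FourierBound (ρ - σ) (4 * n ^ 2 * T * e) (w i)) ∧ (∀ i x, |μ i x| ≤ 4 * n ^ 2 * e) ∧
      ∀ x θ i, (w i x (θ + q) - w i x θ) + ∑ l, N i l x θ * (w l x (θ + q) - w l x θ)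
        = μ i x - E i x θ := by
  have hρ : 0 ≤ ρ := hσ.trans hσρ
  have hn' : (1 : ℝ) ≤ n := by exact_mod_cast hn
  have hnn : (n : ℝ) ≤ n ^ 2 := by nlinarith
  have hncc : n * c ≤ n ^ 2 * c := by gcongr
  have he : 0 ≤ e := (hE ⟨0, hn⟩).nonneg
  have hnc : n * c ≤ 1 / 4 := by linarith
  obtain ⟨P, hP, hP1, hPN⟩ := FourierBound.exists_inverse hρ hc0 hN hnc
  have hPE : ∀ i, FourierBound ρ (n * (2 * e)) fun x θ => ∑ l, P i l x θ * E l x θ := fun i =>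
    FourierBound.sum_const hρ fun l => (hP i l).mul hρ (hE l)
  choose m hm W hW hWeq using fun i j => (hP1 i j).exists_cohomology hσρ hT0 hT
  choose b hb Z hZ hZeq using fun i => (hPE i).exists_cohomology hσρ hT0 hT
  obtain ⟨P', hP', -, hPm⟩ := FourierBound.exists_inverse (n := n) (ρ := 0) (c := 2 * (n * c))
    (N := fun i j x _ => m i j x) le_rfl (by positivity)
    (fun i j => FourierBound.const (m i j) (hm i j) (by positivity)) (by nlinarith)
  let μ : Fin n → C(X, ℝ) := fun i =>
    ⟨fun x => ∑ l, P' i l x 0 * b l x, continuous_finsetSum _ fun l _ =>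
      ((hP' i l).continuous_parameter le_rfl 0).mul (b l).continuous⟩
  have hμapp : ∀ i x, μ i x = ∑ l, P' i l x 0 * b l x := fun i x => rfl
  have hμ : ∀ i x, |μ i x| ≤ 4 * n ^ 2 * e := by
    intro i x
    rw [hμapp]
    refine (Finset.abs_sum_le_sum_abs _ _).trans ?_
    have : ∀ l ∈ Finset.univ, |P' i l x 0 * b l x| ≤ 2 * (n * (2 * e)) := fun l _ => by
      rw [abs_mul]
      exact mul_le_mul ((hP' i l).abs_le le_rfl x 0) (hb l x) (abs_nonneg _) (by norm_num)
    refine (Finset.sum_le_sum this).trans (le_of_eq ?_)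
    simp
    ring
  have hμb : ∀ i x, μ i x + ∑ l, m i l x * μ l x = b i x := fun i x => by
    simp only [hμapp]
    exact add_sum_mul_eq_of_right_inverse (hPm x 0) (fun l => b l x) i
  have hρσ : 0 ≤ ρ - σ := by linarith
  refine ⟨fun i x θ => (∑ j, W i j x θ * μ j x) - Z i x θ, μ, fun i => ?_, hμ, fun x θ i => ?_⟩
  · have h1 := FourierBound.sum_const hρσ fun j =>
      (hW i j).mul hρσ (FourierBound.const (n := n) (μ j) (hμ j) (by positivity))
    refine (h1.sub hρσ (hZ i)).mono le_rfl ?_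
    have h2 : n * (T * (2 * (n * c)) * (4 * n ^ 2 * e)) = (8 * n ^ 2 * c) * (n ^ 2 * T * e) := by
      ring
    have h3 : (8 * n ^ 2 * c) * (n ^ 2 * T * e) ≤ n ^ 2 * T * e :=
      mul_le_of_le_one_left (by positivity) hc
    have h4 : T * (n * (2 * e)) ≤ 2 * (n ^ 2 * T * e) := by
      calc T * (n * (2 * e)) = 2 * (n * T * e) := by ring
        _ ≤ _ := by gcongr
    linarith [show 0 ≤ n ^ 2 * T * e by positivity]
  · have hdiff : ∀ i, ((∑ j, W i j x (θ + q) * μ j x) - Z i x (θ + q)) -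
        ((∑ j, W i j x θ * μ j x) - Z i x θ) = ∑ j, P i j x θ * (μ j x - E j x θ) := by
      intro i
      have h1 : (∑ j, W i j x (θ + q) * μ j x) = ∑ j, (W i j x θ +
          (P i j x θ - (if i = j then 1 else 0) - m i j x)) * μ j x :=
        Finset.sum_congr rfl fun j _ => by rw [← hWeq]; ring
      have h2 := hZeq i x θ
      have h3 := hμb i x
      rw [h1]
      simp only [add_mul, sub_mul, mul_sub, Finset.sum_add_distrib, Finset.sum_sub_distrib,
        ite_mul, one_mul, zero_mul, Finset.sum_ite_eq, Finset.mem_univ, if_true]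
      linarith
    simp only [hdiff]
    exact add_sum_mul_eq_of_right_inverse (hPN x θ) (fun j => μ j x - E j x θ) i

/-- One Newton step. -/
lemma exists_newton_step (hn : 1 ≤ n) {q : Fin n → ℝ} {σ T r t V s : ℝ} (hσ : 0 < σ)
    (hσρ : 2 * σ ≤ ρ) (hT0 : 0 ≤ T)
    (hT : ∀ k : Fin n → ℤ, k ≠ 0 → 1 ≤ ‖torusChar k q - 1‖ * (T * Real.exp (σ * freqLen k)))
    {g v : Fin n → X → (Fin n → ℝ) → ℝ} {lam : Fin n → C(X, ℝ)}
    (hg : ∀ j, FourierBound r t (g j)) (hv : ∀ i, FourierBound ρ V (v i))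
    (hdv : ∀ i l, FourierBound ρ c fun x θ => fderiv ℝ (v i x) θ (Pi.single l 1))
    (hc : 8 * n ^ 2 * c ≤ 1)
    (hE : ∀ j, FourierBound ρ e (conjDefect q g v (fun i => lam i) j))
    (hs : 0 < s) (hr : ρ + V + 8 * n ^ 2 * T * e + s ≤ r) :
    ∃ v' : Fin n → X → (Fin n → ℝ) → ℝ, ∃ lam' : Fin n → C(X, ℝ),
      (∀ i, FourierBound (ρ - 2 * σ) (V + 8 * n ^ 2 * T * e) (v' i)) ∧
      (∀ i l, FourierBound (ρ - 2 * σ) (c + 8 * n ^ 2 * T * e / σ)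
        fun x θ => fderiv ℝ (v' i x) θ (Pi.single l 1)) ∧
      (∀ j, FourierBound (ρ - 2 * σ)
        (4 * n ^ 3 * T * e ^ 2 / σ + 2 * t * (8 * n ^ 2 * T * e) ^ 2 / s ^ 2)
        (conjDefect q g v' (fun i => lam' i) j)) ∧
      (∀ i x θ, |v' i x θ - v i x θ| ≤ 8 * n ^ 2 * T * e) ∧
      ∀ i x, |lam' i x - lam i x| ≤ 4 * n ^ 2 * e := by
  have hρ : 0 < ρ := by linarith
  have hn' : (1 : ℝ) ≤ n := by exact_mod_cast hn
  have hnn : (n : ℝ) ≤ n ^ 2 := by nlinarith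
  have he : 0 ≤ e := (hE ⟨0, hn⟩).nonneg
  have hV : 0 ≤ V := (hv ⟨0, hn⟩).nonneg
  have hc0 : 0 ≤ c := (hdv ⟨0, hn⟩ ⟨0, hn⟩).nonneg
  have hncc : n * c ≤ n ^ 2 * c := by gcongr
  have hd0 : 0 ≤ 8 * n ^ 2 * T * e := by positivity
  obtain ⟨w, μ, hw, hμ, hwμ⟩ := exists_newton_direction hn (by linarith : σ ≤ ρ) hσ.le hT0 hT hc0 hc
    (fun i l => (hdv i l).translate q) hE
  have hρσ : 0 < ρ - σ := by linarith
  let δ : Fin n → X → (Fin n → ℝ) → ℝ := fun i x θ =>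
    w i x θ + ∑ l, fderiv ℝ (v i x) θ (Pi.single l 1) * w l x θ
  have hδ : ∀ i, FourierBound (ρ - σ) (8 * n ^ 2 * T * e) (δ i) := by
    intro i
    refine ((hw i).add hρσ.le (FourierBound.sum_const hρσ.le fun l =>
      ((hdv i l).mono (by linarith) le_rfl).mul hρσ.le (hw l))).mono le_rfl ?_
    have h1 : n * (c * (4 * n ^ 2 * T * e)) = (n * c) * (4 * n ^ 2 * T * e) := by ring
    have h2 : (n * c) * (4 * n ^ 2 * T * e) ≤ 4 * n ^ 2 * T * e :=
      mul_le_of_le_one_left (by positivity) (by linarith)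
    linarith
  refine ⟨fun i x θ => v i x θ + δ i x θ, fun i => lam i + μ i, fun i => ?_, fun i l => ?_,
    fun j => ?_, fun i x θ => ?_, fun i x => ?_⟩
  · exact ((hv i).mono (by linarith) le_rfl).add (by linarith) ((hδ i).mono (by linarith) le_rfl)
  · have h1 := (hδ i).fderiv hσ (by linarith : σ ≤ ρ - σ) l
    refine (((hdv i l).mono (by linarith) le_rfl).add (by linarith)
      (h1.mono (by linarith : ρ - 2 * σ ≤ ρ - σ - σ) le_rfl)).congr fun x θ => ?_
    rw [fderiv_fun_add ((hv i).differentiableAt hρ x θ) ((hδ i).differentiableAt hρσ x θ)]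
    rfl
  · have h1 := FourierBound.sum_const hρσ.le fun l =>
      ((hE j).fderiv hσ (by linarith) l).mul hρσ.le (hw l)
    have h2 := (hg j).taylor_remainder hρσ.le hV hd0
      (fun i => (hv i).mono (by linarith) le_rfl) hδ hs (by linarith)
    refine ((h1.sub hρσ.le h2).mono (by linarith) (le_of_eq ?_)).congr fun x θ => ?_
    · ring
    · exact conjDefect_newton (lam := fun i => lam i) (μ := fun i => μ i)
        (fun j θ => (hg j).differentiableAt (by linarith) x θ)
        (fun j θ => (hv j).differentiableAt hρ x θ) (fun i θ => rfl) (hwμ x) j θ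
  · simpa using (hδ i).abs_le hρσ.le x θ
  · simpa using hμ i x

end Linearised

section Iteration

variable {n : ℕ} {X : Type*} [TopologicalSpace X] [CompactSpace X]

/-- Quantitative approximate conjugacy at stage `y` of the Newton scheme; the stages are
`y = 1, 1/2, 1/4, …`. -/
structure NewtonState (q : Fin n → ℝ) (g : Fin n → X → (Fin n → ℝ) → ℝ) (r a H t : ℝ) (N : ℕ)
    (y : ℝ) (v : Fin n → X → (Fin n → ℝ) → ℝ) (lam : Fin n → C(X, ℝ)) : Prop where
  bound : ∀ i, FourierBound (r / 8 + 4 * a * y) (2 * H * t * (1 - y)) (v i)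
  bound_fderiv : ∀ i l, FourierBound (r / 8 + 4 * a * y) (2 * (H / a) * t * (1 - y))
    fun x θ => fderiv ℝ (v i x) θ (Pi.single l 1)
  defect : ∀ j, FourierBound (r / 8 + 4 * a * y) (t * y ^ (4 * N + 2))
    (conjDefect q g v (fun i => lam i) j)

lemma NewtonState.initial {q : Fin n → ℝ} {g : Fin n → X → (Fin n → ℝ) → ℝ}
    {r a H t : ℝ} {N : ℕ}
    (ha : 32 * a ≤ r) (hr : 0 < r) (hg : ∀ j, FourierBound r t (g j)) :
    NewtonState q g r a H t N 1 (fun _ _ _ => 0) 0 where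
  bound i := FourierBound.zero.mono le_rfl (by simp)
  bound_fderiv i l := (FourierBound.zero.mono le_rfl (by simp)).congr fun x θ => by simp
  defect j := ((hg j).neg.mono (by linarith) (by simp)).congr fun x θ => by simp [conjDefect]

lemma NewtonState.step (hn : 1 ≤ n) {q : Fin n → ℝ} {g : Fin n → X → (Fin n → ℝ) → ℝ}
    {r a t D H y : ℝ} {N : ℕ} {v : Fin n → X → (Fin n → ℝ) → ℝ} {lam : Fin n → C(X, ℝ)}
    (hD0 : 0 ≤ D)
    (hD : ∀ σ > 0, ∀ k : Fin n → ℤ, k ≠ 0 →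
      1 ≤ ‖torusChar k q - 1‖ * (D / σ ^ N * Real.exp (σ * freqLen k)))
    (ha0 : 0 < a) (ha : 32 * a ≤ r) (hH : H = 8 * n ^ 2 * D / a ^ N)
    (ht0 : 0 ≤ t) (ht1 : t ≤ 1) (htr : 12 * H * t ≤ r) (hta : 16 * n ^ 2 * (H / a) * t ≤ 1)
    (htq : (4 * n ^ 3 * D / a ^ (N + 1) + 2 * (8 * n ^ 2 * D / a ^ N) ^ 2 / (r / 2) ^ 2) *
      2 ^ (4 * N + 2) * t ≤ 1)
    (hg : ∀ j, FourierBound r t (g j)) (hy0 : 0 < y) (hy1 : y ≤ 1)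
    (hst : NewtonState q g r a H t N y v lam) :
    ∃ v' lam', NewtonState q g r a H t N (y / 2) v' lam' ∧
      (∀ i x θ, |v' i x θ - v i x θ| ≤ H * t * y) ∧
      ∀ i x, |lam' i x - lam i x| ≤ 4 * n ^ 2 * t * y := by
  have hr : 0 < r := by linarith
  have hH0 : 0 ≤ H := by rw [hH]; positivity
  have hay : 0 < a * y := by positivity
  have hTe : 8 * n ^ 2 * (D / (a * y) ^ N) * (t * y ^ (4 * N + 2)) = H * t * y ^ (3 * N + 2) := by
    rw [hH, mul_pow]
    field_simp
    ring
  have hpow : ∀ k l : ℕ, k ≤ l → y ^ l ≤ y ^ k := fun k l h => pow_le_pow_of_le_one hy0.le hy1 h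
  have hd : H * t * y ^ (3 * N + 2) ≤ H * t * y := by
    have := hpow 1 (3 * N + 2) (by omega)
    rw [pow_one] at this
    gcongr
  have hd2 : H * t * y ^ (3 * N + 2) / (a * y) ≤ H / a * t * y := by
    have h1 : H * t * y ^ (3 * N + 2) / (a * y) = H / a * t * y ^ (3 * N + 1) := by
      field_simp
      ring
    have := hpow 1 (3 * N + 1) (by omega)
    rw [pow_one] at this
    rw [h1]
    gcongr
  have hay1 : a * y ≤ a := mul_le_of_le_one_right ha0.le hy1
  have hHt : H * t * y ≤ H * t := mul_le_of_le_one_right (by positivity) hy1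
  have hHat : 0 ≤ H / a * t * y := by positivity
  have hHat2 : 0 ≤ H * t * y := by positivity
  obtain ⟨v', lam', h1, h2, h3, h4, h5⟩ := exists_newton_step hn hay
    (by linarith : 2 * (a * y) ≤ r / 8 + 4 * a * y) (by positivity) (hD (a * y) hay) hg hst.bound
    hst.bound_fderiv (by nlinarith [hta, hHat, sq_nonneg (n : ℝ)]) hst.defect
    (by positivity : 0 < r / 2)
    (by rw [hTe]; linarith)
  rw [hTe] at *
  have hρ : r / 8 + 4 * a * y - 2 * (a * y) = r / 8 + 4 * a * (y / 2) := by ring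
  rw [hρ] at h1 h2 h3
  refine ⟨v', lam', ⟨fun i => (h1 i).mono le_rfl (by linarith),
    fun i l => (h2 i l).mono le_rfl (by linarith), fun j => (h3 j).mono le_rfl ?_⟩,
    fun i x θ => (h4 i x θ).trans hd, fun i x => (h5 i x).trans ?_⟩
  · set A := 4 * n ^ 3 * D / a ^ (N + 1) with hA
    set B := 2 * (8 * n ^ 2 * D / a ^ N) ^ 2 / (r / 2) ^ 2 with hB
    have hA0 : 0 ≤ A := by positivity
    have hB0 : 0 ≤ B := by positivity
    have e1 : 4 * n ^ 3 * (D / (a * y) ^ N) * (t * y ^ (4 * N + 2)) ^ 2 / (a * y) =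
        A * t ^ 2 * y ^ (7 * N + 3) := by
      rw [hA, mul_pow]
      field_simp
      ring
    have e2 : 2 * t * (H * t * y ^ (3 * N + 2)) ^ 2 / (r / 2) ^ 2 =
        B * t ^ 2 * t * y ^ (6 * N + 4) := by
      rw [hB, hH]
      field_simp
      ring
    rw [e1, e2]
    have p1 := hpow (4 * N + 2) (7 * N + 3) (by omega)
    have p2 := hpow (4 * N + 2) (6 * N + 4) (by omega)
    have htwo : (0 : ℝ) < 2 ^ (4 * N + 2) := by positivity
    calc A * t ^ 2 * y ^ (7 * N + 3) + B * t ^ 2 * t * y ^ (6 * N + 4)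
        ≤ A * t ^ 2 * y ^ (4 * N + 2) + B * t ^ 2 * 1 * y ^ (4 * N + 2) := by gcongr
      _ = ((A + B) * 2 ^ (4 * N + 2) * t) * (t * (y / 2) ^ (4 * N + 2)) := by
        rw [div_pow]; field_simp
      _ ≤ t * (y / 2) ^ (4 * N + 2) := mul_le_of_le_one_left (by positivity) htq
  · have := hpow 1 (4 * N + 2) (by omega)
    rw [pow_one] at this
    calc _ = 4 * n ^ 2 * t * y ^ (4 * N + 2) := by ring
      _ ≤ _ := by gcongr

lemma NewtonState.exists_seq (hn : 1 ≤ n) {q : Fin n → ℝ} {g : Fin n → X → (Fin n → ℝ) → ℝ}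
    {r a t D H : ℝ} {N : ℕ} (hD0 : 0 ≤ D)
    (hD : ∀ σ > 0, ∀ k : Fin n → ℤ, k ≠ 0 →
      1 ≤ ‖torusChar k q - 1‖ * (D / σ ^ N * Real.exp (σ * freqLen k)))
    (ha0 : 0 < a) (ha : 32 * a ≤ r) (hH : H = 8 * n ^ 2 * D / a ^ N)
    (ht0 : 0 ≤ t) (ht1 : t ≤ 1) (htr : 12 * H * t ≤ r) (hta : 16 * n ^ 2 * (H / a) * t ≤ 1)
    (htq : (4 * n ^ 3 * D / a ^ (N + 1) + 2 * (8 * n ^ 2 * D / a ^ N) ^ 2 / (r / 2) ^ 2) *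
      2 ^ (4 * N + 2) * t ≤ 1)
    (hg : ∀ j, FourierBound r t (g j)) :
    ∃ v : ℕ → Fin n → X → (Fin n → ℝ) → ℝ, ∃ lam : ℕ → Fin n → C(X, ℝ),
      v 0 = (fun _ _ _ => 0) ∧ lam 0 = 0 ∧
      (∀ m, NewtonState q g r a H t N ((1 / 2) ^ m) (v m) (lam m)) ∧
      (∀ m i x θ, |v (m + 1) i x θ - v m i x θ| ≤ H * t * (1 / 2) ^ m) ∧
      ∀ m i x, |lam (m + 1) i x - lam m i x| ≤ 4 * n ^ 2 * t * (1 / 2) ^ m := by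
  let S : ℕ → Type _ := fun m =>
    {p : (Fin n → X → (Fin n → ℝ) → ℝ) × (Fin n → C(X, ℝ)) //
      NewtonState q g r a H t N ((1 / 2) ^ m) p.1 p.2}
  have hstep : ∀ m (p : S m), ∃ p' : S (m + 1),
      (∀ i x θ, |p'.1.1 i x θ - p.1.1 i x θ| ≤ H * t * (1 / 2) ^ m) ∧
      ∀ i x, |p'.1.2 i x - p.1.2 i x| ≤ 4 * n ^ 2 * t * (1 / 2) ^ m := by
    intro m p
    obtain ⟨v', lam', h1, h2, h3⟩ := p.2.step hn hD0 hD ha0 ha hH ht0 ht1 htr hta htq hg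
      (by positivity) (pow_le_one₀ (by norm_num) (by norm_num))
    exact ⟨⟨(v', lam'), by rw [pow_succ, mul_one_div]; exact h1⟩, h2, h3⟩
  choose next hnext using hstep
  have h0 : NewtonState q g r a H t N ((1 / 2) ^ 0) (fun _ _ _ => 0) 0 := by
    rw [pow_zero]
    exact NewtonState.initial ha (by linarith) hg
  let seq : ∀ m, S m := fun m => Nat.rec ⟨(fun _ _ _ => 0, 0), h0⟩ next m
  exact ⟨fun m => (seq m).1.1, fun m => (seq m).1.2, rfl, rfl, fun m => (seq m).2,
    fun m => (hnext m (seq m)).1, fun m => (hnext m (seq m)).2⟩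

end Iteration

open Filter Topology in
/-- KAM theorem for a small analytic perturbation of a Diophantine rotation, with a counterterm
depending continuously on the parameter. -/
theorem exists_conjugacy_with_counterterm {n : ℕ} (hn : 1 ≤ n) {q : Fin n → ℝ} {γ τ r : ℝ}
    (hγ : 0 < γ)
    (hdio : ∀ k : Fin n → ℤ, k ≠ 0 → ∀ k₀ : ℤ,
      γ * (∑ i, |(k i : ℝ)|) ^ (-τ) ≤ |(∑ i, (k i : ℝ) * q i) - 2 * π * (k₀ : ℝ)|)
    (hr : 0 < r) :
    ∃ t₀ > 0, ∃ C > 0, ∀ (X : Type) [TopologicalSpace X] [CompactSpace X]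
      (g : Fin n → X → (Fin n → ℝ) → ℝ), ∀ t, 0 ≤ t → t ≤ t₀ → (∀ j, FourierBound r t (g j)) →
      ∃ (lam : Fin n → C(X, ℝ)) (v : Fin n → X → (Fin n → ℝ) → ℝ),
        (∀ i x, |lam i x| ≤ C * t) ∧ (∀ i x θ, |v i x θ| ≤ C * t) ∧
        (∀ i x, Continuous (v i x)) ∧
        (∀ i x θ j, v i x (θ + Pi.single j (2 * π)) = v i x θ) ∧
        ∀ j x θ, conjDefect q g v (fun i => lam i) j x θ = 0 := by
  obtain ⟨D, hD0, N, hD⟩ := exists_small_divisor_bound hγ hdio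
  have hn' : (1 : ℝ) ≤ n := by exact_mod_cast hn
  obtain ⟨a, ha⟩ : ∃ a, a = r / 32 := ⟨_, rfl⟩
  obtain ⟨H, hH⟩ : ∃ H, H = 8 * n ^ 2 * D / a ^ N := ⟨_, rfl⟩
  obtain ⟨Q, hQ⟩ : ∃ Q : ℝ, Q = (4 * n ^ 3 * D / a ^ (N + 1) +
    2 * (8 * n ^ 2 * D / a ^ N) ^ 2 / (r / 2) ^ 2) * 2 ^ (4 * N + 2) := ⟨_, rfl⟩
  have ha0 : 0 < a := by rw [ha]; positivity
  have hH0 : 0 < H := by rw [hH]; positivity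
  have hQ0 : 0 < Q := by rw [hQ]; positivity
  refine ⟨min (min 1 (r / (12 * H))) (min (1 / (16 * n ^ 2 * (H / a))) (1 / Q)), by positivity,
    2 * H + 8 * n ^ 2, by positivity, fun X _ _ g t ht0 ht hg => ?_⟩
  obtain ⟨⟨ht1, ht2⟩, ht3, ht4⟩ : (t ≤ 1 ∧ t ≤ r / (12 * H)) ∧
      t ≤ 1 / (16 * n ^ 2 * (H / a)) ∧ t ≤ 1 / Q := by simpa only [le_min_iff] using ht
  rw [le_div_iff₀' (by positivity)] at ht2 ht3 ht4
  rw [hQ] at ht4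
  obtain ⟨v, lam, hv0, hl0, hst, hv, hl⟩ := NewtonState.exists_seq hn hD0.le hD ha0
    (by rw [ha]; linarith) hH ht0 ht1 ht2 ht3 ht4 hg
  have hhalf : (1 / 2 : ℝ) < 1 := by norm_num
  have hvd : ∀ i x θ m, dist (v m i x θ) (v (m + 1) i x θ) ≤ H * t * (1 / 2) ^ m :=
    fun i x θ m => by rw [dist_comm]; exact hv m i x θ
  have hld : ∀ i m, dist (lam m i) (lam (m + 1) i) ≤ 4 * n ^ 2 * t * (1 / 2) ^ m := fun i m => by
    rw [dist_comm]
    exact (ContinuousMap.dist_le (by positivity)).2 fun x => hl m i x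
  choose w hw using fun i x θ =>
    cauchySeq_tendsto_of_complete (cauchySeq_of_le_geometric _ _ hhalf (hvd i x θ))
  choose μ hμ using fun i =>
    cauchySeq_tendsto_of_complete (cauchySeq_of_le_geometric _ _ hhalf (hld i))
  have hwd : ∀ i x θ m, dist (v m i x θ) (w i x θ) ≤ H * t * (1 / 2) ^ m / (1 - 1 / 2) :=
    fun i x θ => dist_le_of_le_geometric_of_tendsto _ _ hhalf (hvd i x θ) (hw i x θ)
  have hpow : Tendsto (fun m : ℕ => (1 / 2 : ℝ) ^ m) atTop (𝓝 0) :=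
    tendsto_pow_atTop_nhds_zero_of_lt_one (by norm_num) hhalf
  have hρ : ∀ m : ℕ, 0 < r / 8 + 4 * a * (1 / 2) ^ m := fun m => by positivity
  have hcont : ∀ i x, Continuous (w i x) := by
    intro i x
    have hu : TendstoUniformly (fun m => v m i x) (w i x) atTop := by
      rw [Metric.tendstoUniformly_iff]
      intro η hη
      have h1 : Tendsto (fun m : ℕ => H * t * (1 / 2 : ℝ) ^ m / (1 - 1 / 2)) atTop (𝓝 0) := by
        simpa using (hpow.const_mul (H * t)).div_const (1 - 1 / 2)
      filter_upwards [h1.eventually_lt_const hη] with m hm θ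
      rw [dist_comm]
      exact (hwd i x θ m).trans_lt hm
    exact hu.continuous (Frequently.of_forall fun m =>
      ((hst m).bound i).continuous_angle (hρ m) x)
  have hμx : ∀ i x, Tendsto (fun m => lam m i x) atTop (𝓝 (μ i x)) := fun i x =>
    ((ContinuousMap.evalCLM ℝ x).continuous.tendsto _).comp (hμ i)
  refine ⟨μ, w, fun i x => ?_, fun i x θ => ?_, hcont, fun i x θ j => ?_, fun j x θ => ?_⟩
  · have h := dist_le_of_le_geometric_of_tendsto₀ _ _ hhalf (hld i) (hμ i)
    have h1 : dist (lam 0 i x) (μ i x) ≤ dist (lam 0 i) (μ i) := ContinuousMap.dist_apply_le_dist x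
    rw [hl0] at h1 h
    simp only [Pi.zero_apply, ContinuousMap.zero_apply, dist_zero_left, Real.norm_eq_abs] at h1 h
    have h2 : 0 ≤ H * t := by positivity
    have h3 : 4 * n ^ 2 * t / (1 - 1 / 2) = 8 * n ^ 2 * t := by ring
    linarith
  · have h := hwd i x θ 0
    rw [hv0] at h
    simp only [dist_zero_left, Real.norm_eq_abs, pow_zero, mul_one] at h
    have h2 : 0 ≤ 8 * n ^ 2 * t := by positivity
    have h3 : H * t / (1 - 1 / 2) = 2 * H * t := by ring
    linarith
  · refine tendsto_nhds_unique (hw i x _) ((hw i x θ).congr fun m => ?_)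
    exact (((hst m).bound i).periodic x θ j).symm
  · have h1 : Tendsto (fun m => conjDefect q g (v m) (fun i => lam m i) j x θ) atTop
        (𝓝 (conjDefect q g w (fun i => μ i) j x θ)) := by
      refine (((hw j x _).sub (hw j x θ)).sub (hμx j x)).sub ?_
      exact (((hg j).continuous_angle hr x).tendsto _).comp
        (tendsto_pi_nhds.2 fun i => (hw i x θ).const_add (θ i))
    have h2 : Tendsto (fun m => conjDefect q g (v m) (fun i => lam m i) j x θ) atTop (𝓝 0) := by
      refine squeeze_zero_norm (a := fun m : ℕ => t * (1 / 2) ^ m) (fun m => ?_)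
        (by simpa using hpow.const_mul t)
      refine (((hst m).defect j).abs_le (hρ m).le x θ).trans ?_
      have h3 : (1 / 2 : ℝ) ^ m ≤ 1 := pow_le_one₀ (by norm_num) (by norm_num)
      have h4 := pow_le_of_le_one (by positivity : (0 : ℝ) ≤ (1 / 2) ^ m) h3
        (by omega : 4 * N + 2 ≠ 0)
      gcongr
    exact tendsto_nhds_unique h1 h2

section PeriodicFunctions

open MeasureTheory Set

variable {n : ℕ}

/-- The half-open unit box with corner `a`. -/
def unitBox (a : Fin n → ℝ) : Set (Fin n → ℝ) := {x | ∀ i, x i ∈ Ioc (a i) (a i + 1)}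

lemma volume_unitBox (a : Fin n → ℝ) : volume (unitBox a) = 1 := by
  have h : unitBox a = Set.pi univ fun i => Ioc (a i) (a i + 1) := by
    ext x; simp [unitBox]
  rw [h, volume_pi_pi]
  simp

lemma unitBox_subset (a : Fin n → ℝ) : unitBox a ⊆ Icc a (fun i => a i + 1) :=
  fun _ hx => ⟨fun i => (hx i).1.le, fun i => (hx i).2⟩

lemma eq_of_integer_translate {G : (Fin n → ℝ) → ℂ}
    (hG : ∀ θ j, G (θ + Pi.single j 1) = G θ) (m : Fin n → ℤ) (θ : Fin n → ℝ) :
    G (θ + fun i => (m i : ℝ)) = G θ := by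
  have h1 : ∀ j, Function.Periodic G (Pi.single j 1) := fun j θ => hG θ j
  have h2 : ∀ s : Finset (Fin n), Function.Periodic G (∑ j ∈ s, m j • Pi.single j (1 : ℝ)) := by
    intro s
    induction s using Finset.induction_on with
    | empty => intro θ; simp
    | insert j s hj ih => rw [Finset.sum_insert hj]; exact ((h1 j).zsmul (m j)).add_period ih
  have h3 : (fun i => (m i : ℝ)) = ∑ j, m j • Pi.single j (1 : ℝ) := by
    funext i
    simp [Finset.sum_apply, Pi.single_apply]
  rw [h3]
  exact h2 Finset.univ θ

/-- A continuous periodic function factors through the torus. -/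
lemma exists_torus_lift {G : (Fin n → ℝ) → ℂ} (hGc : Continuous G)
    (hG : ∀ θ j, G (θ + Pi.single j 1) = G θ) :
    ∃ g : C(UnitAddTorus (Fin n), ℂ),
      ∀ θ : Fin n → ℝ, g (fun i => (θ i : UnitAddCircle)) = G θ := by
  have hq : IsOpenQuotientMap (Pi.map fun _ : Fin n => ((↑) : ℝ → UnitAddCircle)) :=
    IsOpenQuotientMap.piMap fun _ => QuotientAddGroup.isOpenQuotientMap_mk
  have hlift : ∀ x y : Fin n → ℝ, Pi.map (fun _ : Fin n => ((↑) : ℝ → UnitAddCircle)) x =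
      Pi.map (fun _ : Fin n => ((↑) : ℝ → UnitAddCircle)) y → G x = G y := by
    intro x y hxy
    have h1 : ∀ i, ∃ m : ℤ, y i = x i + m := by
      intro i
      have h2 : (x i : UnitAddCircle) = y i := congrFun hxy i
      rw [eq_comm, QuotientAddGroup.eq_iff_sub_mem, AddSubgroup.mem_zmultiples_iff] at h2
      obtain ⟨m, hm⟩ := h2
      exact ⟨m, by simp at hm; linarith⟩
    choose m hm using h1
    have h3 : y = x + fun i => (m i : ℝ) := funext hm
    rw [h3, eq_of_integer_translate hG]
  let f : C(Fin n → ℝ, UnitAddTorus (Fin n)) := ⟨_, hq.continuous⟩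
  have hf : Topology.IsQuotientMap f := hq.isQuotientMap
  refine ⟨hf.lift ⟨G, hGc⟩ hlift, fun θ => ?_⟩
  exact DFunLike.congr_fun (hf.lift_comp ⟨G, hGc⟩ hlift) θ

lemma mFourier_coe (k : Fin n → ℤ) (θ : Fin n → ℝ) :
    UnitAddTorus.mFourier k (fun i => (θ i : UnitAddCircle)) =
      torusChar k fun i => 2 * π * θ i := by
  simp only [UnitAddTorus.mFourier, ContinuousMap.coe_mk, fourier_coe_apply, torusChar,
    ← Complex.exp_sum]
  congr 1
  push_cast
  rw [Finset.sum_mul]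
  exact Finset.sum_congr rfl fun i _ => by ring

lemma setIntegral_unitBox_translate {G : (Fin n → ℝ) → ℂ} (hGc : Continuous G)
    (hG : ∀ θ j, G (θ + Pi.single j 1) = G θ) (a : Fin n → ℝ) :
    ∫ x in unitBox 0, G (x + a) = ∫ x in unitBox 0, G x := by
  obtain ⟨g, hg⟩ := exists_torus_lift hGc hG
  have h1 := UnitAddTorus.mFourierCoeff_eq_integral g (0 : Fin n → ℤ) a
  rw [UnitAddTorus.mFourierCoeff_eq_integral g (0 : Fin n → ℤ) 0] at h1
  simp only [neg_zero, UnitAddTorus.mFourier_zero, ContinuousMap.one_apply, one_smul, hg] at h1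
  have h2 := (measurePreserving_add_right volume a).setIntegral_preimage_emb
    (measurableEmbedding_addRight a) G (unitBox a)
  have h3 : (fun x => x + a) ⁻¹' unitBox a = unitBox 0 := by
    ext x
    simp [unitBox, add_comm (x _)]
  rw [h3] at h2
  exact h2.trans h1.symm

/-- A periodic function whose means along one coordinate are bounded has bounded mean. -/
lemma norm_setIntegral_unitBox_le {G : (Fin n → ℝ) → ℂ} (hGc : Continuous G)
    (hG : ∀ θ j, G (θ + Pi.single j 1) = G θ) {B : ℝ} (j : Fin n)
    (hB : ∀ θ : Fin n → ℝ, ‖∫ s in (0 : ℝ)..1, G (θ + Pi.single j s)‖ ≤ B) :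
    ‖∫ x in unitBox 0, G x‖ ≤ B := by
  have hc : Continuous (Function.uncurry fun (s : ℝ) (x : Fin n → ℝ) => G (x + Pi.single j s)) := by
    refine hGc.comp (continuous_snd.add ?_)
    exact (continuous_single j).comp continuous_fst
  have h1 : ∫ x in unitBox 0, G x =
      ∫ s in (0 : ℝ)..1, ∫ x in unitBox 0, G (x + Pi.single j s) := by
    simp [setIntegral_unitBox_translate hGc hG]
  have h2 : ∫ s in (0 : ℝ)..1, ∫ x in unitBox 0, G (x + Pi.single j s) =
      ∫ x in unitBox 0, ∫ s in (0 : ℝ)..1, G (x + Pi.single j s) := by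
    simp only [intervalIntegral.integral_of_le zero_le_one]
    refine integral_integral_swap ?_
    rw [Measure.prod_restrict]
    refine (hc.continuousOn.integrableOn_compact
      (isCompact_Icc.prod isCompact_Icc)).mono_set (Set.prod_mono Ioc_subset_Icc_self
        (unitBox_subset 0))
  rw [h1, h2]
  have h3 := norm_setIntegral_le_of_norm_le_const (μ := volume) (s := unitBox (0 : Fin n → ℝ))
    (f := fun x => ∫ s in (0 : ℝ)..1, G (x + Pi.single j s)) (C := B) (by simp [volume_unitBox])
    fun x _ => hB x
  simpa [Measure.real, volume_unitBox] using h3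

end PeriodicFunctions

/-- Contour shift for a holomorphic function with period one. -/
lemma Complex.intervalIntegral_shift_of_periodic {φ : ℂ → ℂ} {s : ℝ}
    (hc : ContinuousOn φ {z | z.im ∈ Set.uIcc 0 s})
    (hd : DifferentiableOn ℂ φ {z | z.im ∈ Set.Ioo (min 0 s) (max 0 s)})
    (hper : ∀ z : ℂ, z.im ∈ Set.uIcc 0 s → φ (z + 1) = φ z) :
    ∫ x in (0 : ℝ)..1, φ x = ∫ x in (0 : ℝ)..1, φ (x + s * Complex.I) := by
  have h := Complex.integral_boundary_rect_eq_zero_of_continuousOn_of_differentiableOn φ 0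
    (1 + s * Complex.I) (hc.mono fun z hz => ?_) (hd.mono fun z hz => ?_)
  · have h2 : ∫ y in (0 : ℝ)..s, φ (1 + y * Complex.I) = ∫ y in (0 : ℝ)..s, φ (y * Complex.I) := by
      refine intervalIntegral.integral_congr fun y hy => ?_
      rw [add_comm]
      exact hper _ (by simpa using hy)
    simp at h
    rw [h2] at h
    simpa [sub_eq_zero] using h
  · simpa using hz.2
  · simpa using hz.2

/-- Exponential sums over multi-indices converge. -/
lemma summable_exp_neg_freqLen (n : ℕ) {s : ℝ} (hs : 0 < s) :
    Summable fun k : Fin n → ℤ => Real.exp (-(s * freqLen k)) := by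
  have hZ : Summable fun m : ℤ => Real.exp (-(s * |(m : ℝ)|)) := by
    have hN : Summable fun m : ℕ => Real.exp (-(s * (m : ℝ))) := by
      have := Real.summable_exp_nat_mul_iff.2 (neg_lt_zero.2 hs)
      exact this.congr fun m => by ring_nf
    refine Summable.of_nat_of_neg (hN.congr fun m => by simp) (hN.congr fun m => by simp)
  induction n with
  | zero => exact Summable.of_finite
  | succ n ih =>
    have h := hZ.mul_of_nonneg ih (fun _ => (Real.exp_pos _).le) (fun _ => (Real.exp_pos _).le)
    rw [← (Fin.consEquiv fun _ : Fin (n + 1) => ℤ).summable_iff]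
    refine h.congr fun p => ?_
    simp only [Function.comp, Fin.consEquiv, Equiv.coe_fn_mk, freqLen, Fin.sum_univ_succ,
      Fin.cons_zero, Fin.cons_succ, ← Real.exp_add]
    ring_nf

section Strip

open MeasureTheory Set

variable {n : ℕ} {h M : ℝ}

/-- The closed strip of half-width `h` (in the `ℓ¹`-norm) around `ℝⁿ`. -/
def complexStrip (n : ℕ) (h : ℝ) : Set (Fin n → ℂ) := {θ | ∑ i, |(θ i).im| ≤ h}

lemma ofReal_mem_complexStrip (hh : 0 ≤ h) (θ : Fin n → ℝ) :
    (fun i => (θ i : ℂ)) ∈ complexStrip n h := by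
  simpa [complexStrip] using hh

lemma lt_subset_interior_complexStrip :
    {θ : Fin n → ℂ | ∑ i, |(θ i).im| < h} ⊆ interior (complexStrip n h) := by
  refine interior_maximal (fun θ hθ => show ∑ i, |(θ i).im| ≤ h from
    le_of_lt (show ∑ i, |(θ i).im| < h from hθ)) ?_
  exact isOpen_lt (by fun_prop) continuous_const

lemma continuous_torusChar (k : Fin n → ℤ) : Continuous (torusChar k) := by
  unfold torusChar
  fun_prop

/-- Exponential decay of the Fourier coefficients of a holomorphic function, in one direction. -/
lemma norm_fourierCoeff_le {F : (Fin n → ℂ) → ℂ} (hh : 0 < h)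
    (hc : ContinuousOn F (complexStrip n h))
    (hd : DifferentiableOn ℂ F (interior (complexStrip n h)))
    (hper : ∀ θ ∈ complexStrip n h, ∀ j, F (θ + Pi.single j (2 * π : ℂ)) = F θ)
    (hM : ∀ θ ∈ complexStrip n h, ‖F θ‖ ≤ M) (k : Fin n → ℤ) (j : Fin n) :
    ‖∫ t in unitBox 0, torusChar (-k) (fun i => 2 * π * t i) *
      F fun i => ((2 * π * t i : ℝ) : ℂ)‖ ≤ M * Real.exp (-(h * |(k j : ℝ)|)) := by
  have hcr : Continuous fun θ : Fin n → ℝ => F fun i => ((2 * π * θ i : ℝ) : ℂ) :=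
    hc.comp_continuous (by fun_prop) fun θ => ofReal_mem_complexStrip hh.le _
  refine norm_setIntegral_unitBox_le
    (G := fun t => torusChar (-k) (fun i => 2 * π * t i) * F fun i => ((2 * π * t i : ℝ) : ℂ))
    (((continuous_torusChar _).comp (by fun_prop)).mul hcr) (fun θ l => ?_) j fun θ => ?_
  · have h1 : (fun i => 2 * π * (θ + Pi.single l 1 : Fin n → ℝ) i) =
        (fun i => 2 * π * θ i) + Pi.single l (2 * π) := by
      funext i
      by_cases hi : i = l
      · subst hi; simp [mul_add]
      · simp [hi]
    have h2 : (fun i => ((2 * π * (θ + Pi.single l 1 : Fin n → ℝ) i : ℝ) : ℂ)) =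
        (fun i => ((2 * π * θ i : ℝ) : ℂ)) + Pi.single l (2 * π : ℂ) := by
      funext i
      by_cases hi : i = l
      · subst hi; simp [mul_add]
      · simp [hi]
    have h3 : torusChar (-k) (Pi.single l (2 * π)) = 1 := by
      rw [torusChar, Complex.exp_eq_one_iff]
      refine ⟨-k l, ?_⟩
      simp only [Pi.single_apply, mul_ite, mul_zero, Finset.sum_ite_eq', Finset.mem_univ, if_true,
        Pi.neg_apply]
      push_cast
      ring
    rw [h1, h2, hper _ (ofReal_mem_complexStrip hh.le _), torusChar_add_apply, h3, mul_one]
  · let p : ℂ → Fin n → ℂ := fun z =>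
      (fun i => ((2 * π * θ i : ℝ) : ℂ)) + z • Pi.single j (2 * π : ℂ)
    let φ : ℂ → ℂ := fun z => torusChar (-k) (fun i => 2 * π * θ i) *
      Complex.exp (-(2 * π * k j * Complex.I) * z) * F (p z)
    have hpim : ∀ z, ∑ i, |(p z i).im| = 2 * π * |z.im| := by
      intro z
      have : ∀ i, |(p z i).im| = if i = j then 2 * π * |z.im| else 0 := by
        intro i
        by_cases hi : i = j
        · subst hi
          simp [p, abs_mul, abs_of_pos Real.pi_pos]
          ring
        · simp [p, hi]
      simp [this]
    have hpd : Differentiable ℂ p := by fun_prop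
    have hsh : ∃ s : ℝ, |s| = h / (2 * π) ∧ 2 * π * k j * s = -(h * |(k j : ℝ)|) := by
      rcases abs_cases (k j : ℝ) with ⟨h1, -⟩ | ⟨h1, -⟩
      · refine ⟨-(h / (2 * π)), by rw [abs_neg, abs_of_pos]; positivity, ?_⟩
        rw [h1]; field_simp
      · refine ⟨h / (2 * π), by rw [abs_of_pos]; positivity, ?_⟩
        rw [h1]; field_simp
    obtain ⟨s, hs, hks⟩ := hsh
    have hs' : 2 * π * |s| = h := by rw [hs]; field_simp
    have hmem : ∀ z : ℂ, z.im ∈ uIcc 0 s → p z ∈ complexStrip n h := by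
      intro z hz
      have h1 : |z.im| ≤ |s| := by simpa using abs_sub_left_of_mem_uIcc hz
      change ∑ i, |(p z i).im| ≤ h
      rw [hpim, ← hs']
      gcongr
    have hint : ∀ z : ℂ, z.im ∈ Ioo (min 0 s) (max 0 s) → p z ∈ interior (complexStrip n h) := by
      intro z hz
      refine lt_subset_interior_complexStrip ?_
      have h1 : |z.im| < |s| := by
        rcases le_total 0 s with h0 | h0
        · rw [min_eq_left h0, max_eq_right h0] at hz
          rw [abs_of_pos hz.1, abs_of_nonneg h0]
          exact hz.2
        · rw [min_eq_right h0, max_eq_left h0] at hz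
          rw [abs_of_neg hz.2, abs_of_nonpos h0]
          linarith [hz.1]
      change ∑ i, |(p z i).im| < h
      rw [hpim, ← hs']
      gcongr
    have hshift := Complex.intervalIntegral_shift_of_periodic (φ := φ) (s := s)
      (ContinuousOn.mul (Continuous.continuousOn (by fun_prop))
        (hc.comp hpd.continuous.continuousOn hmem))
      (DifferentiableOn.mul (Differentiable.differentiableOn (by fun_prop))
        (hd.comp hpd.differentiableOn hint))
      (fun z hz => by
        have h1 : p (z + 1) = p z + Pi.single j (2 * π : ℂ) := by
          simp only [p, add_smul, one_smul, add_assoc]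
        have h2 : Complex.exp (-(2 * π * k j * Complex.I) * (z + 1)) =
            Complex.exp (-(2 * π * k j * Complex.I) * z) := by
          rw [Complex.exp_eq_exp_iff_exists_int]
          exact ⟨-k j, by push_cast; ring⟩
        simp only [φ, h1, h2, hper _ (hmem z hz)])
    have hreal : ∀ a : ℝ, torusChar (-k) (fun i => 2 * π * (θ + Pi.single j a : Fin n → ℝ) i) *
        F (fun i => ((2 * π * (θ + Pi.single j a : Fin n → ℝ) i : ℝ) : ℂ)) = φ a := by
      intro a
      have h1 : (fun i => 2 * π * (θ + Pi.single j a : Fin n → ℝ) i) =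
          (fun i => 2 * π * θ i) + Pi.single j (2 * π * a) := by
        funext i
        by_cases hi : i = j
        · subst hi; simp [mul_add]
        · simp [hi]
      have h2 : (fun i => ((2 * π * (θ + Pi.single j a : Fin n → ℝ) i : ℝ) : ℂ)) = p a := by
        funext i
        by_cases hi : i = j
        · subst hi; simp [p]; ring
        · simp [hi, p]
      have h3 : torusChar (-k) (Pi.single j (2 * π * a)) =
          Complex.exp (-(2 * π * k j * Complex.I) * a) := by
        rw [torusChar]
        simp only [Pi.single_apply, mul_ite, mul_zero, Finset.sum_ite_eq', Finset.mem_univ, if_true,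
          Pi.neg_apply]
        push_cast
        ring_nf
      rw [h1, h2, torusChar_add_apply, h3]
    simp only [hreal]
    rw [hshift]
    have hbound : ∀ a ∈ uIoc (0 : ℝ) 1, ‖φ (a + s * Complex.I)‖ ≤
        M * Real.exp (-(h * |(k j : ℝ)|)) := by
      intro a _
      have h1 : p (a + s * Complex.I) ∈ complexStrip n h := hmem _ (by simp)
      have h2 : (-(2 * π * k j * Complex.I) * (a + s * Complex.I) : ℂ).re = -(h * |(k j : ℝ)|) := by
        rw [← hks]
        simp
      rw [norm_mul, norm_mul, norm_torusChar, one_mul, Complex.norm_exp, h2, mul_comm]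
      exact mul_le_mul_of_nonneg_right (hM _ h1) (Real.exp_pos _).le
    simpa using intervalIntegral.norm_integral_le_of_norm_le_const hbound

/-- A bounded holomorphic function on a strip has exponentially decaying Fourier coefficients. -/
theorem exists_fourierBound_of_holomorphic (hn : 1 ≤ n) (hh : 0 < h) :
    ∃ K > 0, ∀ (X : Type) [TopologicalSpace X] [CompactSpace X] [FirstCountableTopology X]
      (F : X → (Fin n → ℂ) → ℂ) (M : ℝ), 0 ≤ M →
      (∀ x, ContinuousOn (F x) (complexStrip n h)) →
      (∀ x, DifferentiableOn ℂ (F x) (interior (complexStrip n h))) →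
      (∀ x, ∀ θ ∈ complexStrip n h, ∀ j, F x (θ + Pi.single j (2 * π : ℂ)) = F x θ) →
      (∀ x, ∀ θ ∈ complexStrip n h, ‖F x θ‖ ≤ M) →
      (∀ θ : Fin n → ℝ, Continuous fun x => F x fun i => (θ i : ℂ)) →
      FourierBound (h / (2 * n)) (K * M) fun x θ => (F x fun i => (θ i : ℂ)).re := by
  have hn' : (0 : ℝ) < n := by exact_mod_cast hn
  have hs : 0 < h / (2 * n) := by positivity
  have hsum := summable_exp_neg_freqLen n hs
  refine ⟨∑' k : Fin n → ℤ, Real.exp (-(h / (2 * n) * freqLen k)),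
    hsum.tsum_pos (fun _ => (Real.exp_pos _).le) 0 (Real.exp_pos _), ?_⟩
  intro X _ _ _ F M hM0 hc hd hper hM hX
  have hcr : ∀ x, Continuous fun θ : Fin n → ℝ => F x fun i => ((2 * π * θ i : ℝ) : ℂ) :=
    fun x => (hc x).comp_continuous (by fun_prop) fun θ => ofReal_mem_complexStrip hh.le _
  have hchar : ∀ k : Fin n → ℤ, Continuous fun t : Fin n → ℝ =>
      torusChar k (fun i => 2 * π * t i) := fun k => (continuous_torusChar k).comp (by fun_prop)
  have hcoef : ∀ k : Fin n → ℤ, Continuous fun x => ∫ t in unitBox 0,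
      torusChar (-k) (fun i => 2 * π * t i) * F x fun i => ((2 * π * t i : ℝ) : ℂ) := by
    intro k
    refine continuous_of_dominated (bound := fun _ => M)
      (fun x => ((hchar _).mul (hcr x)).aestronglyMeasurable) (fun x => ?_)
      (integrableOn_const (by simp [volume_unitBox])) (Filter.Eventually.of_forall fun t => ?_)
    · refine Filter.Eventually.of_forall fun t => ?_
      rw [norm_mul, norm_torusChar, one_mul]
      exact hM x _ (ofReal_mem_complexStrip hh.le _)
    · exact continuous_const.mul (hX _)
  let a : (Fin n → ℤ) → C(X, ℂ) := fun k => ⟨_, hcoef k⟩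
  have hak : ∀ k x, ‖a k x‖ ≤ M * Real.exp (-(h / n * freqLen k)) := by
    intro k x
    have : Nonempty (Fin n) := ⟨⟨0, hn⟩⟩
    obtain ⟨j, -, hj⟩ := Finset.exists_max_image Finset.univ (fun i => |(k i : ℝ)|)
      Finset.univ_nonempty
    refine (norm_fourierCoeff_le hh (hc x) (hd x) (hper x) (hM x) k j).trans ?_
    have h1 : freqLen k ≤ n * |(k j : ℝ)| := by
      simpa [freqLen] using Finset.sum_le_card_nsmul _ _ _ hj
    have h2 : h / n * freqLen k ≤ h * |(k j : ℝ)| := by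
      calc h / n * freqLen k ≤ h / n * (n * |(k j : ℝ)|) := by gcongr
        _ = _ := by field_simp
    gcongr
  have hle : ∀ k, ‖a k‖ * Real.exp (h / (2 * n) * freqLen k) ≤
      M * Real.exp (-(h / (2 * n) * freqLen k)) := by
    intro k
    have h1 : ‖a k‖ ≤ M * Real.exp (-(h / n * freqLen k)) :=
      (ContinuousMap.norm_le _ (by positivity)).2 (hak k)
    calc _ ≤ M * Real.exp (-(h / n * freqLen k)) * Real.exp (h / (2 * n) * freqLen k) := by gcongr
      _ = _ := by
        rw [mul_assoc, ← Real.exp_add]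
        congr 2
        field_simp
        ring
  have hsa : Summable fun k => ‖a k‖ * Real.exp (h / (2 * n) * freqLen k) :=
    Summable.of_nonneg_of_le (fun k => by positivity) hle (hsum.mul_left M)
  refine ⟨a, hsa, ?_, fun x θ => ?_⟩
  · refine (hsa.tsum_le_tsum hle (hsum.mul_left M)).trans ?_
    rw [tsum_mul_left, mul_comm]
  · obtain ⟨g, hg⟩ := exists_torus_lift (hcr x) (fun θ l => by
      have h2 : (fun i => ((2 * π * (θ + Pi.single l 1 : Fin n → ℝ) i : ℝ) : ℂ)) =
          (fun i => ((2 * π * θ i : ℝ) : ℂ)) + Pi.single l (2 * π : ℂ) := by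
        funext i
        by_cases hi : i = l
        · subst hi; simp [mul_add]
        · simp [hi]
      rw [h2, hper x _ (ofReal_mem_complexStrip hh.le _)])
    have hga : ∀ k, UnitAddTorus.mFourierCoeff g k = a k x := by
      intro k
      rw [UnitAddTorus.mFourierCoeff_eq_integral _ _ 0]
      simp only [mFourier_coe, hg, smul_eq_mul]
      rfl
    have hsg : Summable (UnitAddTorus.mFourierCoeff g) := by
      refine Summable.of_norm_bounded hsa fun k => ?_
      rw [hga]
      have := freqLen_nonneg k
      exact ((a k).norm_coe_le_norm x).trans
        (le_mul_of_one_le_right (norm_nonneg _) (Real.one_le_exp (by positivity)))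
    have h1 := UnitAddTorus.hasSum_mFourier_series_apply_of_summable hsg
      (fun i => ((θ i / (2 * π) : ℝ) : UnitAddCircle))
    have h2 : ∀ i, 2 * π * (θ i / (2 * π)) = θ i := fun i => by field_simp
    simp only [hg, hga, mFourier_coe, h2, smul_eq_mul] at h1
    exact h1.mapL Complex.reCLM

end Strip

section Brouwer

open MeasureTheory Set Metric
open scoped NNReal

variable {E : Type*} [NormedAddCommGroup E] [NormedSpace ℝ E] [FiniteDimensional ℝ E]

/-- Lagrange interpolation of `t ↦ det (1 + t A)` from nodes in `(0, t₀]`. -/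
lemma exists_det_interpolation (E : Type*) [NormedAddCommGroup E] [NormedSpace ℝ E]
    [FiniteDimensional ℝ E] {t₀ : ℝ} (ht₀ : 0 < t₀) :
    ∃ (N : ℕ) (w t : ℕ → ℝ), (∀ i < N, 0 ≤ t i ∧ t i ≤ t₀) ∧ ∑ i ∈ Finset.range N, w i = 1 ∧
      ∀ A : E →L[ℝ] E, (1 + A).det = ∑ i ∈ Finset.range N, w i * (1 + t i • A).det := by
  set d := Module.finrank ℝ E
  let b := Module.finBasis ℝ E
  let t : ℕ → ℝ := fun i => t₀ * (i / (d + 1))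
  have hinj : Set.InjOn t (Finset.range (d + 1)) := by
    intro i _ j _ hij
    have hd : (0 : ℝ) < d + 1 := by positivity
    have := mul_left_cancel₀ ht₀.ne' hij
    field_simp at this
    exact_mod_cast this
  let w : ℕ → ℝ := fun i => (Lagrange.basis (Finset.range (d + 1)) t i).eval 1
  have key : ∀ A : E →L[ℝ] E, (1 + A).det =
      ∑ i ∈ Finset.range (d + 1), w i * (1 + t i • A).det := by
    intro A
    let m := LinearMap.toMatrix b b (A : E →ₗ[ℝ] E)
    let p : Polynomial ℝ := ((Polynomial.X : Polynomial ℝ) • m.map Polynomial.C +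
      (1 : Matrix (Fin d) (Fin d) ℝ).map Polynomial.C).det
    have heval : ∀ s : ℝ, p.eval s = (1 + s • A).det := by
      intro s
      have h1 : (1 + s • A).det =
          LinearMap.det ((LinearMap.id : E →ₗ[ℝ] E) + s • (A : E →ₗ[ℝ] E)) := rfl
      rw [h1, ← LinearMap.det_toMatrix b, map_add, map_smul, LinearMap.toMatrix_id]
      simp only [p]
      rw [← Polynomial.coe_evalRingHom, RingHom.map_det]
      congr 1
      ext i j
      by_cases hij : i = j
      · subst hij
        simp [m]
        ring
      · simp [m, hij]
        ring
    have hdeg : p.degree < (Finset.range (d + 1)).card := by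
      refine Polynomial.degree_le_natDegree.trans_lt ?_
      rw [Finset.card_range]
      exact_mod_cast Nat.lt_succ_of_le
        ((Polynomial.natDegree_det_X_add_C_le m 1).trans_eq (Fintype.card_fin d))
    have h2 := congrArg (Polynomial.eval 1) (Lagrange.eq_interpolate hinj hdeg)
    rw [Lagrange.interpolate_apply, Polynomial.eval_finsetSum] at h2
    simp only [Polynomial.eval_mul, Polynomial.eval_C, heval, one_smul] at h2
    rw [h2]
    exact Finset.sum_congr rfl fun i _ => mul_comm _ _
  refine ⟨d + 1, w, t, fun i hi => ⟨by positivity, ?_⟩, ?_, key⟩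
  · refine mul_le_of_le_one_right ht₀.le ?_
    rw [div_le_one (by positivity)]
    exact_mod_cast hi.le
  · have := key 0
    simpa [ContinuousLinearMap.det] using this.symm

/-- A small Lipschitz perturbation of the identity that is supported in a ball permutes it. -/
lemma bijOn_ball_of_lipschitz {F : E → E} {K : ℝ≥0} (hK : K < 1) {r : ℝ}
    (hF : LipschitzWith K fun x => F x - x) (hid : ∀ x, r ≤ ‖x‖ → F x = x) :
    BijOn F (ball 0 r) (ball 0 r) := by
  have hinj : Function.Injective F := by
    intro x y hxy
    have h1 := hF.dist_le_mul x y
    simp only [hxy, dist_eq_norm] at h1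
    have h2 : ‖F y - x - (F y - y)‖ = ‖x - y‖ := by rw [← norm_neg]; congr 1; abel
    rw [h2] at h1
    have h3 : (K : ℝ) < 1 := by exact_mod_cast hK
    have h4 : ‖x - y‖ = 0 := by nlinarith [norm_nonneg (x - y)]
    exact sub_eq_zero.1 (norm_eq_zero.1 h4)
  refine ⟨fun x hx => ?_, hinj.injOn, fun y hy => ?_⟩
  · by_contra hc
    have h1 : r ≤ ‖F x‖ := by simpa using hc
    exact hc (by rwa [hinj (hid _ h1)])
  · have hcon : ContractingWith K fun x => y - (F x - x) :=
      ⟨hK, LipschitzWith.of_dist_le_mul fun a b => by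
        simpa only [dist_sub_left] using hF.dist_le_mul a b⟩
    obtain ⟨x, hx, -⟩ := hcon.exists_fixedPoint 0 (edist_ne_top _ _)
    have hFx : F x = y := by
      have : y - (F x - x) = x := hx
      rw [sub_eq_iff_eq_add, add_sub_cancel] at this
      exact this.symm
    refine ⟨x, ?_, hFx⟩
    by_contra hc
    have h1 : r ≤ ‖x‖ := by simpa using hc
    exact hc (by rw [← hid x h1, hFx]; exact hy)

lemma exists_det_one_add_pos (E : Type*) [NormedAddCommGroup E] [NormedSpace ℝ E]
    [FiniteDimensional ℝ E] : ∃ η > 0, ∀ A : E →L[ℝ] E, ‖A‖ < η → 0 < (1 + A).det := by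
  have hc : Continuous fun A : E →L[ℝ] E => (1 + A).det :=
    ContinuousLinearMap.continuous_det.comp (by fun_prop)
  have h1 : ∀ᶠ A in nhds (0 : E →L[ℝ] E), 0 < (1 + A).det :=
    hc.continuousAt.eventually_const_lt (by simp [ContinuousLinearMap.det])
  obtain ⟨η, hη, h⟩ := Metric.eventually_nhds_iff.1 h1
  exact ⟨η, hη, fun A hA => h (by simpa using hA)⟩

/-- There is no Lipschitz map that fixes the complement of a ball and sends the ball into the
sphere. -/
theorem LipschitzWith.not_retraction {R : E → E} {L : ℝ≥0} (hR : LipschitzWith L R) {r : ℝ}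
    (hr : 0 < r) (hid : ∀ x, r ≤ ‖x‖ → R x = x) (hs : ∀ x, ‖x‖ < r → ‖R x‖ = r) : False := by
  borelize E
  let μ : Measure E := μH[Module.finrank ℝ E]
  obtain ⟨η, hη, hdet⟩ := exists_det_one_add_pos E
  let g : E → E := fun x => R x - x
  have hg : LipschitzWith (L + 1) g := hR.sub LipschitzWith.id
  have hL : (0 : ℝ) < (L + 1 : ℝ≥0) := by positivity
  obtain ⟨t₀, ht₀, ht₁, htη⟩ :
      ∃ t₀ : ℝ, 0 < t₀ ∧ t₀ * (L + 1 : ℝ≥0) < 1 ∧ t₀ * (L + 1 : ℝ≥0) < η := by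
    refine ⟨min 1 η / (2 * (L + 1 : ℝ≥0)), by positivity, ?_, ?_⟩
    · rw [div_mul_eq_mul_div, div_lt_iff₀ (by positivity)]
      nlinarith [min_le_left 1 η]
    · rw [div_mul_eq_mul_div, div_lt_iff₀ (by positivity)]
      nlinarith [min_le_right 1 η]
  obtain ⟨N, w, t, ht, hw, hint⟩ := exists_det_interpolation E ht₀
  let s : Set E := {x | DifferentiableAt ℝ g x} ∩ ball 0 r
  have hsm : MeasurableSet s := (measurableSet_of_differentiableAt ℝ g).inter measurableSet_ball
  have hae : ∀ᵐ x ∂μ, DifferentiableAt ℝ g x := hg.ae_differentiableAt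
  have hnull : μ (ball 0 r \ s) = 0 := by
    refine measure_mono_null ?_ (ae_iff.1 hae)
    intro x hx hd
    exact hx.2 ⟨hd, hx.1⟩
  have hder : ∀ c : ℝ, ∀ x ∈ s, HasFDerivWithinAt (fun x => x + c • g x)
      (1 + c • fderiv ℝ g x) s x := fun c x hx =>
    ((hasFDerivAt_id x).add (hx.1.hasFDerivAt.const_smul c)).hasFDerivWithinAt
  have hsmall : ∀ c : ℝ, 0 ≤ c → c ≤ t₀ → IntegrableOn (fun x => (1 + c • fderiv ℝ g x).det) s μ ∧
      ∫ x in s, (1 + c • fderiv ℝ g x).det ∂μ = μ.real (ball 0 r) := by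
    intro c hc0 hc
    let F : E → E := fun x => x + c • g x
    have hFL : LipschitzWith (c.toNNReal * (L + 1)) fun x => F x - x := by
      refine LipschitzWith.of_dist_le_mul fun x y => ?_
      have := hg.dist_le_mul x y
      simp only [F, add_sub_cancel_left, NNReal.coe_mul, Real.coe_toNNReal c hc0]
      rw [dist_smul₀, Real.norm_of_nonneg hc0, mul_assoc]
      gcongr
    have hK : c.toNNReal * (L + 1) < 1 := by
      rw [← NNReal.coe_lt_coe, NNReal.coe_mul, Real.coe_toNNReal c hc0]
      exact lt_of_le_of_lt (mul_le_mul_of_nonneg_right hc hL.le) ht₁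
    have hbij : BijOn F (ball 0 r) (ball 0 r) := bijOn_ball_of_lipschitz hK hFL fun x hx => by
      simp [F, g, hid x hx]
    have hinj : InjOn F s := hbij.injOn.mono inter_subset_right
    have hpos : ∀ x, 0 < (1 + c • fderiv ℝ g x).det := by
      intro x
      refine hdet _ (lt_of_le_of_lt ?_ htη)
      rw [norm_smul, Real.norm_of_nonneg hc0]
      gcongr
      exact norm_fderiv_le_of_lipschitz ℝ hg
    have himage : F '' s =ᵐ[μ] ball 0 r := by
      have h1 : F '' s ⊆ ball 0 r := (image_mono inter_subset_right).trans hbij.image_eq.subset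
      refine h1.eventuallyLE.antisymm (ae_le_set.2 ?_)
      have hFl : LipschitzWith (c.toNNReal * (L + 1) + 1) F := by
        simpa using hFL.add LipschitzWith.id
      have h2 : μ (F '' (ball 0 r \ s)) ≤ _ := hFl.hausdorffMeasure_image_le (by positivity) _
      refine measure_mono_null ?_ (le_antisymm (h2.trans_eq ?_) zero_le)
      · rintro y ⟨hy, hys⟩
        obtain ⟨x, hx, rfl⟩ := hbij.surjOn hy
        exact ⟨x, ⟨hx, fun hxs => hys ⟨x, hxs, rfl⟩⟩, rfl⟩
      · change _ * μ _ = 0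
        rw [hnull, mul_zero]
    have h3 := integral_image_eq_integral_abs_det_fderiv_smul μ hsm (hder c) hinj fun _ => (1 : ℝ)
    have h4 := (integrableOn_image_iff_integrableOn_abs_det_fderiv_smul μ hsm (hder c) hinj
      fun _ => (1 : ℝ)).1 (by
        refine IntegrableOn.congr_set_ae ?_ himage
        exact integrableOn_const measure_ball_lt_top.ne)
    simp only [abs_of_pos (hpos _), smul_eq_mul, mul_one] at h3 h4
    refine ⟨h4, ?_⟩
    rw [← h3, setIntegral_congr_set himage]
    simp
  have h1 : ∫ x in s, (1 + fderiv ℝ g x).det ∂μ = μ.real (ball 0 r) := by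
    rw [integral_congr_ae (Filter.Eventually.of_forall fun x => hint (fderiv ℝ g x)),
      integral_finsetSum _ fun i hi => ?_]
    · calc _ = ∑ i ∈ Finset.range N, w i * μ.real (ball 0 r) := by
            refine Finset.sum_congr rfl fun i hi => ?_
            have := ht i (Finset.mem_range.1 hi)
            rw [integral_const_mul, (hsmall _ this.1 this.2).2]
        _ = _ := by rw [← Finset.sum_mul, hw, one_mul]
    · have := ht i (Finset.mem_range.1 hi)
      exact (hsmall _ this.1 this.2).1.const_mul _
  have h2 : ∀ x ∈ s, (1 + fderiv ℝ g x).det = 0 := by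
    intro x hx
    have hd : HasFDerivAt R (1 + fderiv ℝ g x) x := by
      have := (hasFDerivAt_id x).add hx.1.hasFDerivAt
      have h : (fun y => y + g y) = R := by funext y; simp [g]
      rw [← h]
      exact this
    have hRx := hs x (by simpa using hx.2)
    obtain ⟨l, hl, hlx⟩ := exists_dual_vector ℝ (R x) (by rw [hRx]; exact hr.ne')
    have hmax : IsLocalMax (fun y => l (R y)) x := by
      filter_upwards [isOpen_ball.mem_nhds hx.2] with y hy
      have h1 := l.le_opNorm (R y)
      rw [hl, one_mul, hs y (by simpa using hy)] at h1
      change l (R y) ≤ l (R x)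
      rw [hlx, hRx]
      exact (le_abs_self _).trans h1
    have h0 := hmax.hasFDerivAt_eq_zero (l.hasFDerivAt.comp x hd)
    by_contra hne
    have hunit : IsUnit (LinearMap.det ((1 + fderiv ℝ g x : E →L[ℝ] E) : E →ₗ[ℝ] E)) :=
      isUnit_iff_ne_zero.2 hne
    obtain ⟨y, hy⟩ := (LinearMap.equivOfDetNeZero _ hunit.ne_zero).surjective (R x)
    have h3 : l (R x) = 0 := by
      rw [← hy]
      exact DFunLike.congr_fun h0 y
    rw [hlx, hRx] at h3
    exact hr.ne' (by exact_mod_cast h3)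
  rw [setIntegral_congr_fun hsm h2] at h1
  simp only [integral_zero] at h1
  exact (ENNReal.toReal_pos (isOpen_ball.measure_pos μ ⟨0, mem_ball_self hr⟩).ne'
    measure_ball_lt_top.ne).ne h1

end Brouwer

section Brouwer

open MeasureTheory Set Metric
open scoped NNReal

variable {E : Type*} [NormedAddCommGroup E] [NormedSpace ℝ E]

/-- The radial projection onto the closed unit ball. -/
def unitBallProj (x : E) : E := (max 1 ‖x‖)⁻¹ • x

lemma norm_unitBallProj_le (x : E) : ‖unitBallProj x‖ ≤ 1 := by
  have h : 0 < max 1 ‖x‖ := by positivity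
  rw [unitBallProj, norm_smul, norm_inv, Real.norm_of_nonneg h.le, inv_mul_le_one₀ h]
  exact le_max_right _ _

lemma unitBallProj_of_norm_le {x : E} (hx : ‖x‖ ≤ 1) : unitBallProj x = x := by
  rw [unitBallProj, max_eq_left hx, inv_one, one_smul]

lemma lipschitzWith_unitBallProj : LipschitzWith 2 (unitBallProj : E → E) := by
  refine LipschitzWith.of_dist_le_mul fun x y => ?_
  rw [dist_eq_norm, dist_eq_norm]
  have hx : 0 < max 1 ‖x‖ := by positivity
  have hy : 0 < max 1 ‖y‖ := by positivity
  have h1 : unitBallProj x - unitBallProj y =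
      (max 1 ‖x‖)⁻¹ • (x - y) + ((max 1 ‖x‖)⁻¹ - (max 1 ‖y‖)⁻¹) • y := by
    simp only [unitBallProj, smul_sub, sub_smul]
    abel
  have h2 : |max 1 ‖y‖ - max 1 ‖x‖| ≤ ‖x - y‖ := by
    refine (abs_max_sub_max_le_max _ _ _ _).trans ?_
    rw [sub_self, abs_zero, max_eq_right (abs_nonneg _), norm_sub_rev]
    exact abs_norm_sub_norm_le _ _
  have h3 : |(max 1 ‖x‖)⁻¹ - (max 1 ‖y‖)⁻¹| * ‖y‖ ≤ ‖x - y‖ := by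
    rw [inv_sub_inv hx.ne' hy.ne', abs_div, abs_of_pos (mul_pos hx hy), div_mul_eq_mul_div,
      div_le_iff₀ (mul_pos hx hy)]
    have h4 : ‖y‖ ≤ max 1 ‖x‖ * max 1 ‖y‖ :=
      (le_max_right 1 ‖y‖).trans (le_mul_of_one_le_left hy.le (le_max_left _ _))
    exact mul_le_mul h2 h4 (norm_nonneg _) (norm_nonneg _)
  have h5 : (max 1 ‖x‖)⁻¹ ≤ 1 := inv_le_one_of_one_le₀ (le_max_left _ _)
  calc ‖unitBallProj x - unitBallProj y‖ ≤ (max 1 ‖x‖)⁻¹ * ‖x - y‖ +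
        |(max 1 ‖x‖)⁻¹ - (max 1 ‖y‖)⁻¹| * ‖y‖ := by
        rw [h1]
        refine (norm_add_le _ _).trans_eq ?_
        rw [norm_smul, norm_smul, norm_inv, Real.norm_of_nonneg hx.le, Real.norm_eq_abs]
    _ ≤ 1 * ‖x - y‖ + ‖x - y‖ := by gcongr
    _ = _ := by push_cast; ring

/-- The map that pushes the punctured ball of radius `r` radially onto its boundary sphere. -/
def radialPush (r : ℝ) (y : E) : E := max 1 (r / ‖y‖) • y

lemma norm_radialPush {r : ℝ} {y : E} (hy : y ≠ 0) : ‖radialPush r y‖ = max ‖y‖ r := by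
  have h : 0 < ‖y‖ := norm_pos_iff.2 hy
  rw [radialPush, norm_smul, Real.norm_of_nonneg (by positivity), max_mul_of_nonneg _ _ h.le,
    one_mul, div_mul_cancel₀ _ h.ne']

lemma radialPush_of_le {r : ℝ} {y : E} (hy : r ≤ ‖y‖) : radialPush r y = y := by
  rw [radialPush, max_eq_left (div_le_one_of_le₀ hy (norm_nonneg _)), one_smul]

lemma norm_radialPush_sub_le {r : ℝ} (hr : 0 ≤ r) (y : E) : ‖radialPush r y - y‖ ≤ r := by
  rcases eq_or_ne y 0 with rfl | hy
  · simpa [radialPush] using hr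
  have h : 0 < ‖y‖ := norm_pos_iff.2 hy
  have h1 : radialPush r y - y = (max 1 (r / ‖y‖) - 1) • y := by
    rw [radialPush, sub_smul, one_smul]
  rw [h1, norm_smul, Real.norm_of_nonneg (by simp), sub_mul, max_mul_of_nonneg _ _ h.le, one_mul,
    div_mul_cancel₀ _ h.ne', sub_le_iff_le_add]
  exact max_le (by linarith) (by linarith)

lemma continuousOn_radialPush (r : ℝ) : ContinuousOn (radialPush r : E → E) {0}ᶜ := by
  unfold radialPush
  refine ContinuousOn.smul (ContinuousOn.sup continuousOn_const (continuousOn_const.div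
    continuous_norm.continuousOn fun x hx => norm_ne_zero_iff.2 hx)) continuousOn_id

lemma norm_radialPush_sub_radialPush_le {r κ : ℝ} (hr : 0 ≤ r) (hκ : 0 < κ) {y z : E}
    (hy : κ ≤ ‖y‖) (hz : κ ≤ ‖z‖) :
    ‖radialPush r y - radialPush r z‖ ≤ (1 + 2 * (r / κ)) * ‖y - z‖ := by
  have hy0 : 0 < ‖y‖ := hκ.trans_le hy
  have hz0 : 0 < ‖z‖ := hκ.trans_le hz
  have h1 : radialPush r y - radialPush r z =
      max 1 (r / ‖y‖) • (y - z) + (max 1 (r / ‖y‖) - max 1 (r / ‖z‖)) • z := by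
    simp only [radialPush, smul_sub, sub_smul]
    abel
  have h2 : |max 1 (r / ‖y‖) - max 1 (r / ‖z‖)| ≤ |r / ‖y‖ - r / ‖z‖| := by
    refine (abs_max_sub_max_le_max _ _ _ _).trans ?_
    rw [sub_self, abs_zero, max_eq_right (abs_nonneg _)]
  have h3 : |r / ‖y‖ - r / ‖z‖| * ‖z‖ ≤ r / κ * ‖y - z‖ := by
    have h4 : |r / ‖y‖ - r / ‖z‖| * ‖z‖ = r / ‖y‖ * |‖z‖ - ‖y‖| := by
      have : r / ‖y‖ - r / ‖z‖ = r / (‖y‖ * ‖z‖) * (‖z‖ - ‖y‖) := by field_simp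
      rw [this, abs_mul, abs_of_nonneg (by positivity)]
      field_simp
    rw [h4]
    have h5 : |‖z‖ - ‖y‖| ≤ ‖y - z‖ := by
      rw [norm_sub_rev]; exact abs_norm_sub_norm_le _ _
    gcongr
  have h6 : max 1 (r / ‖y‖) ≤ 1 + r / κ := by
    have : r / ‖y‖ ≤ r / κ := by gcongr
    have h0 : 0 ≤ r / κ := by positivity
    exact max_le (by linarith) (by linarith)
  calc _ ≤ max 1 (r / ‖y‖) * ‖y - z‖ + |max 1 (r / ‖y‖) - max 1 (r / ‖z‖)| * ‖z‖ := by
        rw [h1]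
        refine (norm_add_le _ _).trans_eq ?_
        rw [norm_smul, norm_smul, Real.norm_of_nonneg (by positivity), Real.norm_eq_abs]
    _ ≤ (1 + r / κ) * ‖y - z‖ + r / κ * ‖y - z‖ := by
        exact add_le_add (mul_le_mul_of_nonneg_right h6 (norm_nonneg _))
          ((mul_le_mul_of_nonneg_right h2 hz0.le).trans h3)
    _ = _ := by ring

variable [FiniteDimensional ℝ E]

/-- Brouwer's fixed point theorem for Lipschitz maps of the unit ball. -/
theorem LipschitzWith.exists_fixedPoint_unitBall {f : E → E} {K : ℝ≥0} (hf : LipschitzWith K f)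
    (hmaps : ∀ x, ‖x‖ ≤ 1 → ‖f x‖ ≤ 1) : ∃ x, ‖x‖ ≤ 1 ∧ f x = x := by
  by_contra! hne
  let c : E → ℝ := fun x => max 0 (min 1 (2 - ‖x‖))
  have hc0 : ∀ x, 0 ≤ c x := fun x => le_max_left _ _
  have hc1 : ∀ x, c x ≤ 1 := fun x => max_le zero_le_one (min_le_left _ _)
  have hc : ∀ x y, |c x - c y| ≤ ‖x - y‖ := by
    intro x y
    refine (abs_max_sub_max_le_max _ _ _ _).trans ?_
    rw [sub_self, abs_zero, max_eq_right (abs_nonneg _)]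
    refine (abs_min_sub_min_le_max _ _ _ _).trans ?_
    rw [sub_self, abs_zero, max_eq_right (abs_nonneg _), sub_sub_sub_cancel_left, norm_sub_rev]
    exact abs_norm_sub_norm_le _ _
  let F : E → E := fun x => x - c x • f (unitBallProj x)
  have hfp : ∀ x, ‖f (unitBallProj x)‖ ≤ 1 := fun x => hmaps _ (norm_unitBallProj_le x)
  have hFL : ∀ x y, ‖F x - F y‖ ≤ (2 + 2 * K) * ‖x - y‖ := by
    intro x y
    have h1 : F x - F y = (x - y) - ((c x - c y) • f (unitBallProj x) +
        c y • (f (unitBallProj x) - f (unitBallProj y))) := by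
      simp only [F, sub_smul, smul_sub]
      abel
    have h2 : ‖f (unitBallProj x) - f (unitBallProj y)‖ ≤ K * (2 * ‖x - y‖) := by
      simpa [dist_eq_norm, mul_assoc] using (hf.comp lipschitzWith_unitBallProj).dist_le_mul x y
    rw [h1]
    calc _ ≤ ‖x - y‖ + (|c x - c y| * ‖f (unitBallProj x)‖ +
          c y * ‖f (unitBallProj x) - f (unitBallProj y)‖) := by
          refine (_root_.norm_sub_le _ _).trans (add_le_add le_rfl ((norm_add_le _ _).trans_eq ?_))
          rw [norm_smul, norm_smul, Real.norm_eq_abs, Real.norm_of_nonneg (hc0 y)]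
      _ ≤ ‖x - y‖ + (‖x - y‖ * 1 + 1 * (K * (2 * ‖x - y‖))) := by
          gcongr
          exacts [hc x y, hfp x, hc1 y]
      _ = _ := by ring
  have hFcont : Continuous F :=
    (LipschitzWith.of_dist_le_mul (K := 2 + 2 * K) fun x y => by
      simpa [dist_eq_norm] using hFL x y).continuous
  have hFid : ∀ x, 2 ≤ ‖x‖ → F x = x := by
    intro x hx
    have : c x = 0 := max_eq_left ((min_le_right _ _).trans (by linarith))
    simp [F, this]
  have hFne : ∀ x, F x ≠ 0 := by
    intro x hx
    have h1 : x = c x • f (unitBallProj x) := sub_eq_zero.1 hx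
    rcases le_or_gt ‖x‖ 1 with h | h
    · have : c x = 1 := by
        simp only [c]
        rw [min_eq_left (by linarith), max_eq_right zero_le_one]
      rw [this, one_smul, unitBallProj_of_norm_le h] at h1
      exact hne x h h1.symm
    · have h2 : c x < 1 := max_lt zero_lt_one ((min_le_right _ _).trans_lt (by linarith))
      have h3 : ‖x‖ ≤ c x * 1 := by
        conv_lhs => rw [h1]
        rw [norm_smul, Real.norm_of_nonneg (hc0 x)]
        exact mul_le_mul_of_nonneg_left (hfp x) (hc0 x)
      linarith
  have hFle : ∀ x, ‖x‖ < 2 → ‖F x‖ ≤ 2 := by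
    intro x hx
    have h1 : ‖F x‖ ≤ ‖x‖ + c x * 1 := by
      refine (_root_.norm_sub_le _ _).trans (add_le_add le_rfl ?_)
      rw [norm_smul, Real.norm_of_nonneg (hc0 x)]
      exact mul_le_mul_of_nonneg_left (hfp x) (hc0 x)
    have h2 : c x ≤ 2 - ‖x‖ := max_le (by linarith) (min_le_right _ _)
    linarith
  obtain ⟨κ, hκ, hFκ⟩ : ∃ κ > 0, ∀ x, κ ≤ ‖F x‖ := by
    obtain ⟨x₀, -, hx₀⟩ := (isCompact_closedBall (0 : E) 2).exists_isMinOn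
      ⟨0, mem_closedBall_self zero_le_two⟩ hFcont.norm.continuousOn
    refine ⟨min ‖F x₀‖ 2, lt_min (norm_pos_iff.2 (hFne x₀)) two_pos, fun x => ?_⟩
    rcases le_total ‖x‖ 2 with h | h
    · exact (min_le_left _ _).trans (hx₀ (by simpa using h))
    · rw [hFid x h]
      exact (min_le_right _ _).trans h
  have hR : LipschitzWith ((1 + 2 * (2 / κ.toNNReal)) * (2 + 2 * K))
      fun x => radialPush 2 (F x) := by
    refine LipschitzWith.of_dist_le_mul fun x y => ?_
    rw [dist_eq_norm, dist_eq_norm]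
    refine (norm_radialPush_sub_radialPush_le zero_le_two hκ (hFκ x) (hFκ y)).trans ?_
    push_cast
    rw [Real.coe_toNNReal _ hκ.le, mul_assoc]
    exact mul_le_mul_of_nonneg_left (hFL x y) (by positivity)
  refine hR.not_retraction two_pos (fun x hx => ?_) fun x hx => ?_
  · rw [hFid x hx, radialPush_of_le hx]
  · rw [norm_radialPush (hFne x), max_eq_right (hFle x hx)]

/-- Brouwer's fixed point theorem for the unit ball of a finite-dimensional normed space. -/
theorem exists_fixedPoint_unitBall {f : E → E} (hf : ContinuousOn f (closedBall 0 1))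
    (hmaps : MapsTo f (closedBall 0 1) (closedBall 0 1)) : ∃ x ∈ closedBall (0 : E) 1, f x = x := by
  by_contra! hne
  have hmaps' : ∀ x, ‖x‖ ≤ 1 → ‖f x‖ ≤ 1 := fun x hx => by
    simpa using hmaps (show x ∈ closedBall 0 1 by simpa using hx)
  have hmem : ∀ x : E, unitBallProj x ∈ closedBall (0 : E) 1 := fun x => by
    simpa using norm_unitBallProj_le x
  obtain ⟨x₀, hx₀, hmin⟩ := (isCompact_closedBall (0 : E) 1).exists_isMinOn
    ⟨0, mem_closedBall_self zero_le_one⟩ (hf.sub continuousOn_id).norm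
  have hκ : 0 < ‖f x₀ - x₀‖ := norm_pos_iff.2 (sub_ne_zero.2 (hne x₀ hx₀))
  set κ := ‖f x₀ - x₀‖
  have hu : UniformContinuous fun x => f (unitBallProj x) := by
    have h1 := (isCompact_closedBall (0 : E) 1).uniformContinuousOn_of_continuous hf
    rw [← uniformContinuousOn_univ]
    exact h1.comp lipschitzWith_unitBallProj.uniformContinuous.uniformContinuousOn
      fun x _ => hmem x
  obtain ⟨g, hg, hgf⟩ := hu.exists_contDiff_dist_le (show 0 < κ / 4 by positivity)
  obtain ⟨K, hK⟩ := ((hg.of_le (by simp : (1 : WithTop ℕ∞) ≤ _)).locallyLipschitz.locallyLipschitzOn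
    (s := closedBall (0 : E) 1)).exists_lipschitzOnWith_of_compact (isCompact_closedBall _ _)
  have hG : LipschitzWith (K * 2) fun x => g (unitBallProj x) := by
    rw [← lipschitzOnWith_univ] at *
    exact hK.comp (lipschitzWith_unitBallProj.lipschitzOnWith) fun x _ => hmem x
  have hsc : LipschitzWith (‖(1 + κ / 4)⁻¹‖₊ * (K * 2))
      fun x => (1 + κ / 4)⁻¹ • g (unitBallProj x) :=
    (lipschitzWith_smul _).comp hG
  obtain ⟨x, hx, hxx⟩ := hsc.exists_fixedPoint_unitBall fun x hx => by
    have h1 := (hgf x).le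
    rw [unitBallProj_of_norm_le hx, dist_eq_norm] at h1
    have h2 : ‖g x‖ ≤ 1 + κ / 4 := by
      have := norm_le_norm_add_norm_sub (f x) (g x)
      rw [norm_sub_rev] at this
      linarith [hmaps' x hx]
    rw [unitBallProj_of_norm_le hx, norm_smul, norm_inv, Real.norm_of_nonneg (by positivity),
      inv_mul_le_one₀ (by positivity)]
    exact h2
  rw [unitBallProj_of_norm_le hx, inv_smul_eq_iff₀ (by positivity)] at hxx
  have h1 := hgf x
  rw [unitBallProj_of_norm_le hx, dist_eq_norm, hxx] at h1
  have h2 : κ ≤ ‖f x - x‖ := hmin (by simpa using hx)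
  have h3 : f x - x = (κ / 4) • x - ((1 + κ / 4) • x - f x) := by
    rw [add_smul, one_smul]; abel
  have h4 : ‖f x - x‖ ≤ κ / 4 * ‖x‖ + ‖(1 + κ / 4) • x - f x‖ := by
    have h5 : ‖(κ / 4) • x‖ = κ / 4 * ‖x‖ := by
      rw [norm_smul, Real.norm_of_nonneg (by positivity)]
    rw [h3, ← h5]
    exact _root_.norm_sub_le _ _
  nlinarith

/-- A continuous map of a ball that is close to the identity has a zero. -/
theorem exists_eq_of_norm_sub_le {F : E → E} {x₀ : E} {ρ : ℝ} (hρ : 0 < ρ)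
    (hF : ContinuousOn F (closedBall x₀ ρ)) (hle : ∀ x ∈ closedBall x₀ ρ, ‖F x - x‖ ≤ ρ) :
    ∃ x ∈ closedBall x₀ ρ, F x = x₀ := by
  have hmem : ∀ y ∈ closedBall (0 : E) 1, x₀ + ρ • y ∈ closedBall x₀ ρ := fun y hy => by
    have h1 : ‖y‖ ≤ 1 := by simpa using hy
    simpa [norm_smul, abs_of_pos hρ] using mul_le_of_le_one_right hρ.le h1
  obtain ⟨y, hy, hyy⟩ := exists_fixedPoint_unitBall
    (f := fun y => ρ⁻¹ • ((x₀ + ρ • y) - F (x₀ + ρ • y)))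
    (ContinuousOn.const_smul (ContinuousOn.sub (by fun_prop)
      (hF.comp (by fun_prop) hmem)) _)
    (fun y hy => by
      have h1 := hle _ (hmem y hy)
      rw [mem_closedBall_zero_iff, norm_smul, norm_inv, Real.norm_of_nonneg hρ.le,
        inv_mul_le_one₀ hρ, norm_sub_rev]
      exact h1)
  refine ⟨_, hmem y hy, ?_⟩
  have h1 : (x₀ + ρ • y) - F (x₀ + ρ • y) = ρ • y := (inv_smul_eq_iff₀ hρ.ne').1 hyy
  rw [sub_eq_iff_eq_add, add_comm (ρ • y)] at h1
  exact (add_right_cancel h1).symm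

end Brouwer

section InvarianceOfDomain

open MeasureTheory Set Metric
open scoped NNReal

variable {E : Type*} [NormedAddCommGroup E] [NormedSpace ℝ E] [FiniteDimensional ℝ E]

/-- A Lipschitz image of a sphere has dense complement. -/
lemma LipschitzWith.exists_notMem_image_sphere {G : E → E} {C : ℝ≥0} (hG : LipschitzWith C G)
    (q x₀ : E) {ε m : ℝ} (hε : ε ≠ 0) (hm : 0 < m) :
    ∃ v : E, ‖v‖ < m ∧ x₀ + v ∉ G '' sphere q ε := by
  borelize E
  let μ : Measure E := μH[Module.finrank ℝ E]
  have h1 : μ (G '' sphere q ε) ≤ _ := hG.hausdorffMeasure_image_le (by positivity) _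
  have h2 : μ (sphere q ε) = 0 := Measure.addHaar_sphere_of_ne_zero μ q hε
  have h3 : μ (G '' sphere q ε) = 0 := by
    refine le_antisymm (h1.trans_eq ?_) zero_le
    change _ * μ _ = 0
    rw [h2, mul_zero]
  have h4 : ¬ ball x₀ m ⊆ G '' sphere q ε := fun h =>
    (isOpen_ball.measure_pos μ ⟨x₀, mem_ball_self hm⟩).ne' (measure_mono_null h h3)
  obtain ⟨y, hy, hyG⟩ := not_subset.1 h4
  exact ⟨y - x₀, by simpa [dist_eq_norm] using hy, by simpa using hyG⟩

/-- A continuous map with Lipschitz inverse still covers the image of the centre of a ball after a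
small continuous perturbation. -/
theorem exists_eq_add_of_antilipschitz {ω : E → E} {x₀ : E} {ρ : ℝ} (hρ : 0 < ρ) {L : ℝ≥0}
    (hω : ContinuousOn ω (closedBall x₀ ρ))
    (hL : ∀ x ∈ closedBall x₀ ρ, ∀ y ∈ closedBall x₀ ρ, ‖x - y‖ ≤ L * ‖ω x - ω y‖) :
    ∃ r > 0, ∀ p : E → E, ContinuousOn p (closedBall x₀ ρ) →
      (∀ x ∈ closedBall x₀ ρ, ‖p x‖ ≤ r) → ∃ x ∈ closedBall x₀ ρ, ω x = ω x₀ + p x := by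
  have hx₀ : x₀ ∈ closedBall x₀ ρ := mem_closedBall_self hρ.le
  have hinj : InjOn ω (closedBall x₀ ρ) := fun x hx y hy hxy => by
    have := hL x hx y hy
    rw [hxy, sub_self, norm_zero, mul_zero] at this
    exact sub_eq_zero.1 (norm_le_zero_iff.1 this)
  have hinv : LipschitzOnWith L (Function.invFunOn ω (closedBall x₀ ρ)) (ω '' closedBall x₀ ρ) := by
    refine LipschitzOnWith.of_dist_le_mul ?_
    rintro _ ⟨x, hx, rfl⟩ _ ⟨y, hy, rfl⟩
    rw [hinj.leftInvOn_invFunOn hx, hinj.leftInvOn_invFunOn hy, dist_eq_norm, dist_eq_norm]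
    exact hL x hx y hy
  obtain ⟨G, hG, hGinv⟩ := hinv.extend_finite_dimension
  set C := lipschitzExtensionConstant E * L
  have hGω : ∀ x ∈ closedBall x₀ ρ, G (ω x) = x := fun x hx => by
    rw [← hGinv ⟨x, hx, rfl⟩, hinj.leftInvOn_invFunOn hx]
  have hC : (0 : ℝ) ≤ C := C.2
  obtain ⟨ε, hε, hCε⟩ : ∃ ε : ℝ, 0 < ε ∧ C * ε ≤ ρ / 4 := by
    refine ⟨ρ / 4 / (C + 1), by positivity, ?_⟩
    rw [mul_div_assoc', div_le_iff₀ (by positivity)]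
    nlinarith
  obtain ⟨η, hη, hηω⟩ := Metric.continuousWithinAt_iff.1 (hω x₀ hx₀) (ε / 2) (by positivity)
  let m := min ρ η / 4
  have hm : 0 < m := by positivity
  obtain ⟨r, hr, hrε, hCr⟩ : ∃ r : ℝ, 0 < r ∧ r ≤ ε / 2 ∧ C * r ≤ m := by
    refine ⟨min (ε / 2) (m / (C + 1)), by positivity, min_le_left _ _, ?_⟩
    refine (mul_le_mul_of_nonneg_left (min_le_right _ _) hC).trans ?_
    rw [mul_div_assoc', div_le_iff₀ (by positivity)]
    nlinarith
  have hmρ : m ≤ ρ / 4 := by have := min_le_left ρ η; simp only [m]; linarith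
  have hmη : m ≤ η / 4 := by have := min_le_right ρ η; simp only [m]; linarith
  refine ⟨r, hr, fun p hp hpr => ?_⟩
  by_contra! hne
  set q := ω x₀
  let W : E → E := fun x => ω x - p x - q
  have hW : ∀ x ∈ closedBall x₀ ρ, W x ≠ 0 := fun x hx h0 => hne x hx (by
    rw [← sub_eq_zero, ← h0]
    simp only [W]
    abel)
  obtain ⟨v, hv, hvG⟩ := hG.exists_notMem_image_sphere q x₀ hε.ne' hm
  obtain ⟨x, hx, hHx⟩ := exists_eq_of_norm_sub_le (F := fun x => G (q + radialPush ε (W x)) - v) hρ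
    ((hG.continuous.comp_continuousOn (continuousOn_const.add
      ((continuousOn_radialPush ε).comp ((hω.sub hp).sub continuousOn_const) hW))).sub
        continuousOn_const) (fun x hx => by
      have h1 : ‖G (q + radialPush ε (W x)) - G (ω x)‖ ≤ C * (ε + r) := by
        refine (hG.norm_sub_le _ _).trans (mul_le_mul_of_nonneg_left ?_ hC)
        have h2 : q + radialPush ε (W x) - ω x = (radialPush ε (W x) - W x) - p x := by
          simp only [W]
          abel
        rw [h2]
        exact (norm_sub_le _ _).trans (add_le_add (norm_radialPush_sub_le hε.le _) (hpr x hx))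
      have h3 : G (q + radialPush ε (W x)) - v - x =
          (G (q + radialPush ε (W x)) - G (ω x)) - v := by
        rw [hGω x hx]; abel
      rw [h3]
      refine (norm_sub_le _ _).trans ?_
      nlinarith)
  have hGx : G (q + radialPush ε (W x)) = x₀ + v := sub_eq_iff_eq_add.1 hHx
  rcases le_or_gt ε ‖W x‖ with h | h
  · rw [radialPush_of_le h] at hGx
    have h1 : ‖G (q + W x) - G (ω x)‖ ≤ C * r := by
      refine (hG.norm_sub_le _ _).trans (mul_le_mul_of_nonneg_left ?_ hC)
      have h2 : q + W x - ω x = -p x := by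
        simp only [W]
        abel
      rw [h2, norm_neg]
      exact hpr x hx
    rw [hGx, hGω x hx] at h1
    have h3 : dist x x₀ < η := by
      have h4 : x - x₀ = v - (x₀ + v - x) := by abel
      rw [dist_eq_norm, h4]
      refine (norm_sub_le _ _).trans_lt ?_
      linarith
    have h5 := hηω hx h3
    have h6 : ‖W x‖ ≤ ‖ω x - q‖ + ‖p x‖ := by
      have : W x = (ω x - q) - p x := by simp only [W]; abel
      rw [this]
      exact norm_sub_le _ _
    rw [dist_eq_norm] at h5
    linarith [hpr x hx]
  · refine hvG ⟨_, ?_, hGx⟩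
    simp [norm_radialPush (hW x hx), h.le]

end InvarianceOfDomain

section Parameters

open Filter

variable {n : ℕ}

lemma norm_le_sum_abs (x : Fin n → ℝ) : ‖x‖ ≤ ∑ i, |x i| :=
  (pi_norm_le_iff_of_nonneg (Finset.sum_nonneg fun _ _ => abs_nonneg _)).2 fun i =>
    Finset.single_le_sum (f := fun i => |x i|) (fun _ _ => abs_nonneg _) (Finset.mem_univ i)

lemma sum_abs_le_card_mul_norm (x : Fin n → ℝ) : ∑ i, |x i| ≤ n * ‖x‖ := by
  simpa using Finset.sum_le_card_nsmul Finset.univ (fun i => |x i|) ‖x‖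
    fun i _ => norm_le_pi_norm x i

/-- A map with a modulus of continuity (for the `ℓ¹`-distance) is continuous. -/
lemma continuousOn_of_modulus {ϖ : ℝ → ℝ} (hϖ : Tendsto ϖ (nhdsWithin 0 (Set.Ioi 0)) (nhds 0))
    {s : Set (Fin n → ℝ)} {F : (Fin n → ℝ) → ℂ} {M : ℝ}
    (hF : ∀ x ∈ s, ∀ y ∈ s, 0 < ∑ i, |x i - y i| → ∑ i, |x i - y i| ≤ 1 →
      ‖F x - F y‖ ≤ M * ϖ (∑ i, |x i - y i|)) : ContinuousOn F s := by
  intro y hy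
  rw [Metric.continuousWithinAt_iff]
  intro e he
  have h1 : ∀ᶠ t in nhdsWithin (0 : ℝ) (Set.Ioi 0), M * ϖ t < e := by
    have := (hϖ.const_mul M)
    rw [mul_zero] at this
    exact this.eventually_lt_const he
  obtain ⟨d, hd, hdF⟩ := Metric.eventually_nhds_iff.1 (eventually_nhdsWithin_iff.1 h1)
  refine ⟨min d 1 / (n + 1), by positivity, fun {x} hx hxy => ?_⟩
  rcases eq_or_ne x y with rfl | hne
  · simpa using he
  have hpos : 0 < ∑ i, |x i - y i| :=
    (norm_pos_iff.2 (sub_ne_zero.2 hne)).trans_le (norm_le_sum_abs (x - y))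
  have hlt : ∑ i, |x i - y i| < min d 1 := by
    rw [dist_eq_norm, lt_div_iff₀ (by positivity)] at hxy
    have h2 : ∑ i, |x i - y i| ≤ n * ‖x - y‖ := sum_abs_le_card_mul_norm (x - y)
    nlinarith [norm_nonneg (x - y)]
  rw [dist_eq_norm]
  refine (hF x hx y hy hpos (hlt.le.trans (min_le_right _ _))).trans_lt (hdF ?_ hpos)
  rw [Real.dist_eq, sub_zero, abs_of_pos hpos]
  exact hlt.trans_le (min_le_left _ _)

/-- A lower bound on increments by a modulus of continuity makes the inverse Lipschitz near the
centre. -/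
lemma exists_antilipschitz_closedBall (hn : 1 ≤ n) {ω : (Fin n → ℝ) → Fin n → ℝ}
    {ξ₀ : Fin n → ℝ} {δ : ℝ} (hδ : 0 < δ) {ϖ : ℝ → ℝ} (hϖ : IsModulusOfContinuity ϖ)
    (hω : ∀ x y : Fin n → ℝ, (∑ i, |x i - ξ₀ i|) ≤ δ → (∑ i, |y i - ξ₀ i|) ≤ δ →
      0 < (∑ i, |x i - y i|) → (∑ i, |x i - y i|) ≤ 1 →
      ϖ (∑ i, |x i - y i|) ≤ ∑ i, |ω x i - ω y i|) :
    ∃ ρ > 0, (∀ x ∈ Metric.closedBall ξ₀ ρ, ∑ i, |x i - ξ₀ i| ≤ δ) ∧ ∃ L : NNReal,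
      ∀ x ∈ Metric.closedBall ξ₀ ρ, ∀ y ∈ Metric.closedBall ξ₀ ρ,
        ‖x - y‖ ≤ L * ‖ω x - ω y‖ := by
  obtain ⟨C, hC, hev⟩ := hϖ.2.2.2.2
  obtain ⟨d, hd, hdC⟩ := Metric.eventually_nhds_iff.1 (eventually_nhdsWithin_iff.1 hev)
  have hn' : (0 : ℝ) < n := by exact_mod_cast hn
  let ρ := min δ (min d 1 / 4) / n
  have hρ : 0 < ρ := by positivity
  have hsum : ∀ x ∈ Metric.closedBall ξ₀ ρ, ∑ i, |x i - ξ₀ i| ≤ min δ (min d 1 / 4) := by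
    intro x hx
    rw [Metric.mem_closedBall, dist_eq_norm, le_div_iff₀ hn', mul_comm] at hx
    exact (sum_abs_le_card_mul_norm (x - ξ₀)).trans hx
  refine ⟨ρ, hρ, fun x hx => (hsum x hx).trans (min_le_left _ _), (C * n).toNNReal,
    fun x hx y hy => ?_⟩
  rw [Real.coe_toNNReal _ (by positivity)]
  rcases eq_or_ne x y with rfl | hne
  · simp
  have hpos : 0 < ∑ i, |x i - y i| :=
    (norm_pos_iff.2 (sub_ne_zero.2 hne)).trans_le (norm_le_sum_abs (x - y))
  have hm : 0 < min d 1 := by positivity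
  have hlt : ∑ i, |x i - y i| < min d 1 := by
    have h1 : ∑ i, |x i - y i| ≤ ∑ i, |x i - ξ₀ i| + ∑ i, |y i - ξ₀ i| := by
      rw [← Finset.sum_add_distrib]
      refine Finset.sum_le_sum fun i _ => ?_
      rw [abs_sub_comm (y i)]
      exact abs_sub_le _ _ _
    have h2 := (hsum x hx).trans (min_le_right _ _)
    have h3 := (hsum y hy).trans (min_le_right _ _)
    linarith
  have h4 := hdC (by
    rw [Real.dist_eq, sub_zero, abs_of_pos hpos]
    exact hlt.trans_le (min_le_left _ _)) hpos
  have h5 := hω x y ((hsum x hx).trans (min_le_left _ _)) ((hsum y hy).trans (min_le_left _ _)) hpos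
    (hlt.le.trans (min_le_right _ _))
  calc ‖x - y‖ ≤ ∑ i, |x i - y i| := norm_le_sum_abs (x - y)
    _ ≤ C * ϖ (∑ i, |x i - y i|) := h4
    _ ≤ C * ∑ i, |ω x i - ω y i| := by gcongr
    _ ≤ C * (n * ‖ω x - ω y‖) := by
      gcongr
      exact sum_abs_le_card_mul_norm (ω x - ω y)
    _ = _ := by ring

end Parameters

/-- Theorem 3.4 (degree condition realized by injectivity): frequency-preserving KAM for
the perturbed rotation `θ ↦ θ + ω(ξ) + ε f(θ,ξ,ε)` on `T^n = ℝⁿ/2πℤⁿ`, with `f` analytic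
in `θ` on the strip `D(h)` and merely `ϖ₁`-continuous in the parameter `ξ`. Maps of the
torus are formulated through `2π`-periodic (resp. degree-one) lifts, and equality on the
torus through `ProjEq`; all norms are ℓ¹. -/
theorem frequency_preserving_kam_parameter
    (n : ℕ) (hn : 1 ≤ n)
    (Λ : Set (Fin n → ℝ)) (hΛconn : IsConnected Λ) (hΛcomp : IsCompact Λ)
    (ω : (Fin n → ℝ) → (Fin n → ℝ)) (hωc : ContinuousOn ω Λ) (hωinj : Set.InjOn ω Λ)
    (ξstar : Fin n → ℝ) (hξstar : ξstar ∈ interior Λ)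
    (q : Fin n → ℝ) (hq : q = ω ξstar)
    (γ τ : ℝ) (hγ : 0 < γ) (hτ : (n : ℝ) - 1 < τ)
    (hdio : ∀ k : Fin n → ℤ, k ≠ 0 → ∀ k₀ : ℤ,
      γ * (∑ i, |(k i : ℝ)|) ^ (-τ)
        ≤ |(∑ i, (k i : ℝ) * q i) - 2 * π * (k₀ : ℝ)|)
    (δ : ℝ) (hδ : 0 < δ)
    (hball : {ξ : Fin n → ℝ | (∑ i, |ξ i - ξstar i|) ≤ δ} ⊆ interior Λ)
    (ϖ₂ : ℝ → ℝ) (hϖ₂ : IsModulusOfContinuity ϖ₂)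
    (hconv : ∀ ξ' ξ'' : Fin n → ℝ,
      (∑ i, |ξ' i - ξstar i|) ≤ δ → (∑ i, |ξ'' i - ξstar i|) ≤ δ →
      0 < (∑ i, |ξ' i - ξ'' i|) → (∑ i, |ξ' i - ξ'' i|) ≤ 1 →
      ϖ₂ (∑ i, |ξ' i - ξ'' i|) ≤ ∑ i, |ω ξ' i - ω ξ'' i|)
    (ϖ₁ : ℝ → ℝ) (hϖ₁ : IsModulusOfContinuity ϖ₁)
    (h12 : ∃ C > 0, ∀ᶠ x in nhdsWithin 0 (Set.Ioi 0), ϖ₁ x ≤ C * ϖ₂ x)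
    (h M : ℝ) (hh : 0 < h) (hM : 0 < M)
    (f : (Fin n → ℂ) → (Fin n → ℝ) → ℝ → (Fin n → ℂ))
    (hfreg : ∀ ε ∈ Set.Ioc (0 : ℝ) 1, ∀ ξ ∈ Λ,
      ContinuousOn (fun θ => f θ ξ ε) {θ : Fin n → ℂ | (∑ i, |(θ i).im|) ≤ h} ∧
      DifferentiableOn ℂ (fun θ => f θ ξ ε)
        (interior {θ : Fin n → ℂ | (∑ i, |(θ i).im|) ≤ h}))
    (hfper : ∀ ε ∈ Set.Ioc (0 : ℝ) 1, ∀ ξ ∈ Λ,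
      ∀ θ : Fin n → ℂ, (∑ i, |(θ i).im|) ≤ h → ∀ j : Fin n,
        f (θ + Pi.single j (2 * π : ℂ)) ξ ε = f θ ξ ε)
    (hfreal : ∀ ε ∈ Set.Ioc (0 : ℝ) 1, ∀ ξ ∈ Λ, ∀ θ : Fin n → ℝ, ∀ i : Fin n,
      (f (fun i' => (θ i' : ℂ)) ξ ε i).im = 0)
    (hfbound : ∀ ε ∈ Set.Ioc (0 : ℝ) 1, ∀ ξ ∈ Λ,
      ∀ θ : Fin n → ℂ, (∑ i, |(θ i).im|) ≤ h → (∑ i, ‖f θ ξ ε i‖) ≤ M)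
    (hfmod : ∀ ε ∈ Set.Ioc (0 : ℝ) 1, ∀ ξ' ∈ Λ, ∀ ξ'' ∈ Λ,
      0 < (∑ i, |ξ' i - ξ'' i|) → (∑ i, |ξ' i - ξ'' i|) ≤ 1 →
      ∀ θ : Fin n → ℂ, (∑ i, |(θ i).im|) ≤ h →
        (∑ i, ‖f θ ξ' ε i - f θ ξ'' ε i‖) ≤ M * ϖ₁ (∑ i, |ξ' i - ξ'' i|)) :
    ∃ ε₀ ∈ Set.Ioc (0 : ℝ) 1,
      ∃ ξinf : ℝ → (Fin n → ℝ), ∃ u : ℝ → (Fin n → ℝ) → (Fin n → ℝ),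
        (∀ ε ∈ Set.Ioo (0 : ℝ) ε₀,
          ξinf ε ∈ Λ ∧
          Continuous (u ε) ∧
          (∀ θ : Fin n → ℝ, ∀ j : Fin n,
            u ε (θ + Pi.single j (2 * π)) = u ε θ + Pi.single j (2 * π)) ∧
          (∀ θ : Fin n → ℝ,
            ProjEq
              (fun i => u ε θ i + ω (ξinf ε) i +
                ε * (f (fun i' => ((u ε θ i' : ℝ) : ℂ)) (ξinf ε) ε i).re)
              (u ε (θ + q)))) ∧
        (∀ η > 0, ∃ ε₁ > 0, ∀ ε ∈ Set.Ioo (0 : ℝ) ε₀, ε < ε₁ →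
          ∀ θ : Fin n → ℝ, (∑ i, |u ε θ i - θ i|) ≤ η) := by
  obtain ⟨ρ, hρ, hρδ, L, hL⟩ := exists_antilipschitz_closedBall hn hδ hϖ₂ hconv
  have hρΛ : Metric.closedBall ξstar ρ ⊆ Λ := fun x hx => interior_subset (hball (hρδ x hx))
  obtain ⟨r, hr, hsolve⟩ := exists_eq_add_of_antilipschitz hρ (hωc.mono hρΛ) hL
  obtain ⟨K, hK, hFB⟩ := exists_fourierBound_of_holomorphic hn hh
  have hn' : (0 : ℝ) < n := by exact_mod_cast hn
  obtain ⟨t₀, ht₀, C, hC, hconj⟩ := exists_conjugacy_with_counterterm hn (q := q) (τ := τ)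
    (r := h / (2 * n)) hγ hdio (by positivity)
  have hcompact : CompactSpace (Metric.closedBall ξstar ρ) :=
    isCompact_iff_compactSpace.1 (isCompact_closedBall _ _)
  let ε₀ := min 1 (min (t₀ / (K * M)) (r / (C * (K * M))))
  have hε₀ : 0 < ε₀ := by positivity
  have key : ∀ ε ∈ Set.Ioo 0 ε₀, ∃ (ξ : Fin n → ℝ) (u : (Fin n → ℝ) → (Fin n → ℝ)),
      (ξ ∈ Λ ∧ Continuous u ∧
        (∀ (θ : Fin n → ℝ) (j : Fin n), u (θ + Pi.single j (2 * π)) = u θ + Pi.single j (2 * π)) ∧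
        ∀ θ : Fin n → ℝ, ProjEq (fun i => u θ i + ω ξ i +
          ε * (f (fun i' => ((u θ i' : ℝ) : ℂ)) ξ ε i).re) (u (θ + q))) ∧
      ∀ θ : Fin n → ℝ, ∑ i, |u θ i - θ i| ≤ n * (C * (K * (ε * M))) := by
    classical
    intro ε hε
    have hε1 : ε ∈ Set.Ioc (0 : ℝ) 1 := ⟨hε.1, hε.2.le.trans (min_le_left _ _)⟩
    have hεt : K * (ε * M) ≤ t₀ := by
      have : ε ≤ t₀ / (K * M) := hε.2.le.trans ((min_le_right _ _).trans (min_le_left _ _))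
      rw [le_div_iff₀ (by positivity)] at this
      linarith
    have hεr : C * (K * (ε * M)) ≤ r := by
      have : ε ≤ r / (C * (K * M)) := hε.2.le.trans ((min_le_right _ _).trans (min_le_right _ _))
      rw [le_div_iff₀ (by positivity)] at this
      linarith
    have hfb : ∀ j : Fin n, FourierBound (h / (2 * n)) (K * (ε * M))
        fun (x : Metric.closedBall ξstar ρ) (θ : Fin n → ℝ) =>
          ((ε : ℂ) * f (fun i => (θ i : ℂ)) x ε j).re := by
      intro j
      refine hFB (X := Metric.closedBall ξstar ρ) (fun x θ => (ε : ℂ) * f θ x ε j) (ε * M)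
        (mul_nonneg hε.1.le hM.le)
        (fun x => ?_) (fun x => ?_) (fun x θ hθ l => ?_) (fun x θ hθ => ?_) fun θ => ?_
      · exact continuousOn_const.mul
          ((continuous_apply j).comp_continuousOn (hfreg ε hε1 x (hρΛ x.2)).1)
      · exact (differentiableOn_const _).mul
          (differentiableOn_pi.1 (hfreg ε hε1 x (hρΛ x.2)).2 j)
      · simp only [hfper ε hε1 x (hρΛ x.2) θ hθ l]
      · rw [norm_mul, Complex.norm_of_nonneg hε.1.le]
        refine mul_le_mul_of_nonneg_left ?_ hε.1.le
        exact (Finset.single_le_sum (f := fun i => ‖f θ x ε i‖) (fun _ _ => norm_nonneg _)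
          (Finset.mem_univ j)).trans (hfbound ε hε1 x (hρΛ x.2) θ hθ)
      · have hcont : ContinuousOn (fun x => f (fun i => (θ i : ℂ)) x ε j)
            (Metric.closedBall ξstar ρ) := continuousOn_of_modulus (M := M) hϖ₁.2.2.2.1
          fun x hx y hy h0 h1 => ?_
        · exact continuous_const.mul (continuousOn_iff_continuous_domRestrict.1 hcont)
        exact (Finset.single_le_sum
          (f := fun i => ‖f (fun i => (θ i : ℂ)) x ε i - f (fun i => (θ i : ℂ)) y ε i‖)
          (fun _ _ => norm_nonneg _) (Finset.mem_univ j)).trans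
            (hfmod ε hε1 x (hρΛ hx) y (hρΛ hy) h0 h1 _ (by simpa using hh.le))
    obtain ⟨lam, v, hlam, hv, hvc, hvp, hdef⟩ := hconj _ _ _
      (mul_nonneg hK.le (mul_nonneg hε.1.le hM.le)) hεt hfb
    obtain ⟨ξ, hξ, hωξ⟩ := hsolve
      (fun x i => if hx : x ∈ Metric.closedBall ξstar ρ then lam i ⟨x, hx⟩ else 0)
      (by
        rw [continuousOn_iff_continuous_domRestrict, continuous_pi_iff]
        intro i
        convert (lam i).continuous using 1
        funext x
        exact dif_pos x.2)
      (fun x hx => by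
        simp only [hx, dite_true]
        exact (pi_norm_le_iff_of_nonneg hr.le).2 fun i => (hlam i _).trans hεr)
    refine ⟨ξ, fun θ i => θ i + v i ⟨ξ, hξ⟩ θ, ⟨hρΛ hξ, ?_, fun θ j => ?_, fun θ => ?_⟩,
      fun θ => ?_⟩
    · exact continuous_pi fun i => (continuous_apply i).add (hvc i _)
    · funext i
      simp only [hvp, Pi.add_apply]
      ring
    · refine ⟨0, fun i => ?_⟩
      have h1 := hdef i ⟨ξ, hξ⟩ θ
      have h2 := congrFun hωξ i
      simp only [conjDefect, Complex.re_ofReal_mul, Pi.add_apply, hξ, dite_true, ← hq] at h1 h2 ⊢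
      rw [h2]
      simp only [Pi.zero_apply, Int.cast_zero, mul_zero, add_zero]
      linarith
    · simp only [add_sub_cancel_left]
      simpa using Finset.sum_le_card_nsmul Finset.univ _ _ fun i _ => hv i ⟨ξ, hξ⟩ θ
  choose! ξinf u hu hsmall using key
  refine ⟨ε₀, ⟨hε₀, min_le_left _ _⟩, ξinf, u, hu, fun η hη =>
    ⟨η / (n * (C * (K * M))), by positivity, fun ε hε hεη θ => (hsmall ε hε θ).trans ?_⟩⟩
  rw [lt_div_iff₀ (by positivity)] at hεη
  linarith
end
end

section
/- Solvability of the perturbed frequency equation under injectivity (existence part of Lemma 4.5, with the degree condition realized by injectivity). Let n ≥ 1, let K ⊂ ℝⁿ be compact, let ω : K → ℝⁿ be continuous and injective, let r₀ be an interior point of K and p = ω(r₀), and let δ > 0 be such that the closed ball B̄(r₀,δ) ⊂ K. Set d = dist(p, ω(∂B̄(r₀,δ))), which is positive. Then for every continuous map g : B̄(r₀,δ) → ℝⁿ with sup_{B̄(r₀,δ)} |g| < d there exists r̂ in the open ball B(r₀,δ) with ω(r̂) + g(r̂) = p. -/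
open scoped Real

noncomputable section

open MeasureTheory Metric Set Filter Topology Polynomial

/-- The value at `1` of a polynomial of degree at most `N` is a fixed combination of its values
at `N + 1` distinct nodes in `(0, τ)`, so an integral of polynomials which is constant on `(0, τ)`
has the same value at `1`. -/
theorem integral_eval_one_eq_of_eventually_const {α : Type*} [MeasurableSpace α] (μ : Measure α)
    (N : ℕ) (P : α → ℝ[X]) (hP : ∀ x, (P x).natDegree ≤ N)
    (hint : ∀ t, Integrable (fun x => (P x).eval t) μ) {τ c : ℝ} (hτ : 0 < τ)
    (hc : ∀ t, 0 < t → t < τ → ∫ x, (P x).eval t ∂μ = c) :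
    ∫ x, (P x).eval 1 ∂μ = c := by
  set v : ℕ → ℝ := fun i => τ / (i + 2) with hv
  set s := Finset.range (N + 1)
  have hinj : Set.InjOn v s := by
    intro i _ j _ hij
    have hi : (0 : ℝ) < i + 2 := by positivity
    have hj : (0 : ℝ) < j + 2 := by positivity
    simp only [hv] at hij
    rw [div_eq_div_iff hi.ne' hj.ne'] at hij
    have := mul_left_cancel₀ hτ.ne' hij
    exact_mod_cast (by linarith : (i : ℝ) = j)
  have hval : ∀ x, (P x).eval 1
      = ∑ i ∈ s, (P x).eval (v i) * (Lagrange.basis s v i).eval 1 := by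
    intro x
    have hdeg : (P x).degree < s.card := by
      refine lt_of_le_of_lt (Polynomial.degree_le_of_natDegree_le (hP x)) ?_
      simp only [s, Finset.card_range]
      exact_mod_cast Nat.lt_succ_self N
    conv_lhs => rw [Lagrange.eq_interpolate hinj hdeg]
    simp [Lagrange.interpolate_apply, Polynomial.eval_finsetSum]
  have hsum : ∑ i ∈ s, (Lagrange.basis s v i).eval 1 = 1 := by
    rw [← Polynomial.eval_finsetSum, Lagrange.sum_basis hinj ⟨0, by simp [s]⟩]
    simp
  simp_rw [hval]
  rw [integral_finsetSum _ fun i _ => (hint _).mul_const _]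
  simp_rw [integral_mul_const]
  have : ∀ i ∈ s, (∫ x, (P x).eval (v i) ∂μ) * (Lagrange.basis s v i).eval 1
      = c * (Lagrange.basis s v i).eval 1 := by
    intro i _
    rw [hc _ (by positivity) ?_]
    rw [hv, div_lt_iff₀ (by positivity)]
    nlinarith [(Nat.cast_nonneg i : (0 : ℝ) ≤ i)]
  rw [Finset.sum_congr rfl this, ← Finset.mul_sum, hsum, mul_one]

section InnerProductSpace

variable {E : Type*} [NormedAddCommGroup E] [InnerProductSpace ℝ E] [FiniteDimensional ℝ E]

/-- `t ↦ det (1 + t A)` is a polynomial of degree at most the dimension. -/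
theorem exists_polynomial_eval_eq_det_one_add_smul (A : E →L[ℝ] E) :
    ∃ P : ℝ[X], P.natDegree ≤ Module.finrank ℝ E ∧
      ∀ t : ℝ, P.eval t = (ContinuousLinearMap.id ℝ E + t • A).det := by
  let b := Module.finBasis ℝ E
  let M := LinearMap.toMatrix b b (A : E →ₗ[ℝ] E)
  refine ⟨((X : ℝ[X]) • M.map C + (1 : Matrix _ _ ℝ).map C).det, ?_, fun t => ?_⟩
  · simpa using Polynomial.natDegree_det_X_add_C_le M 1
  · rw [ContinuousLinearMap.det, ← LinearMap.det_toMatrix b, ← Polynomial.coe_evalRingHom,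
      RingHom.map_det]
    congr 1
    ext i j
    by_cases h : i = j <;> simp [M, h, LinearMap.toMatrix_apply, add_comm] <;> ring

omit [FiniteDimensional ℝ E] in
theorem exists_polynomial_eval_eq_sub_norm_sq_pow (x u : E) (m : ℝ) (k : ℕ) :
    ∃ P : ℝ[X], P.natDegree ≤ 2 * k ∧
      ∀ t : ℝ, P.eval t = (m - ‖x + t • u‖ ^ 2) ^ k := by
  refine ⟨(C (-‖u‖ ^ 2) * X ^ 2 + C (-(2 * inner ℝ x u)) * X + C (m - ‖x‖ ^ 2)) ^ k, ?_, ?_⟩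
  · refine (natDegree_pow_le_of_le k natDegree_quadratic_le).trans ?_
    omega
  · intro t
    simp only [eval_pow, eval_add, eval_mul, eval_C, eval_X]
    congr 1
    rw [norm_add_sq_real, norm_smul, inner_smul_right, mul_pow, Real.norm_eq_abs, sq_abs]
    ring

/-- A small perturbation of the identity by a Lipschitz map is bijective. -/
theorem bijective_add_of_lipschitzWith {F : Type*} [NormedAddCommGroup F] [CompleteSpace F]
    {u : F → F} {K : NNReal} (hK : K < 1) (hu : LipschitzWith K u) :
    Function.Bijective fun x => x + u x := by
  have hc : ∀ y : F, ContractingWith K fun x => y - u x := fun y =>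
    ⟨hK, LipschitzWith.of_dist_le_mul fun a b => by
      simpa only [dist_sub_left] using hu.dist_le_mul a b⟩
  refine ⟨fun a b hab => ?_, fun y => ?_⟩
  · refine (hc (a + u a)).fixedPoint_unique' ?_ ?_
    · simp [Function.IsFixedPt]
    · simp only [Function.IsFixedPt, sub_eq_iff_eq_add]
      exact hab
  · refine ⟨ContractingWith.fixedPoint _ (hc y), ?_⟩
    have := (hc y).fixedPoint_isFixedPt
    simp only [Function.IsFixedPt, sub_eq_iff_eq_add] at this
    exact this.symm

theorem image_eq_of_bijective_of_eq_self_off {α : Type*} {f : α → α}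
    (hf : Function.Bijective f) {s : Set α} (hs : ∀ x ∉ s, f x = x) : f '' s = s := by
  ext y
  constructor
  · rintro ⟨x, hx, rfl⟩
    by_contra h
    exact h (by rwa [hf.1 (hs _ h)])
  · intro hy
    obtain ⟨x, rfl⟩ := hf.2 y
    by_cases hx : x ∈ s
    · exact mem_image_of_mem _ hx
    · exact absurd (by rwa [hs x hx] at hy) hx

variable [MeasurableSpace E] [BorelSpace E]

/-- Degree-one change of variables for a compactly supported `C¹` perturbation of the identity
and the weight `(M² - ‖y‖²) ^ k`. -/
theorem integral_weight_comp_mul_det_eq (μ : Measure E) [μ.IsAddHaarMeasure]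
    {u : E → E} (hu : ContDiff ℝ 1 u) (hsupp : HasCompactSupport u) {M : ℝ}
    (hM : ∀ x, M < ‖x‖ → u x = 0) (m : ℝ) (k : ℕ) :
    ∫ x in closedBall 0 M, (m - ‖x + u x‖ ^ 2) ^ k
        * (ContinuousLinearMap.id ℝ E + fderiv ℝ u x).det ∂μ
      = ∫ x in closedBall 0 M, (m - ‖x‖ ^ 2) ^ k ∂μ := by
  choose P hPdeg hP using fun x => exists_polynomial_eval_eq_det_one_add_smul (fderiv ℝ u x)
  choose Q hQdeg hQ using fun x => exists_polynomial_eval_eq_sub_norm_sq_pow x (u x) m k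
  have hdu : Continuous (fderiv ℝ u) := hu.continuous_fderiv one_ne_zero
  have hev : ∀ t x, (Q x * P x).eval t = (m - ‖x + t • u x‖ ^ 2) ^ k
      * (ContinuousLinearMap.id ℝ E + t • fderiv ℝ u x).det := by
    intro t x
    rw [eval_mul, hP, hQ]
  obtain ⟨L, hL⟩ := ContDiff.lipschitzWith_of_hasCompactSupport hsupp hu one_ne_zero
  obtain ⟨D, hD⟩ := (hsupp.fderiv ℝ).exists_bound_of_continuous hdu
  have hD0 : 0 ≤ D := (norm_nonneg _).trans (hD 0)
  have hdet : ∀ᶠ B : E →L[ℝ] E in 𝓝 (ContinuousLinearMap.id ℝ E), 0 < B.det := by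
    refine (ContinuousLinearMap.continuous_det (𝕜 := ℝ) (E := E)).continuousAt.eventually
      (lt_mem_nhds ?_)
    simp [ContinuousLinearMap.det]
  obtain ⟨ρ, hρ, hρdet⟩ := Metric.eventually_nhds_iff.1 hdet
  set τ : ℝ := min (ρ / (D + 1)) (1 / (L + 1)) with hτ
  have hτ0 : 0 < τ := by positivity
  have key := integral_eval_one_eq_of_eventually_const (μ.restrict (closedBall 0 M))
    (2 * k + Module.finrank ℝ E) (fun x => Q x * P x)
    (fun x => natDegree_mul_le_of_le (hQdeg x) (hPdeg x)) ?_ hτ0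
    (c := ∫ x in closedBall 0 M, (m - ‖x‖ ^ 2) ^ k ∂μ) ?_
  · simpa only [hev, one_smul] using key
  · intro t
    simp only [hev]
    refine ContinuousOn.integrableOn_compact (isCompact_closedBall _ _) ?_
    refine Continuous.continuousOn ?_
    have := hu.continuous
    have h2 := (ContinuousLinearMap.continuous_det (𝕜 := ℝ) (E := E)).comp
      (continuous_const.add (hdu.const_smul t) :
        Continuous fun x => ContinuousLinearMap.id ℝ E + t • fderiv ℝ u x)
    exact Continuous.mul (by fun_prop) h2
  · intro t ht0 htτ
    have ht1 : t * (D + 1) < ρ := by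
      rw [← lt_div_iff₀ (by positivity)]
      exact htτ.trans_le (min_le_left _ _)
    have ht2 : t * (L + 1) < 1 := by
      rw [← lt_div_iff₀ (by positivity)]
      exact htτ.trans_le (min_le_right _ _)
    have hpos : ∀ x, 0 < (ContinuousLinearMap.id ℝ E + t • fderiv ℝ u x).det := by
      intro x
      refine hρdet ?_
      rw [dist_eq_norm, add_sub_cancel_left, norm_smul, Real.norm_of_nonneg ht0.le]
      nlinarith [hD x]
    have hbij : Function.Bijective fun x => x + t • u x := by
      refine bijective_add_of_lipschitzWith (K := ⟨t, ht0.le⟩ * L) ?_ ?_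
      · rw [← NNReal.coe_lt_coe]
        push_cast
        change t * (L : ℝ) < 1
        nlinarith
      · refine LipschitzWith.of_dist_le_mul fun a b => ?_
        rw [dist_smul₀, Real.norm_of_nonneg ht0.le]
        change _ ≤ t * (L : ℝ) * _
        rw [mul_assoc]
        exact mul_le_mul_of_nonneg_left (hL.dist_le_mul a b) ht0.le
    have himg : (fun x => x + t • u x) '' closedBall 0 M = closedBall 0 M := by
      refine image_eq_of_bijective_of_eq_self_off hbij fun x hx => ?_
      rw [mem_closedBall_zero_iff, not_le] at hx
      simp [hM x hx]
    have hder : ∀ x ∈ closedBall (0 : E) M, HasFDerivWithinAt (fun x => x + t • u x)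
        (ContinuousLinearMap.id ℝ E + t • fderiv ℝ u x) (closedBall 0 M) x := fun x _ =>
      ((hasFDerivAt_id x).add
        (((hu.differentiable one_ne_zero) x).hasFDerivAt.const_smul t)).hasFDerivWithinAt
    have := integral_image_eq_integral_abs_det_fderiv_smul μ measurableSet_closedBall hder
      hbij.1.injOn fun y => (m - ‖y‖ ^ 2) ^ k
    rw [himg] at this
    rw [this]
    simp only [hev, abs_of_pos (hpos _), smul_eq_mul]
    simp only [mul_comm]

/-- A compactly supported `C¹` perturbation of the identity has a zero. -/
theorem exists_add_eq_zero_of_contDiff_hasCompactSupport {u : E → E} (hu : ContDiff ℝ 1 u)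
    (hsupp : HasCompactSupport u) : ∃ x, x + u x = 0 := by
  by_contra! hne
  let μ : Measure E := Measure.addHaar
  have hdu : Continuous (fderiv ℝ u) := hu.continuous_fderiv one_ne_zero
  obtain ⟨R, hR0, hR⟩ := hsupp.exists_pos_le_norm
  obtain ⟨D, hD⟩ := hsupp.exists_bound_of_continuous hu.continuous
  have hD0 : 0 ≤ D := (norm_nonneg _).trans (hD 0)
  set M : ℝ := R + D with hMdef
  have hM0 : 0 < M := by positivity
  have hMu : ∀ x, M < ‖x‖ → u x = 0 := fun x hx => hR x (by linarith)
  have hfM : ∀ x, ‖x‖ ≤ M → ‖x + u x‖ ≤ M := by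
    intro x hx
    by_cases h : R ≤ ‖x‖
    · simpa [hR x h] using hx
    · exact (norm_add_le _ _).trans (by linarith [hD x])
  obtain ⟨ε, hε0, hεM, hε⟩ : ∃ ε, 0 < ε ∧ ε ≤ M ∧ ∀ x, ‖x‖ ≤ M → ε ≤ ‖x + u x‖ := by
    have hc : ContinuousOn (fun x => ‖x + u x‖) (closedBall 0 M) :=
      (continuous_id.add hu.continuous).norm.continuousOn
    obtain ⟨z, hz, hzmin⟩ := (isCompact_closedBall (0 : E) M).exists_isMinOn
      ⟨0, by simp [hM0.le]⟩ hc
    rw [mem_closedBall_zero_iff] at hz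
    exact ⟨‖z + u z‖, norm_pos_iff.2 (hne z), hfM z hz,
      fun x hx => hzmin (mem_closedBall_zero_iff.2 hx)⟩
  have hcdet : Continuous fun x => (ContinuousLinearMap.id ℝ E + fderiv ℝ u x).det :=
    (ContinuousLinearMap.continuous_det (𝕜 := ℝ) (E := E)).comp (continuous_const.add hdu)
  obtain ⟨B, hB⟩ := (isCompact_closedBall (0 : E) M).exists_bound_of_continuousOn
    hcdet.continuousOn
  set a : ℝ := M ^ 2 - ε ^ 2 with ha
  set b : ℝ := M ^ 2 - (ε / 2) ^ 2 with hb
  have ha0 : 0 ≤ a := by nlinarith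
  have hab : a < b := by nlinarith
  have hb0 : 0 < b := ha0.trans_lt hab
  set V := μ.real (closedBall 0 M)
  set W := μ.real (closedBall 0 (ε / 2))
  have hW : 0 < W := ENNReal.toReal_pos
    (measure_closedBall_pos μ _ (by positivity)).ne' measure_closedBall_lt_top.ne
  have hupper : ∀ k : ℕ, ∫ x in closedBall 0 M, (M ^ 2 - ‖x‖ ^ 2) ^ k ∂μ ≤ a ^ k * B * V := by
    intro k
    rw [← integral_weight_comp_mul_det_eq μ hu hsupp hMu]
    refine (le_abs_self _).trans ?_
    rw [← Real.norm_eq_abs]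
    refine norm_setIntegral_le_of_norm_le_const measure_closedBall_lt_top fun x hx => ?_
    rw [norm_mul, norm_pow]
    refine mul_le_mul (pow_le_pow_left₀ (norm_nonneg _) ?_ k) (hB x hx) (norm_nonneg _)
      (by positivity)
    rw [mem_closedBall_zero_iff] at hx
    rw [Real.norm_of_nonneg] <;> nlinarith [hfM x hx, hε x hx, norm_nonneg (x + u x)]
  have hlower : ∀ k : ℕ, b ^ k * W ≤ ∫ x in closedBall 0 M, (M ^ 2 - ‖x‖ ^ 2) ^ k ∂μ := by
    intro k
    have hint : IntegrableOn (fun x : E => (M ^ 2 - ‖x‖ ^ 2) ^ k) (closedBall 0 M) μ :=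
      ContinuousOn.integrableOn_compact (isCompact_closedBall _ _) (by fun_prop)
    have hsub : closedBall (0 : E) (ε / 2) ⊆ closedBall 0 M :=
      closedBall_subset_closedBall (by linarith)
    calc b ^ k * W = ∫ x in closedBall (0 : E) (ε / 2), b ^ k ∂μ := by
          rw [setIntegral_const, smul_eq_mul, mul_comm]
      _ ≤ ∫ x in closedBall (0 : E) (ε / 2), (M ^ 2 - ‖x‖ ^ 2) ^ k ∂μ := by
          refine setIntegral_mono_on (integrableOn_const measure_closedBall_lt_top.ne)
            (hint.mono_set hsub) measurableSet_closedBall fun x hx => ?_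
          rw [mem_closedBall_zero_iff] at hx
          exact pow_le_pow_left₀ hb0.le (by nlinarith [norm_nonneg x]) k
      _ ≤ _ := by
          refine setIntegral_mono_set hint ?_ (Eventually.of_forall hsub)
          refine (ae_restrict_mem measurableSet_closedBall).mono fun x hx => ?_
          rw [mem_closedBall_zero_iff] at hx
          exact pow_nonneg (by nlinarith [norm_nonneg x]) k
  have htend : Tendsto (fun k : ℕ => (a / b) ^ k * (B * V)) atTop (𝓝 (0 * (B * V))) :=
    (tendsto_pow_atTop_nhds_zero_of_lt_one (by positivity)
      ((div_lt_one hb0).2 hab)).mul_const _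
  rw [zero_mul] at htend
  obtain ⟨k, hk⟩ := (htend.eventually_lt_const hW).exists
  have h := (hlower k).trans (hupper k)
  rw [div_pow, div_mul_eq_mul_div, div_lt_iff₀ (by positivity)] at hk
  linarith [mul_assoc (a ^ k) B V]

end InnerProductSpace

/-- **Brouwer's fixed point theorem** for bounded continuous self-maps of a Euclidean space. -/
theorem exists_eq_of_continuous_of_bounded_of_inner {E : Type*} [NormedAddCommGroup E]
    [InnerProductSpace ℝ E] [FiniteDimensional ℝ E] {F : E → E} (hF : Continuous F) {C : ℝ}
    (hC : ∀ x, ‖F x‖ ≤ C) : ∃ x, F x = x := by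
  let _ : MeasurableSpace E := borel E
  have : BorelSpace E := ⟨rfl⟩
  have hC0 : 0 ≤ C := (norm_nonneg _).trans (hC 0)
  obtain ⟨z, -, hz⟩ := (isCompact_closedBall (0 : E) (C + 1)).exists_isMinOn
    ⟨0, mem_closedBall_self (by positivity)⟩
    (hF.dist continuous_id).continuousOn
  refine ⟨z, ?_⟩
  by_contra hne
  let χ : ContDiffBump (0 : E) := ⟨C + 1, C + 2, by positivity, by linarith⟩
  have hv : Continuous fun x => χ x • F x := χ.continuous.smul hF
  set η := min (dist (F z) z) 1
  have hη : 0 < η := lt_min (dist_pos.2 hne) one_pos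
  obtain ⟨g, hg, hgv, hgsupp⟩ := hv.exists_contDiff_approx 1 (ε := fun _ => η)
    continuous_const fun _ => hη
  have hgc : HasCompactSupport g :=
    (χ.hasCompactSupport.smul_right (f' := F)).mono hgsupp
  obtain ⟨x, hx⟩ := exists_add_eq_zero_of_contDiff_hasCompactSupport (u := fun x => -g x)
    hg.neg hgc.neg
  rw [← sub_eq_add_neg, sub_eq_zero] at hx
  have hvC : ‖χ x • F x‖ ≤ C := by
    rw [norm_smul, Real.norm_of_nonneg χ.nonneg]
    nlinarith [χ.le_one (x := x), χ.nonneg (x := x), hC x, norm_nonneg (F x)]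
  have hdist := hgv x
  rw [← hx, dist_eq_norm] at hdist
  have hxball : x ∈ closedBall (0 : E) (C + 1) := by
    rw [mem_closedBall_zero_iff]
    have h1 : ‖x‖ ≤ ‖x - χ x • F x‖ + ‖χ x • F x‖ := by
      simpa using norm_add_le (x - χ x • F x) (χ x • F x)
    linarith [min_le_right (dist (F z) z) 1]
  rw [χ.one_of_mem_closedBall hxball, one_smul, ← dist_eq_norm, dist_comm] at hdist
  exact absurd (hz hxball) (not_le.2 (hdist.trans_le (min_le_left _ _)))

section NormedSpace

variable {E : Type*} [NormedAddCommGroup E] [NormedSpace ℝ E] [FiniteDimensional ℝ E]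

theorem exists_eq_of_continuous_of_bounded {F : E → E} (hF : Continuous F) {C : ℝ}
    (hC : ∀ x, ‖F x‖ ≤ C) : ∃ x, F x = x := by
  let e : E ≃L[ℝ] EuclideanSpace ℝ (Fin (Module.finrank ℝ E)) := toEuclidean
  obtain ⟨y, hy⟩ := exists_eq_of_continuous_of_bounded_of_inner
    (F := fun y => e (F (e.symm y))) (by fun_prop)
    (C := ‖(e : E →L[ℝ] EuclideanSpace ℝ (Fin (Module.finrank ℝ E)))‖ * C)
    fun y => ((e : E →L[ℝ] EuclideanSpace ℝ (Fin (Module.finrank ℝ E))).le_opNorm _).trans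
      (mul_le_mul_of_nonneg_left (hC _) (norm_nonneg _))
  exact ⟨e.symm y, by rw [ContinuousLinearEquiv.eq_symm_apply, hy]⟩

/-- **Brouwer's fixed point theorem** for closed balls. -/
theorem exists_eq_of_continuousOn_closedBall {F : E → E} {r : ℝ} (hr : 0 < r)
    (hF : ContinuousOn F (closedBall 0 r)) (hmaps : MapsTo F (closedBall 0 r) (closedBall 0 r)) :
    ∃ x ∈ closedBall 0 r, F x = x := by
  set ρ : E → E := fun x => (r / max r ‖x‖) • x with hρdef
  have hpos : ∀ x : E, 0 < max r ‖x‖ := fun x => lt_max_of_lt_left hr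
  have hρ : Continuous ρ :=
    (continuous_const.div (continuous_const.max continuous_norm) fun x => (hpos x).ne').smul
      continuous_id
  have hρmem : ∀ x, ρ x ∈ closedBall 0 r := by
    intro x
    rw [mem_closedBall_zero_iff, norm_smul, Real.norm_of_nonneg (div_nonneg hr.le (hpos x).le),
      div_mul_eq_mul_div, div_le_iff₀ (hpos x)]
    exact mul_le_mul_of_nonneg_left (le_max_right _ _) hr.le
  obtain ⟨x, hx⟩ := exists_eq_of_continuous_of_bounded (F := fun x => F (ρ x))
    (hF.comp_continuous hρ hρmem) fun x => mem_closedBall_zero_iff.1 (hmaps (hρmem x))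
  have hxmem : x ∈ closedBall 0 r := hx ▸ hmaps (hρmem x)
  refine ⟨x, hxmem, ?_⟩
  have hfix : ρ x = x := by
    rw [hρdef]
    simp only
    rw [max_eq_left (mem_closedBall_zero_iff.1 hxmem), div_self hr.ne', one_smul]
  rwa [hfix] at hx

/-- A continuous injection on a compact subset has a globally defined continuous left inverse. -/
theorem exists_continuous_leftInvOn {X : Type*} [TopologicalSpace X] {f : X → E} {K : Set X}
    (hK : IsCompact K) (hf : ContinuousOn f K) (hinj : InjOn f K) {ι : X → E} (hι : Continuous ι) :
    ∃ G : E → E, Continuous G ∧ ∀ x ∈ K, G (f x) = ι x := by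
  have := isCompact_iff_compactSpace.1 hK
  have : TietzeExtension E := TietzeExtension.of_tvs ℝ
  have he : IsClosedEmbedding (K.domRestrict f) :=
    hf.domRestrict.isClosedEmbedding hinj.injective
  obtain ⟨G, hG⟩ := ContinuousMap.exists_extension' he
    ⟨fun x : K => ι x, hι.comp continuous_subtype_val⟩
  exact ⟨G, G.continuous, fun x hx => congrFun hG ⟨x, hx⟩⟩

/-- **Invariance of domain**, local form. -/
theorem image_closedBall_mem_nhds {f : E → E} {a : E} {r : ℝ} (hr : 0 < r)
    (hf : ContinuousOn f (closedBall a r)) (hinj : InjOn f (closedBall a r)) :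
    f '' closedBall a r ∈ 𝓝 (f a) := by
  let _ : MeasurableSpace E := borel E
  have : BorelSpace E := ⟨rfl⟩
  let μ : Measure E := Measure.addHaar
  by_contra hnot
  have hK := isCompact_closedBall a r
  have haK : a ∈ closedBall a r := mem_closedBall_self hr.le
  obtain ⟨H, hH, hHf⟩ := exists_continuous_leftInvOn hK hf hinj
    (ι := fun x => x - a) (by fun_prop)
  have hHa : H (f a) = 0 := by rw [hHf a haK, sub_self]
  obtain ⟨ε₀, hε₀, hHε⟩ := Metric.continuousAt_iff.1 (hH.continuousAt (x := f a)) (r / 4)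
    (by positivity)
  rw [hHa] at hHε
  simp only [dist_zero_right] at hHε
  set ε := ε₀ / 3
  have hε : 0 < ε := by positivity
  obtain ⟨c, hcball, hc⟩ : ∃ c ∈ ball (f a) ε, c ∉ f '' closedBall a r := by
    by_contra! h
    exact hnot (mem_of_superset (ball_mem_nhds _ hε) h)
  have hsmall : ∀ y, ‖y - c‖ ≤ ε → ‖H y‖ < r / 4 := by
    intro y hy
    refine hHε ?_
    have h1 := dist_triangle y c (f a)
    rw [mem_ball] at hcball
    rw [dist_eq_norm y c] at h1
    simp only [ε] at *
    linarith
  have hcompact : IsCompact (f '' closedBall a r \ ball c ε) :=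
    (hK.image_of_continuousOn hf).diff isOpen_ball
  obtain ⟨η, hη, hηr, hηH⟩ : ∃ η > 0, η ≤ r / 4 ∧
      ∀ y ∈ f '' closedBall a r \ ball c ε, η ≤ ‖H y‖ := by
    rcases (f '' closedBall a r \ ball c ε).eq_empty_or_nonempty with h | h
    · exact ⟨r / 4, by positivity, le_rfl, by simp [h]⟩
    · obtain ⟨y₀, hy₀, hmin⟩ := hcompact.exists_isMinOn h hH.norm.continuousOn
      refine ⟨min ‖H y₀‖ (r / 4), lt_min (norm_pos_iff.2 ?_) (by positivity), min_le_right _ _,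
        fun y hy => (min_le_left _ _).trans (hmin hy)⟩
      obtain ⟨⟨x, hx, rfl⟩, hxc⟩ := hy₀
      rw [hHf x hx]
      intro h0
      rw [sub_eq_zero.1 h0, mem_ball, dist_comm] at hxc
      exact hxc hcball
  obtain ⟨P, hP, hPH, -⟩ := hH.exists_contDiff_approx 1 (ε := fun _ => η / 2)
    continuous_const fun _ => half_pos hη
  obtain ⟨w, hwball, hw⟩ : ∃ w ∈ ball (0 : E) (η / 2), w ∉ P '' sphere c ε := by
    by_contra! h
    have hnull : μ (P '' sphere c ε) = 0 :=
      addHaar_image_eq_zero_of_differentiableOn_of_addHaar_eq_zero μ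
        (hP.differentiable one_ne_zero).differentiableOn
        (Measure.addHaar_sphere_of_ne_zero μ c hε.ne')
    exact (measure_ball_pos μ (0 : E) (half_pos hη)).ne' (measure_mono_null h hnull)
  rw [mem_ball_zero_iff] at hwball
  have hclose : ∀ y, ‖H y - (P y - w)‖ < η := by
    intro y
    have h1 := hPH y
    rw [dist_comm, dist_eq_norm] at h1
    calc ‖H y - (P y - w)‖ = ‖(H y - P y) + w‖ := by congr 1; abel
      _ ≤ _ := norm_add_le _ _
      _ < η := by linarith
  set Φ : E → E := fun y => c + max (ε / ‖y - c‖) 1 • (y - c) with hΦdef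
  have hne : ∀ y ∈ f '' closedBall a r, ‖y - c‖ ≠ 0 := by
    intro y hy h0
    rw [norm_eq_zero, sub_eq_zero] at h0
    exact hc (h0 ▸ hy)
  have hΦ : ContinuousOn Φ (f '' closedBall a r) := by
    have hsub : ContinuousOn (fun y => y - c) (f '' closedBall a r) := by fun_prop
    exact continuousOn_const.add
      (((continuousOn_const.div hsub.norm hne).sup continuousOn_const).smul hsub)
  have hΦfar : ∀ y, ε ≤ ‖y - c‖ → Φ y = y := by
    intro y hy
    have : ε / ‖y - c‖ ≤ 1 := div_le_one_of_le₀ hy (norm_nonneg _)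
    simp [hΦdef, max_eq_right this]
  have hΦnear : ∀ y ∈ f '' closedBall a r, ‖y - c‖ < ε → Φ y ∈ sphere c ε := by
    intro y hy hlt
    have h0 : 0 < ‖y - c‖ := lt_of_le_of_ne (norm_nonneg _) (hne y hy).symm
    have : 1 ≤ ε / ‖y - c‖ := (one_le_div h0).2 hlt.le
    rw [mem_sphere, dist_eq_norm, hΦdef]
    simp only [add_sub_cancel_left]
    rw [max_eq_left this, norm_smul, Real.norm_of_nonneg (by positivity), div_mul_cancel₀ _ h0.ne']
  have hnonzero : ∀ y ∈ f '' closedBall a r, P (Φ y) - w ≠ 0 := by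
    intro y hy h0
    rcases le_or_gt ε ‖y - c‖ with h | h
    · rw [hΦfar y h] at h0
      have h1 := hclose y
      rw [h0, sub_zero] at h1
      exact absurd (hηH y ⟨hy, by simpa [dist_eq_norm] using h⟩) (not_le.2 h1)
    · exact hw ⟨Φ y, hΦnear y hy h, sub_eq_zero.1 h0⟩
  have hbound : ∀ y ∈ f '' closedBall a r, ‖H y - (P (Φ y) - w)‖ ≤ r := by
    intro y hy
    rcases le_or_gt ε ‖y - c‖ with h | h
    · rw [hΦfar y h]
      linarith [hclose y]
    · have h1 := hsmall y h.le
      have h2 := hsmall (Φ y) (mem_sphere_iff_norm.1 (hΦnear y hy h)).le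
      calc ‖H y - (P (Φ y) - w)‖ = ‖H y - H (Φ y) + (H (Φ y) - (P (Φ y) - w))‖ := by
            congr 1; abel
        _ ≤ ‖H y‖ + ‖H (Φ y)‖ + ‖H (Φ y) - (P (Φ y) - w)‖ :=
            (norm_add_le _ _).trans (by gcongr; exact norm_sub_le _ _)
        _ ≤ r := by linarith [hclose (Φ y)]
  have hmem : ∀ x ∈ closedBall (0 : E) r, a + x ∈ closedBall a r := by
    intro x hx
    simpa using hx
  have hcont : ContinuousOn (fun x => x - (P (Φ (f (a + x))) - w)) (closedBall 0 r) := by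
    have h1 : ContinuousOn (fun x => f (a + x)) (closedBall 0 r) :=
      hf.comp (by fun_prop) hmem
    have h2 : ContinuousOn (fun x => Φ (f (a + x))) (closedBall 0 r) :=
      hΦ.comp h1 fun x hx => mem_image_of_mem f (hmem x hx)
    exact continuousOn_id.sub ((hP.continuous.comp_continuousOn h2).sub continuousOn_const)
  obtain ⟨x, hx, hfix⟩ := exists_eq_of_continuousOn_closedBall hr hcont fun x hx => by
    rw [mem_closedBall_zero_iff]
    have h1 := hbound _ (mem_image_of_mem f (hmem x hx))
    rwa [hHf _ (hmem x hx), add_sub_cancel_left] at h1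
  exact hnonzero _ (mem_image_of_mem f (hmem x hx)) (sub_eq_self.1 hfix)

theorem isOpen_image_of_continuousOn_injOn {f : E → E} {U : Set E} (hU : IsOpen U)
    (hf : ContinuousOn f U) (hinj : InjOn f U) : IsOpen (f '' U) := by
  rw [isOpen_iff_mem_nhds]
  rintro _ ⟨x, hx, rfl⟩
  obtain ⟨ρ, hρ, hsub⟩ := nhds_basis_closedBall.mem_iff.1 (hU.mem_nhds hx)
  exact mem_of_superset (image_closedBall_mem_nhds hρ (hf.mono hsub) (hinj.mono hsub))
    (image_mono hsub)

/-- A continuous injection on a closed ball covers the open ball around the image of the center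
whose radius is the distance to the image of the boundary sphere. -/
theorem ball_subset_image_ball {f : E → E} {a : E} {r d : ℝ} (hr : 0 < r)
    (hf : ContinuousOn f (closedBall a r)) (hinj : InjOn f (closedBall a r))
    (hd : ∀ x ∈ sphere a r, d ≤ dist (f x) (f a)) : ball (f a) d ⊆ f '' ball a r := by
  rcases le_or_gt d 0 with hd0 | hd0
  · simp [ball_eq_empty.2 hd0]
  have hsub := ball_subset_closedBall (x := a) (ε := r)
  refine (convex_ball (f a) d).isPreconnected.subset_of_closure_inter_subset
    (isOpen_image_of_continuousOn_injOn isOpen_ball (hf.mono hsub) (hinj.mono hsub))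
    ⟨f a, mem_ball_self hd0, mem_image_of_mem f (mem_ball_self hr)⟩ ?_
  rintro y ⟨hy, hyd⟩
  have hclosed : IsClosed (f '' closedBall a r) :=
    ((isCompact_closedBall a r).image_of_continuousOn hf).isClosed
  obtain ⟨x, hx, rfl⟩ := closure_minimal (image_mono hsub) hclosed hy
  refine mem_image_of_mem f (mem_ball.2 (lt_of_le_of_ne (mem_closedBall.1 hx) fun h => ?_))
  exact absurd (hd x h) (not_le.2 hyd)

/-- A perturbation of a continuous injection on a closed ball, smaller than the distance from the
image of the center to the image of the boundary sphere, still attains the image of the center. -/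
theorem exists_add_eq_of_injOn_closedBall {f g : E → E} {a : E} {r d : ℝ} (hr : 0 < r)
    (hf : ContinuousOn f (closedBall a r)) (hinj : InjOn f (closedBall a r))
    (hd : ∀ x ∈ sphere a r, d ≤ dist (f x) (f a))
    (hg : ContinuousOn g (closedBall a r)) (hgd : ∀ x ∈ closedBall a r, ‖g x‖ < d) :
    ∃ x ∈ ball a r, f x + g x = f a := by
  have hK := isCompact_closedBall a r
  have haK : a ∈ closedBall a r := mem_closedBall_self hr.le
  obtain ⟨z, hz, hmax⟩ := hK.exists_isMaxOn ⟨a, haK⟩ hg.norm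
  obtain ⟨d', hzd, hdd⟩ := exists_between (hgd z hz)
  have hd'0 : 0 < d' := (norm_nonneg _).trans_lt hzd
  have hcover := ball_subset_image_ball hr hf hinj hd
  obtain ⟨G, hG, hGf⟩ := exists_continuous_leftInvOn hK hf hinj (ι := id) continuous_id
  have hpre : ∀ y ∈ closedBall (0 : E) d', ∃ x ∈ ball a r, f x = f a + y ∧ G (f a + y) = x := by
    intro y hy
    obtain ⟨x, hx, hxy⟩ := hcover (show f a + y ∈ ball (f a) d by
      rw [mem_closedBall_zero_iff] at hy
      simpa using hy.trans_lt hdd)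
    exact ⟨x, hx, hxy, hxy ▸ hGf x (ball_subset_closedBall hx)⟩
  have hGmem : ∀ y ∈ closedBall (0 : E) d', G (f a + y) ∈ closedBall a r := by
    intro y hy
    obtain ⟨x, hx, -, hGx⟩ := hpre y hy
    exact hGx ▸ ball_subset_closedBall hx
  obtain ⟨y, hy, hfix⟩ := exists_eq_of_continuousOn_closedBall hd'0
    (F := fun y => -g (G (f a + y)))
    (hg.comp (by fun_prop) hGmem).neg fun y hy => by
      rw [mem_closedBall_zero_iff, norm_neg]
      exact (hmax (hGmem y hy)).trans hzd.le
  obtain ⟨x, hx, hxy, hGx⟩ := hpre y hy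
  refine ⟨x, hx, ?_⟩
  rw [hGx] at hfix
  rw [hxy, ← hfix, neg_add_cancel_right]

end NormedSpace

/-- Existence part of Lemma 4.5, with the Brouwer degree condition realized by injectivity:
the perturbed frequency equation `ω(r̂) + g(r̂) = p` is solvable in the open ℓ¹-ball
`B(r₀,δ)` for any continuous perturbation `g` smaller than the distance `d` from
`p = ω(r₀)` to `ω(∂B̄(r₀,δ))`. -/
theorem frequency_equation_solvable_of_injective
    (n : ℕ) (hn : 1 ≤ n) (K : Set (Fin n → ℝ)) (hK : IsCompact K)
    (ω : (Fin n → ℝ) → (Fin n → ℝ)) (hωc : ContinuousOn ω K) (hωi : Set.InjOn ω K)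
    (r₀ : Fin n → ℝ) (hr₀ : r₀ ∈ interior K)
    (p : Fin n → ℝ) (hp : p = ω r₀)
    (δ : ℝ) (hδ : 0 < δ)
    (hball : {r : Fin n → ℝ | (∑ i, |r i - r₀ i|) ≤ δ} ⊆ K)
    (d : ℝ)
    (hd : d = sInf {t : ℝ | ∃ r : Fin n → ℝ,
      (∑ i, |r i - r₀ i|) = δ ∧ t = ∑ i, |p i - ω r i|}) :
    0 < d ∧
    ∀ g : (Fin n → ℝ) → (Fin n → ℝ),
      ContinuousOn g {r : Fin n → ℝ | (∑ i, |r i - r₀ i|) ≤ δ} →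
      (∀ r : Fin n → ℝ, (∑ i, |r i - r₀ i|) ≤ δ → (∑ i, |g r i|) < d) →
      ∃ rhat : Fin n → ℝ, (∑ i, |rhat i - r₀ i|) < δ ∧ ω rhat + g rhat = p := by
  let E := PiLp 1 fun _ : Fin n => ℝ
  let φ : E ≃L[ℝ] (Fin n → ℝ) := PiLp.continuousLinearEquiv 1 ℝ fun _ : Fin n => ℝ
  have hnorm : ∀ x : E, ‖x‖ = ∑ i, |φ x i| := fun x => PiLp.norm_eq_of_L1 x
  have hdist : ∀ x y : E, dist x y = ∑ i, |φ x i - φ y i| := fun x y => by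
    rw [dist_eq_norm, hnorm, map_sub]
    rfl
  have hn' : Nonempty (Fin n) := ⟨⟨0, hn⟩⟩
  have : Nontrivial E := φ.toEquiv.nontrivial
  set a : E := φ.symm r₀ with ha
  have hφa : φ a = r₀ := φ.apply_symm_apply r₀
  set f : E → E := fun x => φ.symm (ω (φ x)) with hfdef
  have hφf : ∀ x, φ (f x) = ω (φ x) := fun x => φ.apply_symm_apply _
  have hmem : ∀ x ∈ closedBall a δ, ∑ i, |φ x i - r₀ i| ≤ δ := by
    intro x hx
    rwa [mem_closedBall, hdist, hφa] at hx
  have hmaps : MapsTo φ (closedBall a δ) K := fun x hx => hball (hmem x hx)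
  have hf : ContinuousOn f (closedBall a δ) :=
    φ.symm.continuous.comp_continuousOn (hωc.comp φ.continuous.continuousOn hmaps)
  have hinj : InjOn f (closedBall a δ) := fun x hx y hy hxy =>
    φ.injective (hωi (hmaps hx) (hmaps hy) (φ.symm.injective hxy))
  have hset : {t : ℝ | ∃ r : Fin n → ℝ,
      (∑ i, |r i - r₀ i|) = δ ∧ t = ∑ i, |p i - ω r i|}
      = (fun x => dist (f x) (f a)) '' sphere a δ := by
    ext t
    constructor
    · rintro ⟨r, hr, rfl⟩
      refine ⟨φ.symm r, ?_, ?_⟩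
      · rw [mem_sphere, hdist, hφa, φ.apply_symm_apply, hr]
      · simp only
        rw [dist_comm, hdist, hφf, hφf, hφa, φ.apply_symm_apply, hp]
    · rintro ⟨x, hx, rfl⟩
      refine ⟨φ x, ?_, ?_⟩
      · rwa [mem_sphere, hdist, hφa] at hx
      · simp only
        rw [dist_comm, hdist, hφf, hφf, hφa, hp]
  rw [hset] at hd
  have hcompact : IsCompact ((fun x => dist (f x) (f a)) '' sphere a δ) :=
    (isCompact_sphere a δ).image_of_continuousOn
      (continuous_dist.comp_continuousOn
        ((hf.mono sphere_subset_closedBall).prodMk continuousOn_const))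
  have hdle : ∀ x ∈ sphere a δ, d ≤ dist (f x) (f a) := fun x hx =>
    hd ▸ csInf_le hcompact.bddBelow (mem_image_of_mem _ hx)
  refine ⟨?_, fun g hg hgd => ?_⟩
  · obtain ⟨x, hx, hxd⟩ := hcompact.sInf_mem ((NormedSpace.sphere_nonempty.2 hδ.le).image _)
    rw [hd, ← hxd]
    refine dist_pos.2 fun h => ?_
    have := hinj (sphere_subset_closedBall hx) (mem_closedBall_self hδ.le) h
    rw [this, mem_sphere, dist_self] at hx
    exact hδ.ne hx
  · obtain ⟨x, hx, hxp⟩ := exists_add_eq_of_injOn_closedBall hδ hf hinj hdle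
      (g := fun x => φ.symm (g (φ x)))
      (φ.symm.continuous.comp_continuousOn (hg.comp φ.continuous.continuousOn hmem))
      fun x hx => by
        rw [hnorm, φ.apply_symm_apply]
        exact hgd _ (hmem x hx)
    refine ⟨φ x, ?_, ?_⟩
    · rwa [mem_ball, hdist, hφa] at hx
    · have := congrArg φ hxp
      rwa [map_add, hφf, hφf, φ.apply_symm_apply, hφa, ← hp] at this
end
end
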